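/- Let N ≥ 3 be an integer, let a, b > −2, and let p ≥ q > 0 with pq > 1. Assume that N/(p+1) + N/(q+1) > N−2 and that 2(p+1)/(pq−1) > N−3. Then there exists a constant C > 0, depending only on N, p, q, a, b, such that for every ρ > 0 and every positive solution (u, v) of the Hardy–Hénon system on the punctured ball Ω = {x ∈ ℝ^N : 0 < |x| < ρ}, one has u(x) ≤ C |x|^{−α − (a+bp)/(pq−1)} and v(x) ≤ C |x|^{−β − (b+aq)/(pq−1)} for all x with 0 < |x| < ρ/2. -/

import Mathlib

open MeasureTheory Metric Set Filter

/-- The Euclidean Laplacian of `u : ℝ^N → ℝ`, as the sum of the second derivatives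
along the standard coordinate directions. -/
noncomputable def lap {N : ℕ} (u : EuclideanSpace ℝ (Fin N) → ℝ)
    (x : EuclideanSpace ℝ (Fin N)) : ℝ :=
  ∑ i : Fin N, iteratedFDeriv ℝ 2 u x ![EuclideanSpace.single i 1, EuclideanSpace.single i 1]

/-- `(u, v)` is a positive solution of the Hardy–Hénon system
`-Δu = |x|^a v^p`, `-Δv = |x|^b u^q` on the set `Ω`:
`u, v` are continuous on `Ω`, `C²` on `Ω \ {0}`, positive on `Ω`, and
the equations hold on `Ω \ {0}`. -/
def IsHHSol {N : ℕ} (a b p q : ℝ) (Ω : Set (EuclideanSpace ℝ (Fin N)))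
    (u v : EuclideanSpace ℝ (Fin N) → ℝ) : Prop :=
  ContinuousOn u Ω ∧ ContinuousOn v Ω ∧
  ContDiffOn ℝ 2 u (Ω \ {0}) ∧ ContDiffOn ℝ 2 v (Ω \ {0}) ∧
  (∀ x ∈ Ω, 0 < u x) ∧ (∀ x ∈ Ω, 0 < v x) ∧
  (∀ x ∈ Ω \ {0}, -lap u x = ‖x‖ ^ a * v x ^ p) ∧
  (∀ x ∈ Ω \ {0}, -lap v x = ‖x‖ ^ b * u x ^ q)

section TruncatedPower

theorem hasDerivAt_ite_le {f f' : ℝ → ℝ} {a t : ℝ} (hf : HasDerivAt f (f' t) t)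
    (h0 : f a = 0) (h1 : f' a = 0) :
    HasDerivAt (fun t => if t ≤ a then f t else 0) (if t ≤ a then f' t else 0) t := by
  rcases lt_trichotomy t a with h | h | h
  · rw [if_pos h.le]
    refine hf.congr_of_eventuallyEq ?_
    filter_upwards [Iio_mem_nhds h] with s hs
    rw [if_pos (le_of_lt hs)]
  · subst h
    rw [if_pos le_rfl]
    have hl : HasDerivWithinAt (fun s => if s ≤ t then f s else 0) (f' t) (Iic t) t :=
      hf.hasDerivWithinAt.congr (fun s hs => if_pos hs) (if_pos le_rfl)
    have hr : HasDerivWithinAt (fun s => if s ≤ t then f s else 0) (f' t) (Ici t) t := by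
      rw [h1]
      refine (hasDerivWithinAt_const t (Ici t) (0 : ℝ)).congr (fun s hs => ?_) ?_
      · by_cases hst : s ≤ t
        · rw [if_pos hst, le_antisymm hst hs, h0]
        · rw [if_neg hst]
      · rw [if_pos le_rfl, h0]
    have := hl.union hr
    rwa [Iic_union_Ici, hasDerivWithinAt_univ] at this
  · rw [if_neg (not_le.2 h)]
    refine (hasDerivAt_const t (0 : ℝ)).congr_of_eventuallyEq ?_
    filter_upwards [Ioi_mem_nhds h] with s hs
    rw [if_neg (not_le.2 hs)]

/-- The power `t ^ s` minus its third order Taylor polynomial at `1`. -/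
noncomputable def powRem (s t : ℝ) : ℝ :=
  t ^ s - 1 - s * (t - 1) - s * (s - 1) / 2 * (t - 1) ^ 2
    - s * (s - 1) * (s - 2) / 6 * (t - 1) ^ 3

noncomputable def powRem₁ (s t : ℝ) : ℝ :=
  s * (t ^ (s - 1) - 1 - (s - 1) * (t - 1) - (s - 1) * (s - 2) / 2 * (t - 1) ^ 2)

noncomputable def powRem₂ (s t : ℝ) : ℝ :=
  s * (s - 1) * (t ^ (s - 2) - 1 - (s - 2) * (t - 1))

noncomputable def powRem₃ (s t : ℝ) : ℝ :=
  s * (s - 1) * (s - 2) * (t ^ (s - 3) - 1)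

theorem hasDerivAt_powRem (s : ℝ) {t : ℝ} (ht : 0 < t) :
    HasDerivAt (powRem s) (powRem₁ s t) t := by
  have h1 := Real.hasDerivAt_rpow_const (x := t) (p := s) (Or.inl ht.ne')
  have h2 := (hasDerivAt_id t).sub_const 1
  have := (((h1.sub_const 1).sub (h2.const_mul s)).sub
    ((h2.pow 2).const_mul (s * (s - 1) / 2))).sub ((h2.pow 3).const_mul (s * (s - 1) * (s - 2) / 6))
  refine this.congr_deriv ?_
  simp only [powRem₁, id]
  push_cast
  ring

theorem hasDerivAt_powRem₁ (s : ℝ) {t : ℝ} (ht : 0 < t) :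
    HasDerivAt (powRem₁ s) (powRem₂ s t) t := by
  have h1 := Real.hasDerivAt_rpow_const (x := t) (p := s - 1) (Or.inl ht.ne')
  have h2 := (hasDerivAt_id t).sub_const 1
  have := (((h1.sub_const 1).sub (h2.const_mul (s - 1))).sub
    ((h2.pow 2).const_mul ((s - 1) * (s - 2) / 2))).const_mul s
  refine this.congr_deriv ?_
  simp only [powRem₂, id]
  rw [show s - 1 - 1 = s - 2 by ring]
  push_cast
  ring

theorem hasDerivAt_powRem₂ (s : ℝ) {t : ℝ} (ht : 0 < t) :
    HasDerivAt (powRem₂ s) (powRem₃ s t) t := by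
  have h1 := Real.hasDerivAt_rpow_const (x := t) (p := s - 2) (Or.inl ht.ne')
  have h2 := (hasDerivAt_id t).sub_const 1
  have := ((h1.sub_const 1).sub (h2.const_mul (s - 2))).const_mul (s * (s - 1))
  refine this.congr_deriv ?_
  simp only [powRem₃]
  rw [show s - 2 - 1 = s - 3 by ring]
  ring

theorem nonneg_of_deriv_nonpos {f f' : ℝ → ℝ} (hf : ∀ t, 0 < t → HasDerivAt f (f' t) t)
    (hf' : ∀ t, 0 < t → t ≤ 1 → f' t ≤ 0) (h1 : f 1 = 0) {t : ℝ} (ht : 0 < t) (ht1 : t ≤ 1) :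
    0 ≤ f t := by
  have hanti : AntitoneOn f (Icc t 1) := by
    refine antitoneOn_of_deriv_nonpos (convex_Icc t 1) ?_ ?_ ?_
    · exact fun x hx => (hf x (ht.trans_le hx.1)).continuousAt.continuousWithinAt
    · intro x hx
      rw [interior_Icc] at hx
      exact (hf x (ht.trans hx.1)).differentiableAt.differentiableWithinAt
    · intro x hx
      rw [interior_Icc] at hx
      rw [(hf x (ht.trans hx.1)).deriv]
      exact hf' x (ht.trans hx.1) hx.2.le
  rw [← h1]
  exact hanti ⟨le_rfl, ht1⟩ ⟨ht1, le_rfl⟩ ht1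

theorem powRem_one (s : ℝ) : powRem s 1 = 0 := by simp [powRem]
theorem powRem₁_one (s : ℝ) : powRem₁ s 1 = 0 := by simp [powRem₁]
theorem powRem₂_one (s : ℝ) : powRem₂ s 1 = 0 := by simp [powRem₂]

variable {s t : ℝ}

theorem powRem₃_nonpos (hs : s < 0) (ht : 0 < t) (ht1 : t ≤ 1) : powRem₃ s t ≤ 0 := by
  have h1 : 1 ≤ t ^ (s - 3) := Real.one_le_rpow_of_pos_of_le_one_of_nonpos ht ht1 (by linarith)
  have h2 : s * (s - 1) * (s - 2) ≤ 0 :=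
    mul_nonpos_of_nonneg_of_nonpos (by nlinarith) (by linarith)
  exact mul_nonpos_of_nonpos_of_nonneg h2 (by linarith)

theorem powRem₂_nonneg (hs : s < 0) (ht : 0 < t) (ht1 : t ≤ 1) : 0 ≤ powRem₂ s t :=
  nonneg_of_deriv_nonpos (fun _ h => hasDerivAt_powRem₂ s h)
    (fun _ h h' => powRem₃_nonpos hs h h') (powRem₂_one s) ht ht1

theorem powRem₁_nonpos (hs : s < 0) (ht : 0 < t) (ht1 : t ≤ 1) : powRem₁ s t ≤ 0 := by
  have := nonneg_of_deriv_nonpos (fun _ h => (hasDerivAt_powRem₁ s h).neg)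
    (fun _ h h' => neg_nonpos.2 (powRem₂_nonneg hs h h')) (by simp [powRem₁_one]) ht ht1
  simpa using this

theorem powRem_nonneg (hs : s < 0) (ht : 0 < t) (ht1 : t ≤ 1) : 0 ≤ powRem s t :=
  nonneg_of_deriv_nonpos (fun _ h => hasDerivAt_powRem s h)
    (fun _ h h' => powRem₁_nonpos hs h h') (powRem_one s) ht ht1

theorem powRem_antitone (hs : s < 0) {t' : ℝ} (ht : 0 < t) (htt : t ≤ t') (ht1 : t' ≤ 1) :
    powRem s t' ≤ powRem s t := by
  have hanti : AntitoneOn (powRem s) (Icc t t') := by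
    refine antitoneOn_of_deriv_nonpos (convex_Icc t t') ?_ ?_ ?_
    · exact fun x hx => (hasDerivAt_powRem s (ht.trans_le hx.1)).continuousAt.continuousWithinAt
    · intro x hx
      rw [interior_Icc] at hx
      exact (hasDerivAt_powRem s (ht.trans hx.1)).differentiableAt.differentiableWithinAt
    · intro x hx
      rw [interior_Icc] at hx
      rw [(hasDerivAt_powRem s (ht.trans hx.1)).deriv]
      exact powRem₁_nonpos hs (ht.trans hx.1) (hx.2.le.trans ht1)
  exact hanti ⟨le_rfl, htt⟩ ⟨htt, le_rfl⟩ htt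

theorem powRem_half_pos (hs : s < 0) : 0 < powRem s (1 / 2) := by
  have h : 0 < s * (s - 1) * ((s - 2) * (s - 3)) := mul_pos (by nlinarith) (by nlinarith)
  have key : ∀ t : ℝ, 0 < t → t ≤ 1 →
      s * (s - 1) * ((s - 2) * (s - 3)) * (1 - t) ≤ - powRem₃ s t := by
    intro t ht ht1
    have := one_add_mul_self_le_rpow_one_add (s := 1 / t - 1) (p := 3 - s)
      (by have : 0 < 1 / t := by positivity
          linarith) (by linarith)
    rw [show 1 + (1 / t - 1) = t⁻¹ by simp, Real.inv_rpow ht.le, ← Real.rpow_neg ht.le, neg_sub]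
      at this
    have h3 : 1 - t ≤ 1 / t - 1 := by
      rw [le_sub_iff_add_le, le_div_iff₀ ht]; nlinarith [sq_nonneg (t - 1)]
    have h4 : (3 - s) * (1 - t) ≤ (3 - s) * (1 / t - 1) :=
      mul_le_mul_of_nonneg_left h3 (by linarith)
    have h5 : 0 < s * (s - 1) * (2 - s) := mul_pos (by nlinarith) (by linarith)
    unfold powRem₃
    nlinarith [mul_le_mul_of_nonneg_left (h4.trans (le_sub_iff_add_le'.2 this)) h5.le]
  set K := s * (s - 1) * ((s - 2) * (s - 3)) with hK
  have d (k : ℕ) (t : ℝ) : HasDerivAt (fun t : ℝ => (1 - t) ^ (k + 1)) (-((k + 1) * (1 - t) ^ k)) t := by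
    have := ((hasDerivAt_id t).const_sub 1).pow (k + 1)
    refine this.congr_deriv ?_
    simp
  have e2 : ∀ t, 0 < t → t ≤ 1 → 0 ≤ powRem₂ s t - K / 2 * (1 - t) ^ 2 := fun t =>
    nonneg_of_deriv_nonpos (f := fun t => powRem₂ s t - K / 2 * (1 - t) ^ 2)
      (f' := fun t => powRem₃ s t + K * (1 - t)) (fun t ht =>
      ((hasDerivAt_powRem₂ s ht).sub ((d 1 t).const_mul (K / 2))).congr_deriv (by push_cast; ring))
      (fun t ht ht1 => by linarith [key t ht ht1]) (by simp [powRem₂_one])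
  have e1 : ∀ t, 0 < t → t ≤ 1 → 0 ≤ - powRem₁ s t - K / 6 * (1 - t) ^ 3 := fun t =>
    nonneg_of_deriv_nonpos (f := fun t => - powRem₁ s t - K / 6 * (1 - t) ^ 3)
      (f' := fun t => - powRem₂ s t + K / 2 * (1 - t) ^ 2) (fun t ht =>
      ((hasDerivAt_powRem₁ s ht).neg.sub ((d 2 t).const_mul (K / 6))).congr_deriv
        (by push_cast; ring))
      (fun t ht ht1 => by linarith [e2 t ht ht1]) (by simp [powRem₁_one])
  have e0 : ∀ t, 0 < t → t ≤ 1 → 0 ≤ powRem s t - K / 24 * (1 - t) ^ 4 := fun t =>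
    nonneg_of_deriv_nonpos (f := fun t => powRem s t - K / 24 * (1 - t) ^ 4)
      (f' := fun t => powRem₁ s t + K / 6 * (1 - t) ^ 3) (fun t ht =>
      ((hasDerivAt_powRem s ht).sub ((d 3 t).const_mul (K / 24))).congr_deriv
        (by push_cast; ring))
      (fun t ht ht1 => by linarith [e1 t ht ht1]) (by simp [powRem_one])
  have := e0 (1 / 2) (by norm_num) (by norm_num)
  norm_num at this ⊢
  linarith

theorem powRem_le (hs : s < 0) (ht1 : t ≤ 1) : powRem s t ≤ t ^ s := by
  unfold powRem
  have h1 : 0 ≤ -s * (1 - t) := mul_nonneg (by linarith) (by linarith)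
  have h2 : 0 ≤ s * (s - 1) := by nlinarith
  have h3 : 0 ≤ s * (s - 1) / 2 * (t - 1) ^ 2 := by positivity
  have h4 : 0 ≤ (s * (s - 1)) * (2 - s) * (1 - t) ^ 3 :=
    mul_nonneg (mul_nonneg h2 (by linarith)) (pow_nonneg (by linarith) 3)
  nlinarith

theorem neg_powRem₁_le (hs : s < 0) (ht1 : t ≤ 1) :
    - powRem₁ s t ≤ -s * t ^ (s - 1) := by
  unfold powRem₁
  have h1 : 0 ≤ (1 - s) * (1 - t) := mul_nonneg (by linarith) (by linarith)
  have h2 : 0 ≤ (1 - s) * (2 - s) := by nlinarith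
  have h3 : 0 ≤ (1 - s) * (2 - s) * (t - 1) ^ 2 := by positivity
  nlinarith

theorem powRem₂_le (hs : s < 0) (ht1 : t ≤ 1) :
    powRem₂ s t ≤ s * (s - 1) * t ^ (s - 2) := by
  unfold powRem₂
  have h1 : 0 ≤ (2 - s) * (1 - t) := mul_nonneg (by linarith) (by linarith)
  have h2 : 0 ≤ s * (s - 1) := by nlinarith
  nlinarith

theorem radial_powRem (ht : 0 < t) :
    4 * t * powRem₂ s t + 2 * (2 - 2 * s) * powRem₁ s t
      = (6 - 2 * s) * (s * (s - 1) * (2 - s)) * (1 - t) ^ 2 := by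
  unfold powRem₁ powRem₂
  rw [show s - 1 = (s - 2) + 1 by ring, Real.rpow_add_one ht.ne']
  ring

/-- A compactly supported truncation of the power `t ^ s`. -/
noncomputable def cutPow (s t : ℝ) : ℝ := if t ≤ 1 then powRem s t else 0

noncomputable def cutPow₁ (s t : ℝ) : ℝ := if t ≤ 1 then powRem₁ s t else 0

noncomputable def cutPow₂ (s t : ℝ) : ℝ := if t ≤ 1 then powRem₂ s t else 0

theorem hasDerivAt_cutPow (s : ℝ) {t : ℝ} (ht : 0 < t) :
    HasDerivAt (cutPow s) (cutPow₁ s t) t :=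
  hasDerivAt_ite_le (hasDerivAt_powRem s ht) (powRem_one s) (powRem₁_one s)

theorem hasDerivAt_cutPow₁ (s : ℝ) {t : ℝ} (ht : 0 < t) :
    HasDerivAt (cutPow₁ s) (cutPow₂ s t) t :=
  hasDerivAt_ite_le (hasDerivAt_powRem₁ s ht) (powRem₁_one s) (powRem₂_one s)

theorem contDiffOn_cutPow (s : ℝ) : ContDiffOn ℝ 2 (cutPow s) (Ioi 0) := by
  have hc : ContinuousOn (cutPow₂ s) (Ioi 0) := by
    intro t ht
    unfold cutPow₂
    refine ContinuousAt.continuousWithinAt ?_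
    have h := hasDerivAt_powRem₂ s ht
    by_cases h1 : t = 1
    · subst h1
      rw [Metric.continuousAt_iff]
      intro ε hε
      obtain ⟨δ, hδ, H⟩ := Metric.continuousAt_iff.1 h.continuousAt ε hε
      refine ⟨δ, hδ, fun x hx => ?_⟩
      have := H hx
      rw [powRem₂_one] at this
      rw [if_pos le_rfl, powRem₂_one]
      split_ifs
      · exact this
      · simpa using hε
    · rcases lt_or_gt_of_ne h1 with h1 | h1
      · refine h.continuousAt.congr ?_
        filter_upwards [Iio_mem_nhds h1] with x hx
        rw [if_pos (le_of_lt hx)]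
      · refine continuousAt_const.congr (f := fun _ => (0 : ℝ)) ?_
        filter_upwards [Ioi_mem_nhds h1] with x hx
        rw [if_neg (not_le.2 hx)]
  rw [show (2 : WithTop ℕ∞) = 1 + 1 by norm_num, contDiffOn_succ_iff_deriv_of_isOpen isOpen_Ioi]
  refine ⟨fun t ht => (hasDerivAt_cutPow s ht).differentiableAt.differentiableWithinAt, by simp, ?_⟩
  refine ContDiffOn.congr ?_ (fun t ht => (hasDerivAt_cutPow s ht).deriv)
  rw [show (1 : WithTop ℕ∞) = 0 + 1 by norm_num, contDiffOn_succ_iff_deriv_of_isOpen isOpen_Ioi]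
  refine ⟨fun t ht => (hasDerivAt_cutPow₁ s ht).differentiableAt.differentiableWithinAt, by simp, ?_⟩
  exact ContDiffOn.congr (contDiffOn_zero.2 hc) (fun t ht => (hasDerivAt_cutPow₁ s ht).deriv)

end TruncatedPower

section PartialDerivatives

variable {N : ℕ}

/-- The partial derivative of `f` in the `i`-th coordinate direction. -/
noncomputable def pd (i : Fin N) (f : EuclideanSpace ℝ (Fin N) → ℝ)
    (x : EuclideanSpace ℝ (Fin N)) : ℝ :=
  fderiv ℝ f x (EuclideanSpace.single i 1)

variable {f g u w : EuclideanSpace ℝ (Fin N) → ℝ} {x : EuclideanSpace ℝ (Fin N)}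

theorem contDiff_pd (hf : ContDiff ℝ 2 f) (i : Fin N) : ContDiff ℝ 1 (pd i f) :=
  (hf.fderiv_right (m := 1) (by norm_num)).clm_apply contDiff_const

theorem continuous_pd (hf : ContDiff ℝ 1 f) (i : Fin N) : Continuous (pd i f) :=
  (hf.continuous_fderiv one_ne_zero).clm_apply continuous_const

theorem pd_pd_apply (hf : ContDiff ℝ 2 f) (i j : Fin N) (x : EuclideanSpace ℝ (Fin N)) :
    pd i (pd j f) x = fderiv ℝ (fderiv ℝ f) x (EuclideanSpace.single i 1)
      (EuclideanSpace.single j 1) := by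
  have h : DifferentiableAt ℝ (fderiv ℝ f) x :=
    ((hf.fderiv_right (m := 1) (by norm_num)).differentiable (by norm_num)) x
  have : HasFDerivAt (pd j f) _ x :=
    h.hasFDerivAt.clm_apply (hasFDerivAt_const (EuclideanSpace.single j (1 : ℝ)) x)
  rw [pd, this.fderiv]
  simp

theorem pd_comm (hf : ContDiff ℝ 2 f) (i j : Fin N) : pd i (pd j f) = pd j (pd i f) := by
  funext x
  rw [pd_pd_apply hf, pd_pd_apply hf]
  exact (hf.contDiffAt.isSymmSndFDerivAt (by simp)) _ _

theorem lap_eq_sum_pd (hf : ContDiff ℝ 2 f) (x : EuclideanSpace ℝ (Fin N)) :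
    lap f x = ∑ i, pd i (pd i f) x := by
  unfold lap
  refine Finset.sum_congr rfl fun i _ => ?_
  rw [pd_pd_apply hf, iteratedFDeriv_two_apply]
  simp

theorem continuous_lap (hf : ContDiff ℝ 2 f) : Continuous (lap f) := by
  rw [show lap f = fun x => ∑ i, pd i (pd i f) x from funext fun x => lap_eq_sum_pd hf x]
  exact continuous_finsetSum _ fun i _ => continuous_pd (contDiff_pd hf i) i

theorem hasCompactSupport_pd (hf : HasCompactSupport f) (i : Fin N) :
    HasCompactSupport (pd i f) :=
  (hf.fderiv ℝ).comp_left (g := fun L : EuclideanSpace ℝ (Fin N) →L[ℝ] ℝ =>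
    L (EuclideanSpace.single i 1)) (by simp)

theorem integral_mul_pd (hg : ContDiff ℝ 1 g) (hgc : HasCompactSupport g) (hw : ContDiff ℝ 1 w)
    (i : Fin N) : ∫ x, g x * pd i w x = -∫ x, pd i g x * w x := by
  refine integral_mul_fderiv_eq_neg_fderiv_mul_of_integrable ?_ ?_ ?_
    (fun x _ => hg.differentiable one_ne_zero x) (fun x _ => hw.differentiable one_ne_zero x)
  · exact ((continuous_pd hg i).mul hw.continuous).integrable_of_hasCompactSupport
      (hasCompactSupport_pd hgc i).mul_right
  · exact (hg.continuous.mul (continuous_pd hw i)).integrable_of_hasCompactSupport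
      hgc.mul_right
  · exact (hg.continuous.mul hw.continuous).integrable_of_hasCompactSupport hgc.mul_right

theorem integrable_mul_of_hasCompactSupport (hg : Continuous g) (hgc : HasCompactSupport g)
    (hw : Continuous w) : Integrable fun x => g x * w x :=
  (hg.mul hw).integrable_of_hasCompactSupport hgc.mul_right

theorem integral_lap_mul (hg : ContDiff ℝ 2 g) (hgc : HasCompactSupport g)
    (hu : ContDiff ℝ 2 u) : ∫ x, lap g x * u x = ∫ x, g x * lap u x := by
  have hg1 : ContDiff ℝ 1 g := hg.of_le (by norm_num)
  have hu1 : ContDiff ℝ 1 u := hu.of_le (by norm_num)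
  simp only [lap_eq_sum_pd hg, lap_eq_sum_pd hu, Finset.sum_mul, Finset.mul_sum]
  rw [integral_finsetSum, integral_finsetSum]
  · refine Finset.sum_congr rfl fun i _ => ?_
    rw [integral_mul_pd hg1 hgc (contDiff_pd hu i), neg_eq_iff_eq_neg.1
      (integral_mul_pd (contDiff_pd hg i) (hasCompactSupport_pd hgc i) hu1 i).symm]
  · exact fun i _ => integrable_mul_of_hasCompactSupport hg.continuous hgc
      (continuous_pd (contDiff_pd hu i) i)
  · exact fun i _ => integrable_mul_of_hasCompactSupport
      (continuous_pd (contDiff_pd hg i) i)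
      (hasCompactSupport_pd (hasCompactSupport_pd hgc i) i) hu.continuous

theorem integral_lap_mul_pd (hg : ContDiff ℝ 2 g) (hgc : HasCompactSupport g)
    (hu : ContDiff ℝ 2 u) (i : Fin N) :
    ∫ x, lap g x * pd i u x = -∫ x, pd i g x * lap u x := by
  have hg1 : ContDiff ℝ 1 g := hg.of_le (by norm_num)
  have hu1 : ContDiff ℝ 1 u := hu.of_le (by norm_num)
  simp only [lap_eq_sum_pd hg, lap_eq_sum_pd hu, Finset.sum_mul, Finset.mul_sum]
  rw [integral_finsetSum, integral_finsetSum, ← Finset.sum_neg_distrib]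
  · refine Finset.sum_congr rfl fun j _ => ?_
    rw [neg_eq_iff_eq_neg.1 (integral_mul_pd (contDiff_pd hg j) (hasCompactSupport_pd hgc j)
      (contDiff_pd hu i) j).symm, pd_comm hu j i, integral_mul_pd (contDiff_pd hg j)
      (hasCompactSupport_pd hgc j) (contDiff_pd hu j) i, pd_comm hg i j,
      integral_mul_pd (contDiff_pd hg i) (hasCompactSupport_pd hgc i) (contDiff_pd hu j) j]
  · exact fun j _ => integrable_mul_of_hasCompactSupport (continuous_pd hg1 i)
      (hasCompactSupport_pd hgc i) (continuous_pd (contDiff_pd hu j) j)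
  · exact fun j _ => integrable_mul_of_hasCompactSupport
      (continuous_pd (contDiff_pd hg j) j)
      (hasCompactSupport_pd (hasCompactSupport_pd hgc j) j) (continuous_pd hu1 i)

theorem hasFDerivAt_radial {h : ℝ → ℝ} {h' ε : ℝ} {x z : EuclideanSpace ℝ (Fin N)}
    (hh : HasDerivAt h h' (‖z - x‖ ^ 2 + ε ^ 2)) :
    HasFDerivAt (fun z => h (‖z - x‖ ^ 2 + ε ^ 2)) (h' • (2 • innerSL ℝ (z - x))) z := by
  have h1 : HasFDerivAt (fun z => ‖z - x‖ ^ 2 + ε ^ 2) (2 • innerSL ℝ (z - x)) z := by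
    have := ((hasFDerivAt_id z).sub_const x).norm_sq
    refine (this.add_const (ε ^ 2)).congr_fderiv ?_
    ext; simp
  exact hh.comp_hasFDerivAt z h1

theorem pd_radial {h : ℝ → ℝ} {h' ε : ℝ} {x z : EuclideanSpace ℝ (Fin N)}
    (hh : HasDerivAt h h' (‖z - x‖ ^ 2 + ε ^ 2)) (i : Fin N) :
    pd i (fun z => h (‖z - x‖ ^ 2 + ε ^ 2)) z = 2 * (z i - x i) * h' := by
  rw [pd, (hasFDerivAt_radial hh).fderiv]
  simp [EuclideanSpace.inner_single_right]
  ring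

end PartialDerivatives

section Kernel

/-- The square of the positive part of `1 - t`. -/
noncomputable def sqCut (t : ℝ) : ℝ := if t ≤ 1 then (1 - t) ^ 2 else 0

noncomputable def sqCut' (t : ℝ) : ℝ := if t ≤ 1 then -2 * (1 - t) else 0

theorem hasDerivAt_sqCut (t : ℝ) : HasDerivAt sqCut (sqCut' t) t := by
  refine hasDerivAt_ite_le (f' := fun t => -2 * (1 - t)) ?_ (by simp) (by simp)
  refine (((hasDerivAt_id t).const_sub 1).pow 2).congr_deriv ?_
  simp

theorem continuous_sqCut' : Continuous sqCut' := by
  have : sqCut' = fun t => -2 * max (1 - t) 0 := by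
    funext t
    unfold sqCut'
    split_ifs with h
    · rw [max_eq_left (by linarith)]
    · rw [max_eq_right (by linarith)]; ring
  rw [this]
  fun_prop

theorem contDiff_sqCut : ContDiff ℝ 1 sqCut := by
  rw [contDiff_one_iff_deriv]
  refine ⟨fun t => (hasDerivAt_sqCut t).differentiableAt, ?_⟩
  rw [show deriv sqCut = sqCut' from funext fun t => (hasDerivAt_sqCut t).deriv]
  exact continuous_sqCut'

theorem sqCut_nonneg (t : ℝ) : 0 ≤ sqCut t := by
  unfold sqCut; split_ifs <;> positivity

theorem sqCut_le_one {t : ℝ} (ht : 0 ≤ t) : sqCut t ≤ 1 := by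
  unfold sqCut
  split_ifs with h
  · nlinarith
  · norm_num

theorem abs_sqCut'_le {t : ℝ} (ht : 0 ≤ t) : |sqCut' t| ≤ 2 := by
  unfold sqCut'
  split_ifs with h
  · rw [abs_le]; constructor <;> linarith
  · norm_num

variable {N : ℕ}

/-- A smooth approximation of a multiple of the Green function of the unit ball centered
at `x`. -/
noncomputable def greenApprox (ε : ℝ) (x z : EuclideanSpace ℝ (Fin N)) : ℝ :=
  cutPow ((2 - N) / 2) (‖z - x‖ ^ 2 + ε ^ 2)

/-- The regular part of the Laplacian of `greenApprox`, up to a constant factor. -/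
noncomputable def regApprox (ε : ℝ) (x z : EuclideanSpace ℝ (Fin N)) : ℝ :=
  sqCut (‖z - x‖ ^ 2 + ε ^ 2)

/-- The concentrating part of minus the Laplacian of `greenApprox`. -/
noncomputable def peakApprox (ε : ℝ) (x z : EuclideanSpace ℝ (Fin N)) : ℝ :=
  4 * ε ^ 2 * cutPow₂ ((2 - N) / 2) (‖z - x‖ ^ 2 + ε ^ 2)

/-- The constant in front of `regApprox` in the Laplacian of `greenApprox`. -/
noncomputable def regConst (N : ℕ) : ℝ :=
  (6 - 2 * ((2 - N) / 2)) * ((2 - N) / 2 * ((2 - N) / 2 - 1) * (2 - (2 - N) / 2))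

theorem half_two_sub_neg (hN : 3 ≤ N) : ((2 : ℝ) - N) / 2 < 0 := by
  have : (3 : ℝ) ≤ N := by exact_mod_cast hN
  linarith

theorem regConst_pos (hN : 3 ≤ N) : 0 < regConst N := by
  have h := half_two_sub_neg hN
  unfold regConst
  exact mul_pos (by linarith) (mul_pos (mul_pos_of_neg_of_neg h (by linarith)) (by linarith))

variable {ε : ℝ} {x z : EuclideanSpace ℝ (Fin N)}

theorem sq_add_sq_pos (hε : 0 < ε) : 0 < ‖z - x‖ ^ 2 + ε ^ 2 := by positivity

theorem not_sq_add_sq_le (h : z ∉ closedBall x 1) : ¬ ‖z - x‖ ^ 2 + ε ^ 2 ≤ 1 := by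
  rw [mem_closedBall, dist_eq_norm, not_le] at h
  nlinarith [sq_nonneg ε]

theorem contDiff_greenApprox (hε : 0 < ε) (x : EuclideanSpace ℝ (Fin N)) :
    ContDiff ℝ 2 (greenApprox ε x) :=
  (contDiffOn_cutPow _).comp_contDiff
    (((contDiff_id.sub contDiff_const).norm_sq ℝ).add contDiff_const)
    (fun _ => sq_add_sq_pos hε)

theorem hasCompactSupport_greenApprox (ε : ℝ) (x : EuclideanSpace ℝ (Fin N)) :
    HasCompactSupport (greenApprox ε x) :=
  HasCompactSupport.intro (isCompact_closedBall x 1)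
    (fun _ hz => if_neg (not_sq_add_sq_le hz))

theorem contDiff_regApprox (ε : ℝ) (x : EuclideanSpace ℝ (Fin N)) :
    ContDiff ℝ 1 (regApprox ε x) :=
  contDiff_sqCut.comp (((contDiff_id.sub contDiff_const).norm_sq ℝ).add contDiff_const)

theorem regApprox_eq_zero (h : z ∉ closedBall x 1) : regApprox ε x z = 0 :=
  if_neg (not_sq_add_sq_le h)

theorem hasCompactSupport_regApprox (ε : ℝ) (x : EuclideanSpace ℝ (Fin N)) :
    HasCompactSupport (regApprox ε x) :=
  HasCompactSupport.intro (isCompact_closedBall x 1) (fun _ hz => regApprox_eq_zero hz)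

theorem pd_greenApprox (hε : 0 < ε) (i : Fin N) (x z : EuclideanSpace ℝ (Fin N)) :
    pd i (greenApprox ε x) z = 2 * (z i - x i) * cutPow₁ ((2 - N) / 2) (‖z - x‖ ^ 2 + ε ^ 2) :=
  pd_radial (hasDerivAt_cutPow _ (sq_add_sq_pos hε)) i

theorem lap_greenApprox (hε : 0 < ε) (x z : EuclideanSpace ℝ (Fin N)) :
    lap (greenApprox ε x) z = regConst N * regApprox ε x z - peakApprox ε x z := by
  rw [lap_eq_sum_pd (contDiff_greenApprox hε x)]
  set s : ℝ := (2 - N) / 2 with hs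
  set t := ‖z - x‖ ^ 2 + ε ^ 2 with ht
  have h0 : 0 < t := sq_add_sq_pos hε
  have key : ∀ i, pd i (pd i (greenApprox ε x)) z
      = 2 * cutPow₁ s t + 4 * (z i - x i) ^ 2 * cutPow₂ s t := by
    intro i
    rw [show pd i (greenApprox ε x) = _ from funext fun z => pd_greenApprox hε i x z]
    have h1 : HasFDerivAt (fun z : EuclideanSpace ℝ (Fin N) => 2 * (z i - x i))
        ((2 : ℝ) • (EuclideanSpace.proj i : EuclideanSpace ℝ (Fin N) →L[ℝ] ℝ)) z :=
      (((EuclideanSpace.proj i : EuclideanSpace ℝ (Fin N) →L[ℝ] ℝ).hasFDerivAt).sub_const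
        (x i)).const_mul 2
    have h2 := h1.mul (hasFDerivAt_radial (x := x) (z := z) (hasDerivAt_cutPow₁ s h0))
    have h3 : pd i (fun z => 2 * (z i - x i) * cutPow₁ s (‖z - x‖ ^ 2 + ε ^ 2)) z = _ :=
      congrArg (fun L => L (EuclideanSpace.single i (1 : ℝ))) h2.fderiv
    rw [h3]
    simp [EuclideanSpace.inner_single_right, ← ht]
    ring
  simp only [key, Finset.sum_add_distrib, ← Finset.sum_mul, ← Finset.mul_sum]
  have hn : ∑ i, (z i - x i) ^ 2 = t - ε ^ 2 := by
    rw [ht, EuclideanSpace.norm_sq_eq]; simp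
  rw [hn]
  have hNs : (N : ℝ) = 2 - 2 * s := by rw [hs]; ring
  simp only [Finset.sum_const, Finset.card_univ, Fintype.card_fin, nsmul_eq_mul]
  unfold regApprox peakApprox regConst
  rw [← ht, ← hs, hNs]
  by_cases h1 : t ≤ 1
  · simp only [cutPow₁, cutPow₂, sqCut, if_pos h1]
    linarith [radial_powRem (s := s) h0]
  · simp [cutPow₁, cutPow₂, sqCut, if_neg h1]

theorem peakApprox_eq (hε : 0 < ε) (x z : EuclideanSpace ℝ (Fin N)) :
    peakApprox ε x z = regConst N * regApprox ε x z - lap (greenApprox ε x) z := by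
  rw [lap_greenApprox hε]; ring

theorem continuous_peakApprox (hε : 0 < ε) (x : EuclideanSpace ℝ (Fin N)) :
    Continuous (peakApprox ε x) := by
  rw [show peakApprox ε x = _ from funext (peakApprox_eq hε x)]
  exact ((contDiff_regApprox ε x).continuous.const_mul _).sub
    (continuous_lap (contDiff_greenApprox hε x))

theorem peakApprox_eq_zero (h : z ∉ closedBall x 1) : peakApprox ε x z = 0 := by
  simp [peakApprox, cutPow₂, if_neg (not_sq_add_sq_le h)]

theorem hasCompactSupport_peakApprox (ε : ℝ) (x : EuclideanSpace ℝ (Fin N)) :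
    HasCompactSupport (peakApprox ε x) :=
  HasCompactSupport.intro (isCompact_closedBall x 1) (fun _ hz => peakApprox_eq_zero hz)

theorem peakApprox_nonneg (hN : 3 ≤ N) (hε : 0 < ε) (x z : EuclideanSpace ℝ (Fin N)) :
    0 ≤ peakApprox ε x z := by
  unfold peakApprox cutPow₂
  split_ifs with h
  · exact mul_nonneg (by positivity) (powRem₂_nonneg (half_two_sub_neg hN) (sq_add_sq_pos hε) h)
  · simp

theorem peakApprox_le (hN : 3 ≤ N) (hε : 0 < ε) {δ : ℝ} (hδ : 0 < δ) (h : δ ≤ ‖z - x‖) :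
    peakApprox ε x z ≤ 4 * ε ^ 2 *
      ((2 - N) / 2 * ((2 - N) / 2 - 1) * (δ ^ 2) ^ (((2 : ℝ) - N) / 2 - 2)) := by
  have hs := half_two_sub_neg hN
  unfold peakApprox cutPow₂
  refine mul_le_mul_of_nonneg_left ?_ (by positivity)
  have h2 : (0 : ℝ) ≤ (2 - N) / 2 * ((2 - N) / 2 - 1) := by nlinarith
  split_ifs with h1
  · refine (powRem₂_le hs h1).trans (mul_le_mul_of_nonneg_left ?_ h2)
    refine Real.rpow_le_rpow_of_nonpos (by positivity) ?_ (by linarith)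
    nlinarith [sq_nonneg ε]
  · positivity

theorem integral_peakApprox_mul (hε : 0 < ε) (x : EuclideanSpace ℝ (Fin N))
    {u : EuclideanSpace ℝ (Fin N) → ℝ} (hu : ContDiff ℝ 2 u) :
    ∫ z, peakApprox ε x z * u z
      = regConst N * (∫ z, regApprox ε x z * u z) + ∫ z, greenApprox ε x z * -lap u z := by
  have hG := contDiff_greenApprox hε x
  have h := integral_lap_mul hG (hasCompactSupport_greenApprox ε x) hu
  simp only [mul_neg, integral_neg, ← h]
  rw [← integral_const_mul, ← sub_eq_add_neg, ← integral_sub]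
  · refine integral_congr_ae (Eventually.of_forall fun z => ?_)
    simp only [peakApprox_eq hε]; ring
  · exact (integrable_mul_of_hasCompactSupport (contDiff_regApprox ε x).continuous
      (hasCompactSupport_regApprox ε x) hu.continuous).const_mul _
  · have : lap (greenApprox ε x) = fun z => regConst N * regApprox ε x z - peakApprox ε x z :=
      funext (lap_greenApprox hε x)
    refine integrable_mul_of_hasCompactSupport (continuous_lap hG) ?_ hu.continuous
    rw [this]
    exact (hasCompactSupport_regApprox ε x).mul_left.sub (hasCompactSupport_peakApprox ε x)

theorem integral_peakApprox_mul_pd (hε : 0 < ε) (x : EuclideanSpace ℝ (Fin N))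
    {u : EuclideanSpace ℝ (Fin N) → ℝ} (hu : ContDiff ℝ 2 u) (i : Fin N) :
    ∫ z, peakApprox ε x z * pd i u z
      = -(regConst N * ∫ z, pd i (regApprox ε x) z * u z)
        - ∫ z, pd i (greenApprox ε x) z * -lap u z := by
  have hG := contDiff_greenApprox hε x
  have hu1 : ContDiff ℝ 1 u := hu.of_le (by norm_num)
  have h := integral_lap_mul_pd hG (hasCompactSupport_greenApprox ε x) hu i
  have h' := integral_mul_pd (contDiff_regApprox ε x) (hasCompactSupport_regApprox ε x) hu1 i
  simp only [mul_neg, integral_neg, ← h]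
  rw [← mul_neg, ← h', ← integral_const_mul, ← integral_sub]
  · refine integral_congr_ae (Eventually.of_forall fun z => ?_)
    simp only [peakApprox_eq hε]; ring
  · exact (integrable_mul_of_hasCompactSupport (contDiff_regApprox ε x).continuous
      (hasCompactSupport_regApprox ε x) (continuous_pd hu1 i)).const_mul _
  · have : lap (greenApprox ε x) = fun z => regConst N * regApprox ε x z - peakApprox ε x z :=
      funext (lap_greenApprox hε x)
    refine integrable_mul_of_hasCompactSupport (continuous_lap hG) ?_ (continuous_pd hu1 i)
    rw [this]
    exact (hasCompactSupport_regApprox ε x).mul_left.sub (hasCompactSupport_peakApprox ε x)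

/-- The total mass of the limit of `peakApprox`. -/
noncomputable def peakMass (N : ℕ) : ℝ :=
  regConst N * ∫ z : EuclideanSpace ℝ (Fin N), regApprox 0 0 z

theorem integral_regApprox_zero (x : EuclideanSpace ℝ (Fin N)) :
    ∫ z, regApprox 0 x z = ∫ z : EuclideanSpace ℝ (Fin N), regApprox 0 0 z := by
  have := integral_sub_right_eq_self (μ := volume)
    (fun z : EuclideanSpace ℝ (Fin N) => regApprox 0 0 z) x
  rw [← this]
  simp [regApprox]

theorem peakMass_pos (hN : 3 ≤ N) : 0 < peakMass N := by
  refine mul_pos (regConst_pos hN) ?_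
  refine (contDiff_regApprox 0 0).continuous.integral_pos_of_hasCompactSupport_nonneg_nonzero
    (hasCompactSupport_regApprox 0 0) (fun z => sqCut_nonneg _) (x := 0) ?_
  simp [regApprox, sqCut]

theorem integral_peakApprox (hε : 0 < ε) (x : EuclideanSpace ℝ (Fin N)) :
    ∫ z, peakApprox ε x z = regConst N * ∫ z, regApprox ε x z := by
  have := integral_peakApprox_mul hε x (u := fun _ => 1) contDiff_const
  have hl : ∀ z : EuclideanSpace ℝ (Fin N), lap (fun _ => (1 : ℝ)) z = 0 := by
    intro z
    rw [lap_eq_sum_pd contDiff_const]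
    refine Finset.sum_eq_zero fun i _ => ?_
    rw [pd_pd_apply contDiff_const]
    simp
  simpa [hl] using this

theorem tendsto_integral_peakApprox (x : EuclideanSpace ℝ (Fin N)) :
    Tendsto (fun ε => ∫ z, peakApprox ε x z) (nhdsWithin 0 (Ioi 0)) (nhds (peakMass N)) := by
  have h : Tendsto (fun ε => regConst N * ∫ z, regApprox ε x z) (nhdsWithin 0 (Ioi 0))
      (nhds (peakMass N)) := by
    unfold peakMass
    rw [← integral_regApprox_zero x]
    refine Tendsto.const_mul _ ?_
    refine tendsto_integral_filter_of_dominated_convergence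
      ((closedBall x 1).indicator fun _ => 1) ?_ ?_ ?_ ?_
    · exact Eventually.of_forall fun ε => (contDiff_regApprox ε x).continuous.aestronglyMeasurable
    · refine Eventually.of_forall fun ε => Eventually.of_forall fun z => ?_
      by_cases hz : z ∈ closedBall x 1
      · rw [indicator_of_mem hz, regApprox, Real.norm_of_nonneg (sqCut_nonneg _)]
        exact sqCut_le_one (by positivity)
      · rw [indicator_of_notMem hz, regApprox_eq_zero hz, norm_zero]
    · rw [integrable_indicator_iff measurableSet_closedBall]
      exact integrableOn_const measure_closedBall_lt_top.ne
    · refine Eventually.of_forall fun z => ?_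
      have : Continuous fun ε => regApprox ε x z :=
        contDiff_sqCut.continuous.comp (by fun_prop)
      exact (this.tendsto 0).mono_left nhdsWithin_le_nhds
  refine h.congr' ?_
  filter_upwards [self_mem_nhdsWithin] with ε hε
  exact (integral_peakApprox hε x).symm

theorem tendsto_integral_peakApprox_mul (hN : 3 ≤ N) (x : EuclideanSpace ℝ (Fin N))
    {w : EuclideanSpace ℝ (Fin N) → ℝ} (hw : Continuous w) :
    Tendsto (fun ε => ∫ z, peakApprox ε x z * w z) (nhdsWithin 0 (Ioi 0))
      (nhds (peakMass N * w x)) := by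
  have hm := peakMass_pos hN
  have key : Tendsto (fun ε => ∫ z in closedBall x 1, ((peakMass N)⁻¹ * peakApprox ε x z) • w z)
      (nhdsWithin 0 (Ioi 0)) (nhds (w x)) := by
    refine tendsto_setIntegral_peak_smul_of_integrableOn_of_tendsto (x₀ := x)
      (t := closedBall x 1) measurableSet_closedBall measurableSet_closedBall subset_rfl
      self_mem_nhdsWithin measure_closedBall_lt_top.ne ?_ ?_ ?_ ?_ ?_ ?_
    · filter_upwards [self_mem_nhdsWithin] with ε hε z _
      exact mul_nonneg (inv_nonneg.2 hm.le) (peakApprox_nonneg hN hε x z)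
    · intro u hu hxu
      obtain ⟨δ, hδ, hδu⟩ := Metric.isOpen_iff.1 hu x hxu
      rw [Metric.tendstoUniformlyOn_iff]
      intro η hη
      set A := (peakMass N)⁻¹ * (4 * ((2 - N) / 2 * ((2 - N) / 2 - 1)
        * (δ ^ 2) ^ (((2 : ℝ) - N) / 2 - 2))) with hA
      have : Tendsto (fun ε : ℝ => A * ε ^ 2) (nhdsWithin 0 (Ioi 0)) (nhds 0) := by
        have : Continuous fun ε : ℝ => A * ε ^ 2 := by fun_prop
        simpa using (this.tendsto 0).mono_left nhdsWithin_le_nhds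
      filter_upwards [self_mem_nhdsWithin, this.eventually_lt_const hη] with ε hε hlt z hz
      have hz' : δ ≤ ‖z - x‖ := by
        by_contra! hc
        exact hz.2 (hδu (by rwa [mem_ball, dist_eq_norm]))
      rw [Pi.zero_apply, dist_zero_left, Real.norm_of_nonneg
        (mul_nonneg (inv_nonneg.2 hm.le) (peakApprox_nonneg hN hε x z))]
      refine lt_of_le_of_lt ?_ hlt
      have := mul_le_mul_of_nonneg_left (peakApprox_le hN hε hδ hz') (inv_nonneg.2 hm.le)
      rw [hA]
      linarith
    · have h1 : (fun ε => ∫ z in closedBall x 1, (peakMass N)⁻¹ * peakApprox ε x z)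
          = fun ε => (peakMass N)⁻¹ * ∫ z, peakApprox ε x z := by
        funext ε
        rw [integral_const_mul]
        congr 1
        exact setIntegral_eq_integral_of_forall_compl_eq_zero fun z hz => peakApprox_eq_zero hz
      rw [h1, ← inv_mul_cancel₀ hm.ne']
      exact (tendsto_integral_peakApprox x).const_mul _
    · filter_upwards [self_mem_nhdsWithin] with ε hε
      exact ((continuous_peakApprox hε x).const_mul _).aestronglyMeasurable
    · exact hw.continuousOn.integrableOn_compact (isCompact_closedBall x 1)
    · exact (hw.tendsto x).mono_left nhdsWithin_le_nhds
  refine (key.const_mul (peakMass N)).congr fun ε => ?_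
  rw [← integral_const_mul, setIntegral_eq_integral_of_forall_compl_eq_zero]
  · refine integral_congr_ae (Eventually.of_forall fun z => ?_)
    simp only [smul_eq_mul]
    field_simp
  · intro z hz
    simp [peakApprox_eq_zero hz]

end Kernel

section KernelBounds

variable {N : ℕ} {ε : ℝ} {x z : EuclideanSpace ℝ (Fin N)}

theorem greenApprox_nonneg (hN : 3 ≤ N) (hε : 0 < ε) (x z : EuclideanSpace ℝ (Fin N)) :
    0 ≤ greenApprox ε x z := by
  unfold greenApprox cutPow
  split_ifs with h
  · exact powRem_nonneg (half_two_sub_neg hN) (sq_add_sq_pos hε) h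
  · exact le_rfl

/-- A pointwise mean value inequality for superharmonic functions. -/
theorem exists_mul_integral_le (hN : 3 ≤ N) : ∃ c : ℝ, 0 < c ∧
    ∀ (u : EuclideanSpace ℝ (Fin N) → ℝ) (x : EuclideanSpace ℝ (Fin N)), ContDiff ℝ 2 u →
      (∀ z ∈ closedBall x 1, 0 ≤ u z) → (∀ z ∈ closedBall x 1, 0 ≤ -lap u z) →
      c * ((∫ z in ball x (1 / 2), u z) + ∫ z in ball x (1 / 2), -lap u z) ≤ u x := by
  have hm := peakMass_pos hN
  have hs := half_two_sub_neg hN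
  have hA := regConst_pos hN
  have hp := powRem_half_pos hs
  set c := min (regConst N / 4) (powRem ((2 - N) / 2) (1 / 2)) with hc
  have hc0 : 0 < c := lt_min (by positivity) hp
  refine ⟨c / peakMass N, by positivity, fun u x hu hu0 hl0 => ?_⟩
  rw [div_mul_eq_mul_div, div_le_iff₀' hm]
  refine ge_of_tendsto (tendsto_integral_peakApprox_mul hN x hu.continuous) ?_
  have h4 : ∀ᶠ ε : ℝ in nhdsWithin 0 (Ioi 0), ε < 1 / 4 :=
    (tendsto_id.mono_left nhdsWithin_le_nhds).eventually_lt_const (by norm_num)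
  filter_upwards [self_mem_nhdsWithin, h4] with ε hε hε4
  have hε0 : 0 < ε := hε
  have hle : ∀ z ∈ ball x (1 / 2), ‖z - x‖ ^ 2 + ε ^ 2 ≤ 1 / 2 := by
    intro z hz
    rw [mem_ball, dist_eq_norm] at hz
    nlinarith [norm_nonneg (z - x)]
  rw [integral_peakApprox_mul hε x hu, mul_add]
  have hsub : ball x (1 / 2) ⊆ closedBall x 1 :=
    ball_subset_closedBall.trans (closedBall_subset_closedBall (by norm_num))
  have hIu : IntegrableOn u (ball x (1 / 2)) :=
    (hu.continuous.continuousOn.integrableOn_compact (isCompact_closedBall x 1)).mono_set hsub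
  have hcl := (continuous_lap hu).neg
  have hIl : IntegrableOn (fun z => -lap u z) (ball x (1 / 2)) :=
    (hcl.continuousOn.integrableOn_compact (isCompact_closedBall x 1)).mono_set hsub
  have hI1 := integrable_mul_of_hasCompactSupport (contDiff_regApprox ε x).continuous
    (hasCompactSupport_regApprox ε x) hu.continuous
  have hI2 := integrable_mul_of_hasCompactSupport (contDiff_greenApprox hε x).continuous
    (hasCompactSupport_greenApprox ε x) hcl
  have hn1 : ∀ z, 0 ≤ regApprox ε x z * u z := by
    intro z
    by_cases hz : z ∈ closedBall x 1
    · exact mul_nonneg (sqCut_nonneg _) (hu0 z hz)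
    · rw [regApprox_eq_zero hz, zero_mul]
  have hn2 : ∀ z, 0 ≤ greenApprox ε x z * -lap u z := by
    intro z
    by_cases hz : z ∈ closedBall x 1
    · exact mul_nonneg (greenApprox_nonneg hN hε x z) (hl0 z hz)
    · rw [greenApprox, cutPow, if_neg (not_sq_add_sq_le hz), zero_mul]
  refine add_le_add ?_ ?_
  · rw [← integral_const_mul, ← integral_const_mul]
    refine (setIntegral_mono_on (hIu.const_mul _) ((hI1.const_mul _).integrableOn)
      measurableSet_ball ?_).trans (setIntegral_le_integral (hI1.const_mul _)
        (Eventually.of_forall fun z => mul_nonneg hA.le (hn1 z)))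
    intro z hz
    have h1 := hle z hz
    have hr : 1 / 4 ≤ regApprox ε x z := by
      rw [regApprox, sqCut, if_pos (by linarith)]
      nlinarith
    have h0 := hu0 z (hsub hz)
    rw [← mul_assoc]
    refine mul_le_mul_of_nonneg_right ?_ h0
    have := min_le_left (regConst N / 4) (powRem ((2 - N) / 2) (1 / 2))
    nlinarith
  · rw [← integral_const_mul]
    refine (setIntegral_mono_on (hIl.const_mul _) hI2.integrableOn
      measurableSet_ball ?_).trans (setIntegral_le_integral hI2 (Eventually.of_forall hn2))
    intro z hz
    have h1 := hle z hz
    refine mul_le_mul_of_nonneg_right ?_ (hl0 z (hsub hz))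
    rw [greenApprox, cutPow, if_pos (by linarith)]
    exact (min_le_right _ _).trans (powRem_antitone hs (sq_add_sq_pos hε) h1 (by norm_num))

theorem ofReal_rpow_le_enorm_rpow {E : Type*} [NormedAddCommGroup E] {r : ℝ} (hr : r < 0)
    (w : E) :
    ENNReal.ofReal ((‖w‖ ^ 2 + ε ^ 2) ^ r) ≤ ‖w‖ₑ ^ (2 * r) := by
  by_cases hw : w = 0
  · rw [hw, enorm_zero, ENNReal.zero_rpow_of_neg (by linarith)]
    exact le_top
  · have h0 : 0 < ‖w‖ := norm_pos_iff.2 hw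
    rw [← ofReal_norm, ENNReal.ofReal_rpow_of_pos h0]
    refine ENNReal.ofReal_le_ofReal ?_
    rw [Real.rpow_mul h0.le, Real.rpow_two]
    exact Real.rpow_le_rpow_of_nonpos (by positivity) (by nlinarith) hr.le

theorem ofReal_integral_le_lintegral {X : Type*} [MeasurableSpace X] {μ : Measure X}
    (f : X → ℝ) : ENNReal.ofReal (∫ x, f x ∂μ) ≤ ∫⁻ x, ENNReal.ofReal (f x) ∂μ := by
  by_cases hf : Integrable f μ
  · rw [integral_eq_lintegral_pos_part_sub_lintegral_neg_part hf]
    refine (ENNReal.ofReal_le_ofReal (sub_le_self _ ENNReal.toReal_nonneg)).trans ?_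
    exact ENNReal.ofReal_toReal_le
  · simp [integral_undef hf]

theorem abs_sub_apply_le (i : Fin N) (x z : EuclideanSpace ℝ (Fin N)) :
    |z i - x i| ≤ ‖z - x‖ := by
  simpa using PiLp.norm_apply_le (z - x) i

theorem ofReal_greenApprox_le (hN : 3 ≤ N) (hε : 0 < ε) (x z : EuclideanSpace ℝ (Fin N)) :
    ENNReal.ofReal (greenApprox ε x z) ≤ ‖z - x‖ₑ ^ (2 - N : ℝ) := by
  have hs := half_two_sub_neg hN
  have := ofReal_rpow_le_enorm_rpow (ε := ε) hs (z - x)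
  rw [show 2 * ((2 - N : ℝ) / 2) = 2 - N by ring] at this
  refine le_trans (ENNReal.ofReal_le_ofReal ?_) this
  unfold greenApprox cutPow
  split_ifs with h
  · exact powRem_le hs h
  · positivity

/-- A bound for functions with a given upper bound on minus the Laplacian. -/
theorem exists_ofReal_le (hN : 3 ≤ N) : ∃ C : ENNReal, C ≠ ⊤ ∧
    ∀ (u : EuclideanSpace ℝ (Fin N) → ℝ) (x : EuclideanSpace ℝ (Fin N)), ContDiff ℝ 2 u →
      ENNReal.ofReal (u x) ≤ C * ((∫⁻ z in closedBall x 1, ENNReal.ofReal (u z)) +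
        ∫⁻ z in closedBall x 1, ‖z - x‖ₑ ^ (2 - N : ℝ) * ENNReal.ofReal (-lap u z)) := by
  have hm := peakMass_pos hN
  set A := ENNReal.ofReal (regConst N) with hA
  refine ⟨ENNReal.ofReal (peakMass N)⁻¹ * (A + 1), by finiteness, fun u x hu => ?_⟩
  have key : ENNReal.ofReal (peakMass N * u x) ≤ (A + 1) *
      ((∫⁻ z in closedBall x 1, ENNReal.ofReal (u z)) +
        ∫⁻ z in closedBall x 1, ‖z - x‖ₑ ^ (2 - N : ℝ) * ENNReal.ofReal (-lap u z)) := by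
    refine le_of_tendsto ((ENNReal.continuous_ofReal.tendsto _).comp
      (tendsto_integral_peakApprox_mul hN x hu.continuous)) ?_
    filter_upwards [self_mem_nhdsWithin] with ε hε
    have hε0 : 0 < ε := hε
    rw [Function.comp_apply, integral_peakApprox_mul hε x hu]
    refine ENNReal.ofReal_add_le.trans ?_
    rw [mul_add]
    refine add_le_add ?_ ?_
    · rw [ENNReal.ofReal_mul (regConst_pos hN).le]
      refine mul_le_mul' le_self_add ((ofReal_integral_le_lintegral _).trans ?_)
      rw [← lintegral_indicator measurableSet_closedBall]
      refine lintegral_mono fun z => ?_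
      by_cases hz : z ∈ closedBall x 1
      · rw [indicator_of_mem hz, regApprox, ENNReal.ofReal_mul (sqCut_nonneg _)]
        exact mul_le_of_le_one_left' (ENNReal.ofReal_le_one.2 (sqCut_le_one (by positivity)))
      · simp [regApprox_eq_zero hz]
    · refine le_trans ((ofReal_integral_le_lintegral _).trans ?_) (le_mul_of_one_le_left' le_add_self)
      rw [← lintegral_indicator measurableSet_closedBall]
      refine lintegral_mono fun z => ?_
      by_cases hz : z ∈ closedBall x 1
      · rw [indicator_of_mem hz, ENNReal.ofReal_mul (greenApprox_nonneg hN hε x z)]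
        exact mul_le_mul' (ofReal_greenApprox_le hN hε x z) le_rfl
      · simp [greenApprox, cutPow, if_neg (not_sq_add_sq_le hz)]
  rw [show u x = (peakMass N)⁻¹ * (peakMass N * u x) by field_simp,
    ENNReal.ofReal_mul (inv_nonneg.2 hm.le), mul_assoc]
  exact mul_le_mul' le_rfl key

theorem enorm_pd_greenApprox_le (hN : 3 ≤ N) (hε : 0 < ε) (i : Fin N)
    (x z : EuclideanSpace ℝ (Fin N)) :
    ‖pd i (greenApprox ε x) z‖ₑ ≤ ENNReal.ofReal N * ‖z - x‖ₑ ^ (1 - N : ℝ) := by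
  have hs := half_two_sub_neg hN
  have h3 : (3 : ℝ) ≤ N := by exact_mod_cast hN
  have := ofReal_rpow_le_enorm_rpow (ε := ε) (r := (1 - N) / 2) (by linarith) (z - x)
  rw [show 2 * ((1 - N : ℝ) / 2) = 1 - N by ring] at this
  refine le_trans ?_ (mul_le_mul' le_rfl this)
  rw [← ENNReal.ofReal_mul (by linarith), ← ofReal_norm]
  refine ENNReal.ofReal_le_ofReal ?_
  rw [pd_greenApprox hε]
  set t := ‖z - x‖ ^ 2 + ε ^ 2 with ht
  have h0 : 0 < t := sq_add_sq_pos hε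
  unfold cutPow₁
  split_ifs with h
  · have h1 := powRem₁_nonpos hs h0 h
    have h2 := neg_powRem₁_le hs h
    have hi : |z i - x i| ≤ t ^ (1 / 2 : ℝ) := by
      rw [← Real.sqrt_eq_rpow]
      refine Real.abs_le_sqrt ?_
      rw [← sq_abs]
      have := abs_sub_apply_le i x z
      nlinarith [sq_nonneg ε, abs_nonneg (z i - x i)]
    rw [norm_mul, norm_mul, Real.norm_eq_abs, Real.norm_eq_abs, Real.norm_eq_abs,
      abs_of_nonpos h1, abs_of_pos (by norm_num : (0 : ℝ) < 2)]
    calc 2 * |z i - x i| * -powRem₁ ((2 - N) / 2) t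
        ≤ 2 * t ^ (1 / 2 : ℝ) * (-((2 - N) / 2) * t ^ (((2 : ℝ) - N) / 2 - 1)) := by
          gcongr
          linarith
      _ = (N - 2) * (t ^ (1 / 2 : ℝ) * t ^ (((2 : ℝ) - N) / 2 - 1)) := by ring
      _ = (N - 2) * t ^ ((1 - N : ℝ) / 2) := by
          rw [← Real.rpow_add h0]
          congr 2
          ring
      _ ≤ N * t ^ ((1 - N : ℝ) / 2) := by
          gcongr
          linarith
  · simp only [mul_zero, norm_zero]
    positivity

theorem enorm_pd_regApprox_le (ε : ℝ) (i : Fin N) (x z : EuclideanSpace ℝ (Fin N)) :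
    ‖pd i (regApprox ε x) z‖ₑ ≤ (closedBall x 1).indicator (fun _ => 4) z := by
  have hpd : pd i (regApprox ε x) z = 2 * (z i - x i) * sqCut' (‖z - x‖ ^ 2 + ε ^ 2) :=
    pd_radial (hasDerivAt_sqCut _) i
  rw [hpd]
  by_cases hz : z ∈ closedBall x 1
  · rw [indicator_of_mem hz, show (4 : ENNReal) = ENNReal.ofReal 4 by simp, ← ofReal_norm]
    refine ENNReal.ofReal_le_ofReal ?_
    have h1 := abs_sub_apply_le i x z
    have h2 := abs_sqCut'_le (t := ‖z - x‖ ^ 2 + ε ^ 2) (by positivity)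
    rw [mem_closedBall, dist_eq_norm] at hz
    rw [norm_mul, norm_mul, Real.norm_eq_abs, Real.norm_eq_abs, Real.norm_eq_abs,
      abs_of_pos (by norm_num : (0 : ℝ) < 2)]
    calc 2 * |z i - x i| * |sqCut' (‖z - x‖ ^ 2 + ε ^ 2)| ≤ 2 * 1 * 2 := by
          gcongr
          exact h1.trans hz
      _ = 4 := by norm_num
  · simp [sqCut', if_neg (not_sq_add_sq_le hz)]

theorem pd_greenApprox_eq_zero (hε : 0 < ε) (i : Fin N) (hz : z ∉ closedBall x 1) :
    pd i (greenApprox ε x) z = 0 := by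
  rw [pd_greenApprox hε, cutPow₁, if_neg (not_sq_add_sq_le hz), mul_zero]

/-- An interior gradient bound in terms of the Laplacian. -/
theorem exists_enorm_pd_le (hN : 3 ≤ N) : ∃ C : ENNReal, C ≠ ⊤ ∧
    ∀ (u : EuclideanSpace ℝ (Fin N) → ℝ) (x : EuclideanSpace ℝ (Fin N)) (i : Fin N),
      ContDiff ℝ 2 u →
      ‖pd i u x‖ₑ ≤ C * ((∫⁻ z in closedBall x 1, ‖u z‖ₑ) +
        ∫⁻ z in closedBall x 1, ‖z - x‖ₑ ^ (1 - N : ℝ) * ‖lap u z‖ₑ) := by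
  have hm := peakMass_pos hN
  set A := ‖regConst N‖ₑ * 4 with hA
  set B := ENNReal.ofReal N with hB
  refine ⟨‖(peakMass N)⁻¹‖ₑ * (A + B), by finiteness, fun u x i hu => ?_⟩
  have key : ‖peakMass N * pd i u x‖ₑ ≤ (A + B) *
      ((∫⁻ z in closedBall x 1, ‖u z‖ₑ) +
        ∫⁻ z in closedBall x 1, ‖z - x‖ₑ ^ (1 - N : ℝ) * ‖lap u z‖ₑ) := by
    refine le_of_tendsto ((continuous_enorm.tendsto _).comp
      (tendsto_integral_peakApprox_mul hN x
        (continuous_pd (hu.of_le (by norm_num)) i))) ?_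
    filter_upwards [self_mem_nhdsWithin] with ε hε
    have hε0 : 0 < ε := hε
    rw [Function.comp_apply, integral_peakApprox_mul_pd hε x hu, sub_eq_add_neg]
    refine (enorm_add_le _ _).trans ?_
    rw [enorm_neg, enorm_neg, enorm_mul, mul_add]
    refine add_le_add ?_ ?_
    · rw [hA, add_mul]
      refine le_trans ?_ le_self_add
      rw [mul_assoc]
      refine mul_le_mul' le_rfl ((enorm_integral_le_lintegral_enorm _).trans ?_)
      rw [← lintegral_const_mul' _ _ (by finiteness), ← lintegral_indicator measurableSet_closedBall]
      refine lintegral_mono fun z => ?_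
      rw [enorm_mul]
      refine (mul_le_mul' (enorm_pd_regApprox_le ε i x z) le_rfl).trans ?_
      by_cases hz : z ∈ closedBall x 1 <;> simp [hz]
    · rw [add_mul]
      refine le_trans ?_ le_add_self
      refine (enorm_integral_le_lintegral_enorm _).trans ?_
      rw [← lintegral_const_mul' _ _ (by finiteness), ← lintegral_indicator measurableSet_closedBall]
      refine lintegral_mono fun z => ?_
      by_cases hz : z ∈ closedBall x 1
      · rw [indicator_of_mem hz, enorm_mul, enorm_neg, ← mul_assoc]
        exact mul_le_mul' (enorm_pd_greenApprox_le hN hε i x z) le_rfl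
      · simp [pd_greenApprox_eq_zero hε i hz]
  rw [show pd i u x = (peakMass N)⁻¹ * (peakMass N * pd i u x) by field_simp, enorm_mul, mul_assoc]
  exact mul_le_mul' le_rfl key

end KernelBounds

section PartialDerivatives

variable {N : ℕ} {f g u : EuclideanSpace ℝ (Fin N) → ℝ} {x : EuclideanSpace ℝ (Fin N)}

theorem pd_comp {φ : ℝ → ℝ} {φ' : ℝ} (hφ : HasDerivAt φ φ' (u x)) (hu : DifferentiableAt ℝ u x)
    (i : Fin N) : pd i (fun x => φ (u x)) x = φ' * pd i u x := by
  have := hφ.comp_hasFDerivAt x hu.hasFDerivAt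
  have h : fderiv ℝ (fun x => φ (u x)) x = φ' • fderiv ℝ u x := this.fderiv
  simp [pd, h]

theorem pd_mul (hf : DifferentiableAt ℝ f x) (hg : DifferentiableAt ℝ g x) (i : Fin N) :
    pd i (fun x => f x * g x) x = f x * pd i g x + pd i f x * g x := by
  simp only [pd]
  rw [fderiv_fun_mul hf hg]
  simp
  ring

theorem pd_add (hf : DifferentiableAt ℝ f x) (hg : DifferentiableAt ℝ g x) (i : Fin N) :
    pd i (fun x => f x + g x) x = pd i f x + pd i g x := by
  simp only [pd]
  rw [fderiv_fun_add hf hg]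
  simp

theorem pd_sub (hf : DifferentiableAt ℝ f x) (hg : DifferentiableAt ℝ g x) (i : Fin N) :
    pd i (fun x => f x - g x) x = pd i f x - pd i g x := by
  simp only [pd]
  rw [fderiv_fun_sub hf hg]
  simp

theorem pd_const_mul (a : ℝ) (hf : DifferentiableAt ℝ f x) (i : Fin N) :
    pd i (fun x => a * f x) x = a * pd i f x := by
  simp only [pd]
  rw [fderiv_const_mul hf]
  simp

/-- The chain rule for the Laplacian. -/
theorem lap_comp {φ φ' φ'' : ℝ → ℝ} {S : Set ℝ} (hφ : ∀ t ∈ S, HasDerivAt φ (φ' t) t)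
    (hφ' : ∀ t ∈ S, HasDerivAt φ' (φ'' t) t) (hu : ContDiff ℝ 2 u) (hS : ∀ x, u x ∈ S)
    (hc : ContDiff ℝ 2 (fun x => φ (u x))) (x : EuclideanSpace ℝ (Fin N)) :
    lap (fun x => φ (u x)) x = φ' (u x) * lap u x + φ'' (u x) * ∑ i, pd i u x ^ 2 := by
  rw [lap_eq_sum_pd hc, lap_eq_sum_pd hu, Finset.mul_sum, Finset.mul_sum,
    ← Finset.sum_add_distrib]
  refine Finset.sum_congr rfl fun i _ => ?_
  have hd : ∀ x, DifferentiableAt ℝ u x := hu.differentiable (by norm_num)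
  rw [show pd i (fun x => φ (u x)) = fun x => φ' (u x) * pd i u x from
    funext fun x => pd_comp (hφ _ (hS x)) (hd x) i]
  have h1 : DifferentiableAt ℝ (fun x => φ' (u x)) x := (hφ' _ (hS x)).differentiableAt.comp x (hd x)
  rw [pd_mul h1 ((contDiff_pd hu i).differentiable (by norm_num) x), pd_comp (hφ' _ (hS x)) (hd x)]
  ring

theorem lap_const_mul_sub (a : ℝ) (hf : ContDiff ℝ 2 f) (hg : ContDiff ℝ 2 g)
    (x : EuclideanSpace ℝ (Fin N)) :
    lap (fun x => a * f x - g x) x = a * lap f x - lap g x := by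
  have h : ContDiff ℝ 2 (fun x => a * f x) := contDiff_const.mul hf
  rw [lap_eq_sum_pd (h.sub hg), lap_eq_sum_pd hf, lap_eq_sum_pd hg, Finset.mul_sum,
    ← Finset.sum_sub_distrib]
  refine Finset.sum_congr rfl fun i _ => ?_
  have hdf : ∀ x, DifferentiableAt ℝ f x := hf.differentiable (by norm_num)
  have hdg : ∀ x, DifferentiableAt ℝ g x := hg.differentiable (by norm_num)
  have e : pd i (fun x => a * f x - g x) = fun x => a * pd i f x - pd i g x := by
    funext x
    rw [pd_sub ((hdf x).const_mul a) (hdg x), pd_const_mul a (hdf x)]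
  have hf' := (contDiff_pd hf i).differentiable (by norm_num) x
  rw [e, pd_sub (hf'.const_mul a) ((contDiff_pd hg i).differentiable (by norm_num) x),
    pd_const_mul a hf']

end PartialDerivatives

/-- A positive solution on the ball of radius `K` of the Lane–Emden system with slowly varying
coefficients. -/
structure IsSys {N : ℕ} (p q η K : ℝ) (U V c d : EuclideanSpace ℝ (Fin N) → ℝ) : Prop where
  contDiff_left : ContDiff ℝ 2 U
  contDiff_right : ContDiff ℝ 2 V
  contDiff_coeff_left : ContDiff ℝ 1 c
  contDiff_coeff_right : ContDiff ℝ 1 d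
  left_pos : ∀ x, 0 < U x
  right_pos : ∀ x, 0 < V x
  coeff_left_mem : ∀ x, ‖x‖ ≤ K → c x ∈ Icc (1 / 2) 2
  coeff_right_mem : ∀ x, ‖x‖ ≤ K → d x ∈ Icc (1 / 2) 2
  lap_left : ∀ x, ‖x‖ ≤ K → -lap U x = c x * V x ^ p
  lap_right : ∀ x, ‖x‖ ≤ K → -lap V x = d x * U x ^ q
  radial_left : ∀ x, ‖x‖ ≤ K → |fderiv ℝ c x x| ≤ η
  radial_right : ∀ x, ‖x‖ ≤ K → |fderiv ℝ d x x| ≤ η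

section LocalBounds

variable {N : ℕ} {p q η K : ℝ} {U V c d : EuclideanSpace ℝ (Fin N) → ℝ}

theorem IsSys.swap (h : IsSys p q η K U V c d) : IsSys q p η K V U d c :=
  ⟨h.2, h.1, h.4, h.3, h.6, h.5, h.8, h.7, h.10, h.9, h.12, h.11⟩

theorem IsSys.continuous_rpow (h : IsSys p q η K U V c d) (s : ℝ) :
    Continuous fun x => U x ^ s :=
  h.contDiff_left.continuous.rpow_const fun x => Or.inl (h.left_pos x).ne'

theorem exists_le_of_rpow_le {p q k : ℝ} (hp : 0 < p) (hpq : 1 < p * q)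
    (hk : 0 < k) : ∃ C : ℝ, 0 < C ∧ ∀ A B : ℝ, 0 < A → 0 < B → k * B ^ p ≤ A → k * A ^ q ≤ B →
      A ≤ C := by
  refine ⟨((k * k ^ p)⁻¹) ^ (p * q - 1)⁻¹, by positivity, fun A B hA hB h1 h2 => ?_⟩
  have h3 : k * (k * A ^ q) ^ p ≤ A :=
    (mul_le_mul_of_nonneg_left (Real.rpow_le_rpow (by positivity) h2 hp.le) hk.le).trans h1
  rw [Real.mul_rpow hk.le (by positivity), ← Real.rpow_mul hA.le, ← mul_assoc] at h3
  rw [Real.le_rpow_inv_iff_of_pos hA.le (by positivity) (by linarith), Real.rpow_sub_one hA.ne',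
    mul_comm p q, div_le_iff₀ hA, inv_mul_eq_div, le_div_iff₀' (by positivity)]
  exact h3

theorem const_mul_le_setIntegral {f : EuclideanSpace ℝ (Fin N) → ℝ} (hf : Continuous f) {a r : ℝ}
    (y : EuclideanSpace ℝ (Fin N)) (h : ∀ x ∈ ball y r, a ≤ f x) :
    volume.real (ball (0 : EuclideanSpace ℝ (Fin N)) r) * a ≤ ∫ x in ball y r, f x := by
  have hI : IntegrableOn f (ball y r) :=
    (hf.continuousOn.integrableOn_compact (isCompact_closedBall y r)).mono_set
      ball_subset_closedBall
  have := setIntegral_mono_on (integrableOn_const (C := a) measure_ball_lt_top.ne) hI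
    measurableSet_ball h
  rw [setIntegral_const, smul_eq_mul] at this
  rwa [measureReal_def, Measure.addHaar_ball_center, ← measureReal_def] at this

theorem IsSys.mul_integral_le_aux (hN : 3 ≤ N) : ∃ k : ℝ, 0 < k ∧
    ∀ {p q η K : ℝ} {U V c d : EuclideanSpace ℝ (Fin N) → ℝ}, IsSys p q η K U V c d →
      ∀ x y : EuclideanSpace ℝ (Fin N), ‖y‖ + 2 ≤ K → x ∈ ball y (1 / 4) →
        k * (∫ z in ball y (1 / 4), V z ^ p) ≤ U x ∧ k * (∫ z in ball y (1 / 4), U z) ≤ U x := by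
  obtain ⟨c₀, hc₀, h⟩ := exists_mul_integral_le hN
  refine ⟨c₀ / 2, by positivity, fun {p q η K U V c d} hS x y hy hx => ?_⟩
  have hsub : ball y (1 / 4) ⊆ ball x (1 / 2) := by
    refine ball_subset_ball' ?_
    rw [dist_comm]
    rw [mem_ball] at hx
    linarith
  have hnorm : ∀ z ∈ closedBall x 1, ‖z‖ ≤ K := by
    intro z hz
    have h1 := dist_triangle z x y
    rw [mem_ball] at hx
    rw [mem_closedBall] at hz
    have h2 := norm_le_norm_add_norm_sub' z y
    rw [dist_eq_norm z y] at h1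
    linarith
  have hl : ∀ z ∈ closedBall x 1, V z ^ p ≤ 2 * -lap U z := by
    intro z hz
    rw [hS.lap_left z (hnorm z hz)]
    have := (hS.coeff_left_mem z (hnorm z hz)).1
    have := Real.rpow_pos_of_pos (hS.right_pos z) p
    nlinarith
  have hl0 : ∀ z ∈ closedBall x 1, 0 ≤ -lap U z := by
    intro z hz
    have := hl z hz
    have := Real.rpow_pos_of_pos (hS.right_pos z) p
    linarith
  have key := h U x hS.contDiff_left (fun z _ => (hS.left_pos z).le) hl0
  have hsub1 : ball x (1 / 2) ⊆ closedBall x 1 :=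
    ball_subset_closedBall.trans (closedBall_subset_closedBall (by norm_num))
  have hI : ∀ {f : EuclideanSpace ℝ (Fin N) → ℝ}, Continuous f → IntegrableOn f (ball x (1 / 2)) :=
    fun hf => (hf.continuousOn.integrableOn_compact (isCompact_closedBall x 1)).mono_set hsub1
  have i1 : ∫ z in ball y (1 / 4), U z ≤ ∫ z in ball x (1 / 2), U z :=
    setIntegral_mono_set (hI hS.contDiff_left.continuous)
      (Eventually.of_forall fun z => (hS.left_pos z).le) (Eventually.of_forall hsub)
  have i2 : ∫ z in ball y (1 / 4), V z ^ p ≤ ∫ z in ball x (1 / 2), V z ^ p :=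
    setIntegral_mono_set (hI (hS.swap.continuous_rpow p))
      (Eventually.of_forall fun z => (Real.rpow_pos_of_pos (hS.right_pos z) p).le)
      (Eventually.of_forall hsub)
  have i3 : ∫ z in ball x (1 / 2), V z ^ p ≤ 2 * ∫ z in ball x (1 / 2), -lap U z := by
    rw [← integral_const_mul]
    exact setIntegral_mono_on (hI (hS.swap.continuous_rpow p))
      ((hI (continuous_lap hS.contDiff_left).neg).const_mul 2) measurableSet_ball
      (fun z hz => hl z (hsub1 hz))
  have n1 : 0 ≤ ∫ z in ball y (1 / 4), U z := integral_nonneg fun z => (hS.left_pos z).le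
  have n2 : 0 ≤ ∫ z in ball y (1 / 4), V z ^ p :=
    integral_nonneg fun z => (Real.rpow_pos_of_pos (hS.right_pos z) p).le
  constructor <;> nlinarith

theorem IsSys.exists_integral_le (hN : 3 ≤ N) (hp : 0 < p) (hq : 0 < q) (hpq : 1 < p * q) :
    ∃ C : ℝ, 0 < C ∧ ∀ {η K : ℝ} {U V c d : EuclideanSpace ℝ (Fin N) → ℝ},
      IsSys p q η K U V c d → ∀ y : EuclideanSpace ℝ (Fin N), ‖y‖ + 2 ≤ K →
        (∫ z in ball y (1 / 4), V z ^ p) ≤ C ∧ (∫ z in ball y (1 / 4), V z) ≤ C := by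
  obtain ⟨k, hk, h⟩ := IsSys.mul_integral_le_aux hN
  set m := volume.real (ball (0 : EuclideanSpace ℝ (Fin N)) (1 / 4)) with hm
  have hm0 : 0 < m := ENNReal.toReal_pos (measure_ball_pos _ _ (by norm_num)).ne'
    measure_ball_lt_top.ne
  obtain ⟨C, hC, hle⟩ := exists_le_of_rpow_le hp hpq
    (k := min (m * k ^ p) (m * k ^ q)) (lt_min (by positivity) (by positivity))
  refine ⟨max C ((C / m) ^ p⁻¹ / k), lt_max_of_lt_left hC, fun {η K U V c d} hS y hy => ?_⟩
  set A := ∫ z in ball y (1 / 4), V z ^ p with hA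
  set B := ∫ z in ball y (1 / 4), U z ^ q with hB
  have pos : ∀ {f : EuclideanSpace ℝ (Fin N) → ℝ}, Continuous f → (∀ z, 0 < f z) →
      0 < ∫ z in ball y (1 / 4), f z := by
    intro f hf hf0
    rw [setIntegral_pos_iff_support_of_nonneg_ae (Eventually.of_forall fun z => (hf0 z).le)
      ((hf.continuousOn.integrableOn_compact (isCompact_closedBall y (1 / 4))).mono_set
      ball_subset_closedBall)]
    rw [Function.support_eq_univ fun z => (hf0 z).ne', univ_inter]
    exact measure_ball_pos _ _ (by norm_num)
  have hA0 : 0 < A := pos (hS.swap.continuous_rpow p) fun z => Real.rpow_pos_of_pos (hS.right_pos z) p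
  have hB0 : 0 < B := pos (hS.continuous_rpow q) fun z => Real.rpow_pos_of_pos (hS.left_pos z) q
  have hV0 := pos hS.contDiff_right.continuous hS.right_pos
  have low : ∀ {t : ℝ}, 0 < t → (∀ x ∈ ball y (1 / 4), k * t ≤ V x) → m * (k ^ p * t ^ p) ≤ A := by
    intro t ht hx
    rw [← Real.mul_rpow hk.le ht.le]
    exact const_mul_le_setIntegral (hS.swap.continuous_rpow p) y
      fun x hxb => Real.rpow_le_rpow (by positivity) (hx x hxb) hp.le
  have h1 : m * (k ^ p * B ^ p) ≤ A := low hB0 fun x hx => (h hS.swap x y hy hx).1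
  have h2 : m * (k ^ q * A ^ q) ≤ B := by
    rw [← Real.mul_rpow hk.le hA0.le]
    exact const_mul_le_setIntegral (hS.continuous_rpow q) y
      fun x hx => Real.rpow_le_rpow (by positivity) (h hS x y hy hx).1 hq.le
  have hAC : A ≤ C := by
    refine hle A B hA0 hB0 ?_ ?_
    · refine le_trans (mul_le_mul_of_nonneg_right (min_le_left _ _) (by positivity)) ?_
      rwa [mul_assoc]
    · refine le_trans (mul_le_mul_of_nonneg_right (min_le_right _ _) (by positivity)) ?_
      rwa [mul_assoc]
  refine ⟨le_max_of_le_left hAC, le_max_of_le_right ?_⟩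
  have h3 := low hV0 fun x hx => (h hS.swap x y hy hx).2
  rw [le_div_iff₀' hk, Real.le_rpow_inv_iff_of_pos (by positivity) (by positivity) hp,
    Real.mul_rpow hk.le hV0.le, le_div_iff₀' hm0]
  exact h3.trans hAC

/-- Local integral bounds, uniform over all solutions. -/
theorem IsSys.exists_lintegral_le (hN : 3 ≤ N) (hp : 0 < p) (hq : 0 < q) (hpq : 1 < p * q)
    (R : ℝ) : ∃ C : ENNReal, C ≠ ⊤ ∧ ∀ {η K : ℝ} {U V c d : EuclideanSpace ℝ (Fin N) → ℝ},
      IsSys p q η K U V c d → R + 2 ≤ K →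
        (∫⁻ z in closedBall 0 R, ENNReal.ofReal (V z ^ p)) ≤ C ∧
        (∫⁻ z in closedBall 0 R, ENNReal.ofReal (V z)) ≤ C := by
  obtain ⟨C, hC, h⟩ := IsSys.exists_integral_le hN hp hq hpq
  obtain ⟨t, hts, ht, hcov⟩ := (isCompact_closedBall (0 : EuclideanSpace ℝ (Fin N)) R).finite_cover_balls
    (show (0 : ℝ) < 1 / 4 by norm_num)
  have := ht.fintype
  refine ⟨∑ y : t, ENNReal.ofReal C, ENNReal.sum_ne_top.2 fun _ _ => ENNReal.ofReal_ne_top, fun {η K U V c d} hS hK => ?_⟩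
  have cov : ∀ {f : EuclideanSpace ℝ (Fin N) → ℝ}, Continuous f → (∀ z, 0 < f z) →
      (∀ y ∈ t, ∫ z in ball y (1 / 4), f z ≤ C) →
      ∫⁻ z in closedBall 0 R, ENNReal.ofReal (f z) ≤ ∑ y : t, ENNReal.ofReal C := by
    intro f hf hf0 hle
    have hcov' : closedBall (0 : EuclideanSpace ℝ (Fin N)) R ⊆
        ⋃ y : t, ball (y : EuclideanSpace ℝ (Fin N)) (1 / 4) := by
      simpa only [iUnion_coe_set] using hcov
    refine (lintegral_mono_set hcov').trans ((lintegral_iUnion_le _ _).trans ?_)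
    rw [tsum_fintype]
    refine Finset.sum_le_sum fun y _ => ?_
    rw [← ofReal_integral_eq_lintegral_ofReal (f := f)
      ((hf.continuousOn.integrableOn_compact (isCompact_closedBall (y : EuclideanSpace ℝ (Fin N)) (1 / 4))).mono_set
      ball_subset_closedBall) (Eventually.of_forall fun z => (hf0 z).le)]
    exact ENNReal.ofReal_le_ofReal (hle y y.2)
  have hy : ∀ y ∈ t, ‖y‖ + 2 ≤ K := fun y hy => by
    have := mem_closedBall_zero_iff.1 (hts hy)
    linarith
  exact ⟨cov (hS.swap.continuous_rpow p) (fun z => Real.rpow_pos_of_pos (hS.right_pos z) p)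
    fun y hyt => (h hS y (hy y hyt)).1, cov hS.contDiff_right.continuous hS.right_pos
    fun y hyt => (h hS y (hy y hyt)).2⟩

end LocalBounds

section Comparison

/-- A smooth convex approximation of the negative part. -/
noncomputable def smoothNeg (t : ℝ) : ℝ := if t ≤ 0 then -t - 1 + (t ^ 2 - t + 1)⁻¹ else 0

noncomputable def smoothNeg₁ (t : ℝ) : ℝ :=
  if t ≤ 0 then -1 - (2 * t - 1) / (t ^ 2 - t + 1) ^ 2 else 0

noncomputable def smoothNeg₂ (t : ℝ) : ℝ :=
  if t ≤ 0 then (6 * t ^ 2 - 6 * t) / (t ^ 2 - t + 1) ^ 3 else 0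

theorem sq_sub_self_add_one_pos (t : ℝ) : 0 < t ^ 2 - t + 1 := by nlinarith [sq_nonneg (t - 1 / 2)]

theorem hasDerivAt_sq_sub_self_add_one (t : ℝ) :
    HasDerivAt (fun t : ℝ => t ^ 2 - t + 1) (2 * t - 1) t := by
  simpa using (((hasDerivAt_id t).pow 2).sub (hasDerivAt_id t)).add_const 1

theorem hasDerivAt_smoothNeg (t : ℝ) : HasDerivAt smoothNeg (smoothNeg₁ t) t := by
  refine hasDerivAt_ite_le (f := fun t => -t - 1 + (t ^ 2 - t + 1)⁻¹)
    (f' := fun t => -1 - (2 * t - 1) / (t ^ 2 - t + 1) ^ 2) ?_ (by norm_num) (by norm_num)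
  have h := (hasDerivAt_sq_sub_self_add_one t).inv (sq_sub_self_add_one_pos t).ne'
  refine ((((hasDerivAt_id t).neg).sub_const 1).add h).congr_deriv ?_
  ring

theorem hasDerivAt_smoothNeg₁ (t : ℝ) : HasDerivAt smoothNeg₁ (smoothNeg₂ t) t := by
  refine hasDerivAt_ite_le (f := fun t => -1 - (2 * t - 1) / (t ^ 2 - t + 1) ^ 2)
    (f' := fun t => (6 * t ^ 2 - 6 * t) / (t ^ 2 - t + 1) ^ 3) ?_ (by norm_num) (by norm_num)
  have h0 := (sq_sub_self_add_one_pos t).ne'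
  have h := (hasDerivAt_sq_sub_self_add_one t).pow 2
  have h2 := (((hasDerivAt_id t).const_mul 2).sub_const 1).div h (pow_ne_zero 2 h0)
  refine (h2.const_sub (-1)).congr_deriv ?_
  simp only [id, Pi.pow_apply]
  generalize hD : t ^ 2 - t + 1 = D at h0 ⊢
  field_simp
  push_cast
  linear_combination (2 * D) * hD

theorem continuous_smoothNeg₂ : Continuous smoothNeg₂ := by
  refine Continuous.if_le ?_ continuous_const continuous_id continuous_const ?_
  · refine Continuous.div (by fun_prop) (by fun_prop) fun t => ?_
    exact pow_ne_zero 3 (sq_sub_self_add_one_pos t).ne'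
  · rintro t rfl
    norm_num

theorem contDiff_smoothNeg : ContDiff ℝ 2 smoothNeg := by
  have h1 : deriv smoothNeg = smoothNeg₁ := funext fun t => (hasDerivAt_smoothNeg t).deriv
  have h2 : deriv smoothNeg₁ = smoothNeg₂ := funext fun t => (hasDerivAt_smoothNeg₁ t).deriv
  rw [show (2 : WithTop ℕ∞) = 1 + 1 by norm_num, contDiff_succ_iff_deriv]
  refine ⟨fun t => (hasDerivAt_smoothNeg t).differentiableAt, by simp, ?_⟩
  rw [h1, contDiff_one_iff_deriv, h2]
  exact ⟨fun t => (hasDerivAt_smoothNeg₁ t).differentiableAt, continuous_smoothNeg₂⟩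

theorem smoothNeg₁_nonpos (t : ℝ) : smoothNeg₁ t ≤ 0 := by
  unfold smoothNeg₁
  split_ifs with h
  · have h0 := sq_sub_self_add_one_pos t
    rw [sub_nonpos, le_div_iff₀ (by positivity)]
    nlinarith [sq_nonneg t, mul_nonneg (neg_nonneg.2 h) (sq_nonneg t), sq_nonneg (t ^ 2)]
  · exact le_rfl

theorem smoothNeg₂_nonneg (t : ℝ) : 0 ≤ smoothNeg₂ t := by
  unfold smoothNeg₂
  split_ifs with h
  · have h0 := sq_sub_self_add_one_pos t
    refine div_nonneg ?_ (by positivity)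
    nlinarith [sq_nonneg t]
  · exact le_rfl

theorem neg_sub_one_le_smoothNeg (t : ℝ) : -t - 1 ≤ smoothNeg t := by
  unfold smoothNeg
  split_ifs with h
  · have := inv_pos.2 (sq_sub_self_add_one_pos t)
    linarith
  · linarith

theorem smoothNeg_le_of_neg_le {t v : ℝ} (hv : 0 ≤ v) (h : -t ≤ v) : smoothNeg t ≤ v := by
  unfold smoothNeg
  split_ifs with h0
  · have : (t ^ 2 - t + 1)⁻¹ ≤ 1 := inv_le_one_of_one_le₀ (by nlinarith)
    linarith
  · exact hv

variable {N : ℕ} {p q η K : ℝ} {U V c d : EuclideanSpace ℝ (Fin N) → ℝ}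

theorem IsSys.lap_comparison_nonpos (hS : IsSys p q η K U V c d) (hq : 0 < q) (hqp : q ≤ p)
    {l : ℝ} (hl : 0 < l) (hl4 : 4 ≤ (q + 1) / (p + 1) * l ^ (p + 1))
    {x : EuclideanSpace ℝ (Fin N)} (hx : ‖x‖ ≤ K)
    (hle : l * U x ^ ((q + 1) / (p + 1)) ≤ V x) :
    lap (fun x => l * U x ^ ((q + 1) / (p + 1)) - V x) x ≤ 0 := by
  set σ := (q + 1) / (p + 1) with hσ
  have hp : 0 < p := hq.trans_le hqp
  have hσ0 : 0 < σ := by positivity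
  have hσ1 : σ ≤ 1 := by rw [hσ, div_le_one (by positivity)]; linarith
  have hσp : σ * (p + 1) = q + 1 := by rw [hσ]; field_simp
  have hU := hS.left_pos x
  have hUσ : ContDiff ℝ 2 fun x => U x ^ σ :=
    contDiff_iff_contDiffAt.2 fun x => hS.contDiff_left.contDiffAt.rpow_const_of_ne (hS.left_pos x).ne'
  rw [lap_const_mul_sub l hUσ hS.contDiff_right,
    lap_comp (φ := fun t => t ^ σ) (φ' := fun t => σ * t ^ (σ - 1))
      (φ'' := fun t => σ * ((σ - 1) * t ^ (σ - 1 - 1))) (S := Ioi 0)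
      (fun t ht => Real.hasDerivAt_rpow_const (Or.inl (ne_of_gt ht)))
      (fun t ht => (Real.hasDerivAt_rpow_const (Or.inl (ne_of_gt ht))).const_mul σ)
      hS.contDiff_left hS.left_pos hUσ]
  have e1 := hS.lap_left x hx
  have e2 := hS.lap_right x hx
  have hc := (hS.coeff_left_mem x hx).1
  have hd := (hS.coeff_right_mem x hx).2
  have h1 : σ * ((σ - 1) * U x ^ (σ - 1 - 1)) * ∑ i, pd i U x ^ 2 ≤ 0 := by
    refine mul_nonpos_of_nonpos_of_nonneg ?_ (Finset.sum_nonneg fun i _ => sq_nonneg _)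
    refine mul_nonpos_of_nonneg_of_nonpos hσ0.le ?_
    exact mul_nonpos_of_nonpos_of_nonneg (by linarith) (by positivity)
  have h2 : l ^ p * U x ^ (σ * p) ≤ V x ^ p := by
    rw [Real.rpow_mul hU.le, ← Real.mul_rpow hl.le (by positivity)]
    exact Real.rpow_le_rpow (by positivity) hle hp.le
  have h3 : U x ^ q = U x ^ (σ - 1) * U x ^ (σ * p) := by
    rw [← Real.rpow_add hU]
    congr 1
    linarith
  have h4 : l ^ (p + 1) = l * l ^ p := by rw [Real.rpow_add_one hl.ne', mul_comm]
  have hUq := Real.rpow_pos_of_pos hU q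
  have hV := Real.rpow_pos_of_pos (hS.right_pos x) p
  have h5 : l * (σ * U x ^ (σ - 1)) * (1 / 2 * (l ^ p * U x ^ (σ * p)))
      ≤ l * (σ * U x ^ (σ - 1)) * (c x * V x ^ p) := by gcongr
  have h6 : l * (σ * U x ^ (σ - 1)) * (1 / 2 * (l ^ p * U x ^ (σ * p)))
      = 1 / 2 * (σ * l ^ (p + 1)) * U x ^ q := by rw [h3, h4]; ring
  have h7 : d x * U x ^ q ≤ 1 / 2 * (σ * l ^ (p + 1)) * U x ^ q := by
    gcongr
    linarith
  have h8 : lap U x = -(c x * V x ^ p) := by linarith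
  have h9 : lap V x = -(d x * U x ^ q) := by linarith
  rw [h8, h9]
  nlinarith [mul_nonneg hl.le (neg_nonneg.2 h1)]

/-- The pointwise comparison of the two components. -/
theorem IsSys.exists_rpow_le (hN : 3 ≤ N) (hq : 0 < q) (hqp : q ≤ p) (hpq : 1 < p * q)
    (R : ℝ) : ∃ C : ℝ, 0 < C ∧ ∀ {η K : ℝ} {U V c d : EuclideanSpace ℝ (Fin N) → ℝ},
      IsSys p q η K U V c d → R + 3 ≤ K → ∀ x, ‖x‖ ≤ R →
        V x ^ (p + 1) ≤ C * (U x ^ (q + 1) + 1) := by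
  have hp : 0 < p := hq.trans_le hqp
  obtain ⟨C₁, hC₁, hint⟩ := IsSys.exists_lintegral_le hN hp hq hpq (R + 1)
  obtain ⟨C₂, hC₂, hker⟩ := exists_ofReal_le hN
  set σ := (q + 1) / (p + 1) with hσ
  have hσ0 : 0 < σ := by positivity
  have hσp : σ * (p + 1) = q + 1 := by rw [hσ]; field_simp
  set l : ℝ := (4 / σ) ^ (p + 1)⁻¹ with hl
  have hl0 : 0 < l := by positivity
  have hlp : σ * l ^ (p + 1) = 4 := by
    rw [hl, ← Real.rpow_mul (by positivity), inv_mul_cancel₀ (by positivity), Real.rpow_one]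
    field_simp
  set M : ℝ := (C₂ * C₁).toReal with hM
  have hM0 : 0 ≤ M := ENNReal.toReal_nonneg
  refine ⟨2 ^ (p + 1) * (l ^ (p + 1) + (M + 1) ^ (p + 1)), by positivity,
    fun {η K U V c d} hS hK x hx => ?_⟩
  have hU := hS.left_pos x
  set W : EuclideanSpace ℝ (Fin N) → ℝ := fun x => l * U x ^ σ - V x with hW
  have hUσ : ContDiff ℝ 2 fun x => U x ^ σ :=
    contDiff_iff_contDiffAt.2 fun x => hS.contDiff_left.contDiffAt.rpow_const_of_ne (hS.left_pos x).ne'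
  have hWc : ContDiff ℝ 2 W := (contDiff_const.mul hUσ).sub hS.contDiff_right
  have hΨ : ContDiff ℝ 2 fun x => smoothNeg (W x) := contDiff_smoothNeg.comp hWc
  have hball : ∀ z ∈ closedBall x 1, ‖z‖ ≤ R + 1 := by
    intro z hz
    have := norm_le_norm_add_norm_sub' z x
    rw [mem_closedBall, dist_eq_norm] at hz
    linarith
  have hlap : ∀ z ∈ closedBall x 1, -lap (fun x => smoothNeg (W x)) z ≤ 0 := by
    intro z hz
    rw [lap_comp (S := univ) (fun t _ => hasDerivAt_smoothNeg t)
      (fun t _ => hasDerivAt_smoothNeg₁ t) hWc (fun _ => mem_univ _) hΨ, neg_nonpos]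
    refine add_nonneg ?_ (mul_nonneg (smoothNeg₂_nonneg _)
      (Finset.sum_nonneg fun i _ => sq_nonneg _))
    by_cases h0 : W z ≤ 0
    · exact mul_nonneg_of_nonpos_of_nonpos (smoothNeg₁_nonpos _)
        (hS.lap_comparison_nonpos hq hqp hl0 hlp.ge ((hball z hz).trans (by linarith))
          (by simp only [hW] at h0; linarith))
    · rw [smoothNeg₁, if_neg h0, zero_mul]
  have hle : ∀ z, smoothNeg (W z) ≤ V z := by
    intro z
    have : 0 ≤ l * U z ^ σ := mul_nonneg hl0.le (Real.rpow_nonneg (hS.left_pos z).le _)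
    exact smoothNeg_le_of_neg_le (hS.right_pos z).le (by simp only [hW]; linarith)
  have hsub : closedBall x 1 ⊆ closedBall 0 (R + 1) := fun z hz =>
    mem_closedBall_zero_iff.2 (hball z hz)
  have hb : ENNReal.ofReal (smoothNeg (W x)) ≤ C₂ * C₁ := by
    refine (hker _ x hΨ).trans (mul_le_mul' le_rfl ?_)
    have h0 : ∫⁻ z in closedBall x 1, ‖z - x‖ₑ ^ (2 - N : ℝ) *
        ENNReal.ofReal (-lap (fun x => smoothNeg (W x)) z) = 0 := by
      rw [setLIntegral_congr_fun (g := fun _ => 0) measurableSet_closedBall ?_, lintegral_zero]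
      intro z hz
      simp only
      rw [ENNReal.ofReal_of_nonpos (hlap z hz), mul_zero]
    rw [h0, add_zero]
    refine le_trans ?_ (hint hS (by linarith)).2
    exact (lintegral_mono fun z => ENNReal.ofReal_le_ofReal (hle z)).trans (lintegral_mono_set hsub)
  have hb' : smoothNeg (W x) ≤ M := (ENNReal.ofReal_le_iff_le_toReal (by finiteness)).1 hb
  have hV : V x ≤ l * U x ^ σ + (M + 1) := by
    have := neg_sub_one_le_smoothNeg (W x)
    simp only [hW] at this hb'
    linarith
  have ha : 0 ≤ l * U x ^ σ := by positivity
  have hmax : V x ≤ 2 * max (l * U x ^ σ) (M + 1) := by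
    have := le_max_left (l * U x ^ σ) (M + 1)
    have := le_max_right (l * U x ^ σ) (M + 1)
    linarith
  have hpow : (l * U x ^ σ) ^ (p + 1) = l ^ (p + 1) * U x ^ (q + 1) := by
    rw [Real.mul_rpow hl0.le (by positivity), ← Real.rpow_mul hU.le, hσp]
  have hUq : 0 < U x ^ (q + 1) := by positivity
  have hlq : 0 < l ^ (p + 1) := by positivity
  have hMq : 0 < (M + 1) ^ (p + 1) := by positivity
  calc V x ^ (p + 1) ≤ (2 * max (l * U x ^ σ) (M + 1)) ^ (p + 1) :=
        Real.rpow_le_rpow (hS.right_pos x).le hmax (by linarith)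
    _ = 2 ^ (p + 1) * max (l * U x ^ σ) (M + 1) ^ (p + 1) :=
        Real.mul_rpow (by norm_num) (le_max_of_le_left ha)
    _ ≤ 2 ^ (p + 1) * ((l ^ (p + 1) + (M + 1) ^ (p + 1)) * (U x ^ (q + 1) + 1)) := by
        gcongr
        rcases max_cases (l * U x ^ σ) (M + 1) with h | h <;> rw [h.1]
        · rw [hpow]; nlinarith
        · nlinarith
    _ = _ := by ring

end Comparison

section Divergence

variable {n : ℕ}

/-- The closed cube with side length `2 * r` centered at the origin. -/
def cube (N : ℕ) (r : ℝ) : Set (EuclideanSpace ℝ (Fin N)) := {z | ∀ i, |z i| ≤ r}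

/-- The point of a coordinate hyperplane with given coordinates. -/
def facePoint (i : Fin (n + 1)) (t : ℝ) (y : Fin n → ℝ) : EuclideanSpace ℝ (Fin (n + 1)) :=
  WithLp.toLp 2 (i.insertNth t y)

theorem isClosed_cube (N : ℕ) (r : ℝ) : IsClosed (cube N r) := by
  simp only [cube, Set.ofPred_forall]
  exact isClosed_iInter fun i => isClosed_le (by fun_prop) continuous_const

theorem toLp_mem_cube {N : ℕ} {r : ℝ} {y : Fin N → ℝ} :
    WithLp.toLp 2 y ∈ cube N r ↔ y ∈ Icc (fun _ => -r) (fun _ => r) := by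
  simp only [cube, Set.mem_ofPred_eq, abs_le, mem_Icc, Pi.le_def, forall_and]

theorem integral_cube {N : ℕ} (r : ℝ) (f : EuclideanSpace ℝ (Fin N) → ℝ) :
    ∫ z in cube N r, f z = ∫ y in Icc (fun _ => -r) (fun _ => r), f (WithLp.toLp 2 y) := by
  have he : MeasurableEmbedding (WithLp.toLp 2 : (Fin N → ℝ) → EuclideanSpace ℝ (Fin N)) :=
    (MeasurableEquiv.toLp 2 (Fin N → ℝ)).measurableEmbedding
  rw [← (PiLp.volume_preserving_toLp (Fin N)).setIntegral_preimage_emb he]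
  congr 2
  ext y
  exact toLp_mem_cube

theorem lintegral_cube {N : ℕ} (r : ℝ) (f : EuclideanSpace ℝ (Fin N) → ENNReal) :
    ∫⁻ z in cube N r, f z = ∫⁻ y in Icc (fun _ => -r) (fun _ => r), f (WithLp.toLp 2 y) := by
  have he : MeasurableEmbedding (WithLp.toLp 2 : (Fin N → ℝ) → EuclideanSpace ℝ (Fin N)) :=
    (MeasurableEquiv.toLp 2 (Fin N → ℝ)).measurableEmbedding
  rw [← (PiLp.volume_preserving_toLp (Fin N)).setLIntegral_comp_preimage_emb he]
  congr 2
  ext y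
  exact toLp_mem_cube

theorem continuous_facePoint (i : Fin (n + 1)) (t : ℝ) : Continuous (facePoint i t) := by
  unfold facePoint
  fun_prop

/-- The divergence theorem on a cube. -/
theorem integral_cube_sum_pd {P : Fin (n + 1) → EuclideanSpace ℝ (Fin (n + 1)) → ℝ}
    (hP : ∀ i, ContDiff ℝ 1 (P i)) {r : ℝ} (hr : 0 ≤ r) :
    ∫ z in cube (n + 1) r, ∑ i, pd i (P i) z
      = ∑ i, ((∫ y in Icc (fun _ => -r) (fun _ => r), P i (facePoint i r y))
        - ∫ y in Icc (fun _ => -r) (fun _ => r), P i (facePoint i (-r) y)) := by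
  rw [integral_cube]
  set L := (PiLp.continuousLinearEquiv 2 ℝ (fun _ : Fin (n + 1) => ℝ)).symm with hL
  have hLt : ∀ y, L y = WithLp.toLp 2 y := fun y => rfl
  have hc : ∀ i, ContDiff ℝ 1 fun y => P i (L y) := fun i => (hP i).comp L.contDiff
  have hpd : ∀ i y, pd i (P i) (L y) = fderiv ℝ (fun y => P i (L y)) y (Pi.single i 1) := by
    intro i y
    have h1 : HasFDerivAt (fun y => P i (L y)) _ y :=
      ((hP i).differentiable one_ne_zero (L y)).hasFDerivAt.comp y L.hasFDerivAt
    rw [h1.fderiv, pd]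
    rfl
  have hcont : Continuous fun y => ∑ i, pd i (P i) (L y) :=
    continuous_finsetSum _ fun i _ => (continuous_pd (hP i) i).comp L.continuous
  have := integral_divergence_of_hasFDerivAt_off_countable' (fun _ : Fin (n + 1) => -r) (fun _ => r)
    (fun i => by linarith) (fun i y => P i (L y)) (fun i y => fderiv ℝ (fun y => P i (L y)) y) ∅
    countable_empty (fun i => (hc i).continuous.continuousOn)
    (fun y _ i => ((hc i).differentiable one_ne_zero y).hasFDerivAt) ?_
  · simp only [← hpd] at this
    exact this
  · simp only [← hpd]
    exact hcont.continuousOn.integrableOn_compact isCompact_Icc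

end Divergence

section Pohozaev

variable {N : ℕ} {f U V c d : EuclideanSpace ℝ (Fin N) → ℝ} {x : EuclideanSpace ℝ (Fin N)}

theorem fderiv_self_eq_sum (x : EuclideanSpace ℝ (Fin N)) : fderiv ℝ f x x = ∑ i, x i * pd i f x := by
  simp only [pd]
  generalize fderiv ℝ f x = L
  conv_lhs => rw [← (EuclideanSpace.basisFun (Fin N) ℝ).sum_repr x]
  simp

theorem pd_coord (i j : Fin N) : pd i (fun z : EuclideanSpace ℝ (Fin N) => z j) x
    = if i = j then 1 else 0 := by
  have : HasFDerivAt (fun z : EuclideanSpace ℝ (Fin N) => z j)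
    (EuclideanSpace.proj j : EuclideanSpace ℝ (Fin N) →L[ℝ] ℝ) x :=
    (EuclideanSpace.proj j : EuclideanSpace ℝ (Fin N) →L[ℝ] ℝ).hasFDerivAt
  rw [pd, this.fderiv]
  simp [eq_comm]

theorem pd_sum {ι : Type*} {s : Finset ι} {F : ι → EuclideanSpace ℝ (Fin N) → ℝ}
    (hF : ∀ j ∈ s, DifferentiableAt ℝ (F j) x) (i : Fin N) :
    pd i (fun z => ∑ j ∈ s, F j z) x = ∑ j ∈ s, pd i (F j) x := by
  simp only [pd]
  rw [fderiv_fun_sum hF]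
  simp

/-- The energy density in the Pohozaev identity. -/
noncomputable def energyDensity (p q : ℝ) (U V c d : EuclideanSpace ℝ (Fin N) → ℝ)
    (z : EuclideanSpace ℝ (Fin N)) : ℝ :=
  c z * V z ^ (p + 1) / (p + 1) + d z * U z ^ (q + 1) / (q + 1)

/-- The vector field of the Pohozaev identity. -/
noncomputable def pohozaevField (p q a₁ a₂ : ℝ) (U V c d : EuclideanSpace ℝ (Fin N) → ℝ) (i : Fin N)
    (z : EuclideanSpace ℝ (Fin N)) : ℝ :=
  (∑ j, z j * pd j U z) * pd i V z + (∑ j, z j * pd j V z) * pd i U z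
    - (∑ j, pd j U z * pd j V z) * z i + a₁ * (V z * pd i U z) + a₂ * (U z * pd i V z)
    + z i * energyDensity p q U V c d z

theorem contDiff_coord (i : Fin N) : ContDiff ℝ 1 fun z : EuclideanSpace ℝ (Fin N) => z i := by
  fun_prop

section

variable {p q η K : ℝ}

theorem IsSys.contDiff_energyDensity (hS : IsSys p q η K U V c d) :
    ContDiff ℝ 1 (energyDensity p q U V c d) := by
  have hU : ContDiff ℝ 1 U := hS.contDiff_left.of_le (by norm_num)
  have hV : ContDiff ℝ 1 V := hS.contDiff_right.of_le (by norm_num)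
  have h1 : ∀ s : ℝ, ContDiff ℝ 1 fun x => U x ^ s := fun s =>
    contDiff_iff_contDiffAt.2 fun x => hU.contDiffAt.rpow_const_of_ne (hS.left_pos x).ne'
  have h2 : ∀ s : ℝ, ContDiff ℝ 1 fun x => V x ^ s := fun s =>
    contDiff_iff_contDiffAt.2 fun x => hV.contDiffAt.rpow_const_of_ne (hS.right_pos x).ne'
  exact ((hS.contDiff_coeff_left.mul (h2 _)).div_const _).add
    ((hS.contDiff_coeff_right.mul (h1 _)).div_const _)

theorem IsSys.contDiff_pohozaevField (hS : IsSys p q η K U V c d) (a₁ a₂ : ℝ) (i : Fin N) :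
    ContDiff ℝ 1 (pohozaevField p q a₁ a₂ U V c d i) := by
  have hU : ContDiff ℝ 1 U := hS.contDiff_left.of_le (by norm_num)
  have hV : ContDiff ℝ 1 V := hS.contDiff_right.of_le (by norm_num)
  have hH := hS.contDiff_energyDensity
  have h1 := contDiff_pd hS.contDiff_left
  have h2 := contDiff_pd hS.contDiff_right
  exact ((((((ContDiff.sum fun j _ => (contDiff_coord j).mul (h1 j)).mul (h2 i)).add
    ((ContDiff.sum fun j _ => (contDiff_coord j).mul (h2 j)).mul (h1 i))).sub
    ((ContDiff.sum fun j _ => (h1 j).mul (h2 j)).mul (contDiff_coord i))).add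
    (contDiff_const.mul (hV.mul (h1 i)))).add (contDiff_const.mul (hU.mul (h2 i)))).add
    ((contDiff_coord i).mul hH)

theorem IsSys.pd_energyDensity (hS : IsSys p q η K U V c d) (hp : 0 < p) (hq : 0 < q) (i : Fin N) :
    pd i (energyDensity p q U V c d) x
      = pd i c x * V x ^ (p + 1) / (p + 1) + c x * V x ^ p * pd i V x
        + pd i d x * U x ^ (q + 1) / (q + 1) + d x * U x ^ q * pd i U x := by
  have hU := hS.contDiff_left.differentiable (by norm_num) x
  have hV := hS.contDiff_right.differentiable (by norm_num) x
  have hc := hS.contDiff_coeff_left.differentiable (by norm_num) x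
  have hd := hS.contDiff_coeff_right.differentiable (by norm_num) x
  have e1 := Real.hasDerivAt_rpow_const (p := p + 1) (Or.inl (hS.right_pos x).ne')
  have e2 := Real.hasDerivAt_rpow_const (p := q + 1) (Or.inl (hS.left_pos x).ne')
  have h1 : DifferentiableAt ℝ (fun x => V x ^ (p + 1)) x := e1.differentiableAt.comp x hV
  have h2 : DifferentiableAt ℝ (fun x => U x ^ (q + 1)) x := e2.differentiableAt.comp x hU
  have e : energyDensity p q U V c d = fun z =>
      (p + 1)⁻¹ * (c z * V z ^ (p + 1)) + (q + 1)⁻¹ * (d z * U z ^ (q + 1)) := by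
    funext z
    simp only [energyDensity]
    ring
  rw [e, pd_add ((hc.fun_mul h1).const_mul _) ((hd.fun_mul h2).const_mul _),
    pd_const_mul _ (hc.fun_mul h1), pd_const_mul _ (hd.fun_mul h2), pd_mul hc h1, pd_mul hd h2,
    pd_comp e1 hV, pd_comp e2 hU, add_sub_cancel_right, add_sub_cancel_right]
  field_simp
  ring

theorem IsSys.pd_pohozaevField (hS : IsSys p q η K U V c d) (a₁ a₂ : ℝ) (i : Fin N) :
    pd i (pohozaevField p q a₁ a₂ U V c d i) x
      = (pd i U x + ∑ j, x j * pd i (pd j U) x) * pd i V x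
        + (∑ j, x j * pd j U x) * pd i (pd i V) x
        + (pd i V x + ∑ j, x j * pd i (pd j V) x) * pd i U x
        + (∑ j, x j * pd j V x) * pd i (pd i U) x
        - (∑ j, (pd i (pd j U) x * pd j V x + pd j U x * pd i (pd j V) x)) * x i
        - (∑ j, pd j U x * pd j V x)
        + a₁ * (pd i V x * pd i U x + V x * pd i (pd i U) x)
        + a₂ * (pd i U x * pd i V x + U x * pd i (pd i V) x)
        + energyDensity p q U V c d x + x i * pd i (energyDensity p q U V c d) x := by
  have hU := hS.contDiff_left.differentiable (by norm_num) x
  have hV := hS.contDiff_right.differentiable (by norm_num) x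
  have hH := hS.contDiff_energyDensity.differentiable (by norm_num) x
  have h1 := fun j => (contDiff_pd hS.contDiff_left j).differentiable (by norm_num) x
  have h2 := fun j => (contDiff_pd hS.contDiff_right j).differentiable (by norm_num) x
  have h3 := fun j => (contDiff_coord (N := N) j).differentiable (by norm_num) x
  have hXU : DifferentiableAt ℝ (fun z => ∑ j, z j * pd j U z) x :=
    DifferentiableAt.fun_sum fun j _ => (h3 j).fun_mul (h1 j)
  have hXV : DifferentiableAt ℝ (fun z => ∑ j, z j * pd j V z) x :=
    DifferentiableAt.fun_sum fun j _ => (h3 j).fun_mul (h2 j)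
  have hD : DifferentiableAt ℝ (fun z => ∑ j, pd j U z * pd j V z) x :=
    DifferentiableAt.fun_sum fun j _ => (h1 j).fun_mul (h2 j)
  have k1 := hXU.fun_mul (h2 i)
  have k2 := hXV.fun_mul (h1 i)
  have k3 := hD.fun_mul (h3 i)
  have k4 := (hV.fun_mul (h1 i)).const_mul a₁
  have k5 := (hU.fun_mul (h2 i)).const_mul a₂
  have k6 := (h3 i).fun_mul hH
  have pXU : pd i (fun z => ∑ j, z j * pd j U z) x = pd i U x + ∑ j, x j * pd i (pd j U) x := by
    rw [pd_sum (F := fun j z => z j * pd j U z) fun j _ => (h3 j).fun_mul (h1 j)]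
    simp_rw [fun j => pd_mul (h3 j) (h1 j) i, pd_coord, Finset.sum_add_distrib]
    simp [add_comm]
  have pXV : pd i (fun z => ∑ j, z j * pd j V z) x = pd i V x + ∑ j, x j * pd i (pd j V) x := by
    rw [pd_sum (F := fun j z => z j * pd j V z) fun j _ => (h3 j).fun_mul (h2 j)]
    simp_rw [fun j => pd_mul (h3 j) (h2 j) i, pd_coord, Finset.sum_add_distrib]
    simp [add_comm]
  have pD : pd i (fun z => ∑ j, pd j U z * pd j V z) x
      = ∑ j, (pd i (pd j U) x * pd j V x + pd j U x * pd i (pd j V) x) := by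
    rw [pd_sum (F := fun j z => pd j U z * pd j V z) fun j _ => (h1 j).fun_mul (h2 j)]
    simp_rw [fun j => pd_mul (h1 j) (h2 j) i, add_comm]
  unfold pohozaevField
  rw [pd_add ((((k1.fun_add k2).fun_sub k3).fun_add k4).fun_add k5) k6, pd_add (((k1.fun_add k2).fun_sub k3).fun_add k4) k5,
    pd_add ((k1.fun_add k2).fun_sub k3) k4, pd_sub (k1.fun_add k2) k3, pd_add k1 k2, pd_mul hXU (h2 i),
    pd_mul hXV (h1 i), pd_mul hD (h3 i), pd_const_mul _ (hV.fun_mul (h1 i)),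
    pd_const_mul _ (hU.fun_mul (h2 i)), pd_mul hV (h1 i), pd_mul hU (h2 i), pd_mul (h3 i) hH,
    pXU, pXV, pD, pd_coord, if_pos rfl]
  ring

theorem IsSys.sum_pd_pohozaevField (hS : IsSys p q η K U V c d) (hp : 0 < p) (hq : 0 < q)
    {a₁ a₂ : ℝ} (ha : a₁ + a₂ = N - 2) (hx : ‖x‖ ≤ K) :
    ∑ i, pd i (pohozaevField p q a₁ a₂ U V c d i) x
      = (N / (p + 1) - a₁) * (c x * V x ^ (p + 1)) + (N / (q + 1) - a₂) * (d x * U x ^ (q + 1))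
        + fderiv ℝ c x x * V x ^ (p + 1) / (p + 1) + fderiv ℝ d x x * U x ^ (q + 1) / (q + 1) := by
  have eU := hS.lap_left x hx
  have eV := hS.lap_right x hx
  rw [lap_eq_sum_pd hS.contDiff_left] at eU
  rw [lap_eq_sum_pd hS.contDiff_right] at eV
  rw [fderiv_self_eq_sum, fderiv_self_eq_sum]
  simp_rw [hS.pd_pohozaevField, hS.pd_energyDensity hp hq]
  have s1 : ∑ i, (∑ j, x j * pd i (pd j U) x) * pd i V x
      = ∑ i, (∑ j, pd i (pd j U) x * pd j V x) * x i := by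
    simp_rw [Finset.sum_mul]
    rw [Finset.sum_comm]
    refine Finset.sum_congr rfl fun i _ => Finset.sum_congr rfl fun j _ => ?_
    rw [pd_comm hS.contDiff_left j i]
    ring
  have s2 : ∑ i, (∑ j, x j * pd i (pd j V) x) * pd i U x
      = ∑ i, (∑ j, pd j U x * pd i (pd j V) x) * x i := by
    simp_rw [Finset.sum_mul]
    rw [Finset.sum_comm]
    refine Finset.sum_congr rfl fun i _ => Finset.sum_congr rfl fun j _ => ?_
    rw [pd_comm hS.contDiff_right j i]
    ring
  have s3 : ∑ i : Fin N, energyDensity p q U V c d x = N * energyDensity p q U V c d x := by simp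
  have s4 : ∑ i : Fin N, ∑ j, pd j U x * pd j V x = N * ∑ j, pd j U x * pd j V x := by simp
  have s5 : ∑ i, pd i V x * pd i U x = ∑ i, pd i U x * pd i V x :=
    Finset.sum_congr rfl fun i _ => mul_comm _ _
  have s6 : ∑ i, x i * (pd i c x * V x ^ (p + 1) / (p + 1) + c x * V x ^ p * pd i V x
        + pd i d x * U x ^ (q + 1) / (q + 1) + d x * U x ^ q * pd i U x)
      = (∑ i, x i * pd i c x) * V x ^ (p + 1) / (p + 1) + c x * V x ^ p * (∑ i, x i * pd i V x)
        + (∑ i, x i * pd i d x) * U x ^ (q + 1) / (q + 1)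
        + d x * U x ^ q * (∑ i, x i * pd i U x) := by
    simp only [Finset.sum_mul, Finset.mul_sum, Finset.sum_div, ← Finset.sum_add_distrib]
    refine Finset.sum_congr rfl fun i _ => ?_
    ring
  simp only [Finset.sum_add_distrib, Finset.sum_sub_distrib, add_mul, ← Finset.mul_sum] at s6 ⊢
  rw [s1, s2, s3, s4, s5, s6]
  have r1 : V x ^ (p + 1) = V x ^ p * V x := Real.rpow_add_one (hS.right_pos x).ne' p
  have r2 : U x ^ (q + 1) = U x ^ q * U x := Real.rpow_add_one (hS.left_pos x).ne' q
  have hp1 : p + 1 ≠ 0 := by positivity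
  have hq1 : q + 1 ≠ 0 := by positivity
  have eE : energyDensity p q U V c d x = c x * V x ^ (p + 1) / (p + 1)
    + d x * U x ^ (q + 1) / (q + 1) := rfl
  rw [eE, r1, r2]
  linear_combination (-(∑ j, x j * pd j V x) - a₁ * V x) * eU
    + (-(∑ j, x j * pd j U x) - a₂ * U x) * eV + (∑ j, pd j U x * pd j V x) * ha

end

end Pohozaev

section PohozaevInequality

variable {N : ℕ} {f U V c d : EuclideanSpace ℝ (Fin N) → ℝ} {x : EuclideanSpace ℝ (Fin N)}
  {p q η K : ℝ}

/-- The sum of the absolute values of a function and its partial derivatives. -/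
noncomputable def gradSum (f : EuclideanSpace ℝ (Fin N) → ℝ) (x : EuclideanSpace ℝ (Fin N)) : ℝ :=
  |f x| + ∑ i, |pd i f x|

theorem sum_abs_pd_le_gradSum : ∑ i, |pd i f x| ≤ gradSum f x :=
  le_add_of_nonneg_left (abs_nonneg _)

theorem gradSum_nonneg : 0 ≤ gradSum f x :=
  add_nonneg (abs_nonneg _) (Finset.sum_nonneg fun _ _ => abs_nonneg _)

theorem abs_pd_le_gradSum (i : Fin N) : |pd i f x| ≤ gradSum f x :=
  (Finset.single_le_sum (f := fun i => |pd i f x|) (fun _ _ => abs_nonneg _)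
    (Finset.mem_univ i)).trans sum_abs_pd_le_gradSum

theorem abs_le_gradSum : |f x| ≤ gradSum f x :=
  le_add_of_nonneg_right (Finset.sum_nonneg fun _ _ => abs_nonneg _)

theorem norm_le_of_mem_cube {r : ℝ} (hx : x ∈ cube N r) : ‖x‖ ≤ N * r := by
  conv_lhs => rw [← (EuclideanSpace.basisFun (Fin N) ℝ).sum_repr x]
  refine (norm_sum_le _ _).trans ?_
  calc ∑ i : Fin N, ‖(EuclideanSpace.basisFun (Fin N) ℝ).repr x i •
        EuclideanSpace.basisFun (Fin N) ℝ i‖ ≤ ∑ i : Fin N, r := by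
        refine Finset.sum_le_sum fun i _ => ?_
        rw [norm_smul, (EuclideanSpace.basisFun (Fin N) ℝ).norm_eq_one, mul_one]
        exact hx i
    _ = N * r := by simp

theorem facePoint_mem_cube {n : ℕ} {i : Fin (n + 1)} {r t : ℝ} {y : Fin n → ℝ} (ht : |t| ≤ r)
    (hy : y ∈ Icc (fun _ => -r) (fun _ => r)) : facePoint i t y ∈ cube (n + 1) r := by
  rw [facePoint, toLp_mem_cube]
  refine ⟨fun j => ?_, fun j => ?_⟩ <;> refine Fin.succAboveCases i ?_ (fun k => ?_) j
  · simpa using (abs_le.1 ht).1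
  · simpa using hy.1 k
  · simpa using (abs_le.1 ht).2
  · simpa using hy.2 k

theorem isCompact_cube (r : ℝ) : IsCompact (cube N r) :=
  Metric.isCompact_of_isClosed_isBounded (isClosed_cube N r)
    (isBounded_iff_forall_norm_le.2 ⟨N * r, fun _ hx => norm_le_of_mem_cube hx⟩)

theorem IsSys.abs_pohozaevField_le (hS : IsSys p q η K U V c d) (hp : 0 < p) (hq : 0 < q)
    {a₁ a₂ : ℝ} (hx : ‖x‖ ≤ K) (hx2 : x ∈ cube N 2) (i : Fin N) :
    |pohozaevField p q a₁ a₂ U V c d i x|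
      ≤ (6 + |a₁| + |a₂|) * (gradSum U x * gradSum V x + (U x ^ (q + 1) + V x ^ (p + 1))) := by
  have hV : 0 < V x ^ (p + 1) := Real.rpow_pos_of_pos (hS.right_pos x) _
  have hU : 0 < U x ^ (q + 1) := Real.rpow_pos_of_pos (hS.left_pos x) _
  obtain ⟨c1, c2⟩ := hS.coeff_left_mem x hx
  obtain ⟨d1, d2⟩ := hS.coeff_right_mem x hx
  have gU := gradSum_nonneg (f := U) (x := x)
  have gV := gradSum_nonneg (f := V) (x := x)
  have hs : ∀ f : EuclideanSpace ℝ (Fin N) → ℝ, |∑ j, x j * pd j f x| ≤ 2 * gradSum f x := by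
    intro f
    calc |∑ j, x j * pd j f x| ≤ ∑ j, 2 * |pd j f x| := by
          refine (Finset.abs_sum_le_sum_abs _ _).trans (Finset.sum_le_sum fun j _ => ?_)
          rw [abs_mul]
          exact mul_le_mul_of_nonneg_right (hx2 j) (abs_nonneg _)
      _ = 2 * ∑ j, |pd j f x| := by rw [Finset.mul_sum]
      _ ≤ 2 * gradSum f x := by linarith [sum_abs_pd_le_gradSum (f := f) (x := x)]
  have t1 : |(∑ j, x j * pd j U x) * pd i V x| ≤ 2 * (gradSum U x * gradSum V x) := by
    rw [abs_mul, ← mul_assoc]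
    exact mul_le_mul (hs U) (abs_pd_le_gradSum i) (abs_nonneg _) (by positivity)
  have t2 : |(∑ j, x j * pd j V x) * pd i U x| ≤ 2 * (gradSum U x * gradSum V x) := by
    rw [abs_mul, mul_comm (gradSum U x), ← mul_assoc]
    exact mul_le_mul (hs V) (abs_pd_le_gradSum i) (abs_nonneg _) (by positivity)
  have t3 : |(∑ j, pd j U x * pd j V x) * x i| ≤ 2 * (gradSum U x * gradSum V x) := by
    rw [abs_mul, mul_comm 2]
    refine mul_le_mul ?_ (hx2 i) (abs_nonneg _) (by positivity)
    calc |∑ j, pd j U x * pd j V x| ≤ ∑ j, |pd j U x| * gradSum V x := by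
          refine (Finset.abs_sum_le_sum_abs _ _).trans (Finset.sum_le_sum fun j _ => ?_)
          rw [abs_mul]
          exact mul_le_mul_of_nonneg_left (abs_pd_le_gradSum j) (abs_nonneg _)
      _ = (∑ j, |pd j U x|) * gradSum V x := by rw [Finset.sum_mul]
      _ ≤ _ := mul_le_mul_of_nonneg_right sum_abs_pd_le_gradSum gV
  have t4 : |a₁ * (V x * pd i U x)| ≤ |a₁| * (gradSum U x * gradSum V x) := by
    rw [abs_mul, abs_mul, mul_comm (gradSum U x)]
    exact mul_le_mul_of_nonneg_left (mul_le_mul abs_le_gradSum (abs_pd_le_gradSum i)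
      (abs_nonneg _) gV) (abs_nonneg _)
  have t5 : |a₂ * (U x * pd i V x)| ≤ |a₂| * (gradSum U x * gradSum V x) := by
    rw [abs_mul, abs_mul]
    exact mul_le_mul_of_nonneg_left (mul_le_mul abs_le_gradSum (abs_pd_le_gradSum i)
      (abs_nonneg _) gU) (abs_nonneg _)
  have hE : |energyDensity p q U V c d x| ≤ 2 * (U x ^ (q + 1) + V x ^ (p + 1)) := by
    rw [energyDensity, abs_of_nonneg (by positivity)]
    have h1 : c x * V x ^ (p + 1) / (p + 1) ≤ 2 * V x ^ (p + 1) :=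
      (div_le_self (by positivity) (by linarith)).trans (mul_le_mul_of_nonneg_right c2 hV.le)
    have h2 : d x * U x ^ (q + 1) / (q + 1) ≤ 2 * U x ^ (q + 1) :=
      (div_le_self (by positivity) (by linarith)).trans (mul_le_mul_of_nonneg_right d2 hU.le)
    linarith
  have t6 : |x i * energyDensity p q U V c d x| ≤ 4 * (U x ^ (q + 1) + V x ^ (p + 1)) := by
    rw [abs_mul]
    have := mul_le_mul (hx2 i) hE (abs_nonneg _) (by norm_num)
    linarith
  have hP : |pohozaevField p q a₁ a₂ U V c d i x| ≤ (6 + |a₁| + |a₂|) * (gradSum U x * gradSum V x)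
      + 4 * (U x ^ (q + 1) + V x ^ (p + 1)) := by
    rw [pohozaevField]
    rw [abs_le] at *
    constructor <;> linarith
  have h0 : 0 ≤ (2 + |a₁| + |a₂|) * (U x ^ (q + 1) + V x ^ (p + 1)) := by positivity
  linarith

/-- The quantity controlling the boundary terms of the Pohozaev identity. -/
noncomputable def boundaryDensity (p q : ℝ) (U V : EuclideanSpace ℝ (Fin N) → ℝ)
    (z : EuclideanSpace ℝ (Fin N)) : ENNReal :=
  ENNReal.ofReal (gradSum U z) * ENNReal.ofReal (gradSum V z)
    + ENNReal.ofReal (U z ^ (q + 1) + V z ^ (p + 1))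

/-- The energy on a cube is controlled by boundary terms. -/
theorem IsSys.exists_lintegral_energy_le {n : ℕ} (hp : 0 < p) (hq : 0 < q)
    (hhyper : ((n + 1 : ℕ) : ℝ) / (p + 1) + (n + 1 : ℕ) / (q + 1) > (n + 1 : ℕ) - 2) :
    ∃ η > 0, ∃ C : ENNReal, C ≠ ⊤ ∧ ∀ {K : ℝ} {U V c d : EuclideanSpace ℝ (Fin (n + 1)) → ℝ},
      IsSys p q η K U V c d → ((n + 1 : ℕ) : ℝ) * 2 ≤ K → ∀ r ∈ Icc (1 : ℝ) 2,
        ∫⁻ z in cube (n + 1) r, ENNReal.ofReal (U z ^ (q + 1) + V z ^ (p + 1))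
          ≤ C * ∑ i, ((∫⁻ y in Icc (fun _ => -r) (fun _ => r), boundaryDensity p q U V
              (facePoint i r y))
            + ∫⁻ y in Icc (fun _ => -r) (fun _ => r), boundaryDensity p q U V
              (facePoint i (-r) y)) := by
  set M : ℝ := ((n + 1 : ℕ) : ℝ) with hM
  set e : ℝ := (M / (p + 1) + M / (q + 1) - (M - 2)) / 2 with he
  have he0 : 0 < e := by rw [he]; linarith
  set a₁ : ℝ := M / (p + 1) - e with ha₁
  set a₂ : ℝ := M / (q + 1) - e with ha₂
  refine ⟨e / 4, by positivity, ENNReal.ofReal (4 / e * (6 + |a₁| + |a₂|)), ENNReal.ofReal_ne_top,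
    fun {K U V c d} hS hK r hr => ?_⟩
  have hr0 : 0 ≤ r := by linarith [hr.1]
  set G : EuclideanSpace ℝ (Fin (n + 1)) → ℝ := fun z => U z ^ (q + 1) + V z ^ (p + 1) with hG
  have hGc : Continuous G := (hS.continuous_rpow _).add (hS.swap.continuous_rpow _)
  have hG0 : ∀ z, 0 ≤ G z := fun z =>
    add_nonneg (Real.rpow_nonneg (hS.left_pos z).le _) (Real.rpow_nonneg (hS.right_pos z).le _)
  set A : ℝ := 6 + |a₁| + |a₂| with hA
  have hA0 : 0 < A := by positivity
  have hcub : ∀ z ∈ cube (n + 1) r, ‖z‖ ≤ K ∧ z ∈ cube (n + 1) 2 := fun z hz =>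
    have h2 : z ∈ cube (n + 1) 2 := fun i => (hz i).trans hr.2
    ⟨(norm_le_of_mem_cube h2).trans hK, h2⟩
  set P := pohozaevField p q a₁ a₂ U V c d with hP
  have hPc : ∀ i, ContDiff ℝ 1 (P i) := hS.contDiff_pohozaevField a₁ a₂
  have hdiv : ∀ z ∈ cube (n + 1) r, e / 4 * G z ≤ ∑ i, pd i (P i) z := by
    intro z hz
    have hzK := (hcub z hz).1
    rw [hP, hS.sum_pd_pohozaevField hp hq (by rw [ha₁, ha₂, ← hM, he]; ring) hzK]
    have hV : 0 < V z ^ (p + 1) := Real.rpow_pos_of_pos (hS.right_pos z) _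
    have hU : 0 < U z ^ (q + 1) := Real.rpow_pos_of_pos (hS.left_pos z) _
    have c1 := (hS.coeff_left_mem z hzK).1
    have d1 := (hS.coeff_right_mem z hzK).1
    have r1 := (abs_le.1 (hS.radial_left z hzK)).1
    have r2 := (abs_le.1 (hS.radial_right z hzK)).1
    have k1 : -(e / 4) * V z ^ (p + 1) ≤ fderiv ℝ c z z * V z ^ (p + 1) / (p + 1) := by
      rw [le_div_iff₀ (by positivity)]
      nlinarith [mul_pos (mul_pos he0 hV) hp, mul_le_mul_of_nonneg_right r1 hV.le]
    have k2 : -(e / 4) * U z ^ (q + 1) ≤ fderiv ℝ d z z * U z ^ (q + 1) / (q + 1) := by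
      rw [le_div_iff₀ (by positivity)]
      nlinarith [mul_pos (mul_pos he0 hU) hq, mul_le_mul_of_nonneg_right r2 hU.le]
    have k3 : e * (1 / 2 * V z ^ (p + 1)) ≤ e * (c z * V z ^ (p + 1)) :=
      mul_le_mul_of_nonneg_left (mul_le_mul_of_nonneg_right c1 hV.le) he0.le
    have k4 : e * (1 / 2 * U z ^ (q + 1)) ≤ e * (d z * U z ^ (q + 1)) :=
      mul_le_mul_of_nonneg_left (mul_le_mul_of_nonneg_right d1 hU.le) he0.le
    rw [← hM, show M / (p + 1) - a₁ = e by rw [ha₁]; ring, show M / (q + 1) - a₂ = e by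
      rw [ha₂]; ring]
    simp only [hG]
    linarith
  have hint : e / 4 * (∫ z in cube (n + 1) r, G z) ≤ ∫ z in cube (n + 1) r, ∑ i, pd i (P i) z := by
    rw [← integral_const_mul]
    refine setIntegral_mono_on ?_ ?_ (isClosed_cube _ r).measurableSet hdiv
    · exact (hGc.const_mul _).continuousOn.integrableOn_compact (isCompact_cube r)
    · exact (continuous_finsetSum _ fun i _ =>
        continuous_pd (hPc i) i).continuousOn.integrableOn_compact (isCompact_cube r)
  rw [integral_cube_sum_pd hPc hr0] at hint
  have hface : ∀ i t, |t| ≤ r → ENNReal.ofReal |∫ y in Icc (fun _ => -r) (fun _ => r),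
      P i (facePoint i t y)| ≤ ENNReal.ofReal A * ∫⁻ y in Icc (fun _ => -r) (fun _ => r),
        boundaryDensity p q U V (facePoint i t y) := by
    intro i t ht
    refine (ENNReal.ofReal_le_ofReal abs_integral_le_integral_abs).trans
      ((ofReal_integral_le_lintegral _).trans ?_)
    rw [← lintegral_const_mul' _ _ ENNReal.ofReal_ne_top]
    refine setLIntegral_mono' measurableSet_Icc fun y hy => ?_
    obtain ⟨h1, h2⟩ := hcub _ (facePoint_mem_cube (i := i) ht hy)
    have hb : boundaryDensity p q U V (facePoint i t y) = ENNReal.ofReal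
        (gradSum U (facePoint i t y) * gradSum V (facePoint i t y) + G (facePoint i t y)) := by
      rw [boundaryDensity, ENNReal.ofReal_add (mul_nonneg gradSum_nonneg gradSum_nonneg) (hG0 _),
        ENNReal.ofReal_mul gradSum_nonneg]
    rw [hb, ← ENNReal.ofReal_mul hA0.le]
    exact ENNReal.ofReal_le_ofReal (hS.abs_pohozaevField_le hp hq h1 h2 i)
  rw [← ofReal_integral_eq_lintegral_ofReal
    (hGc.continuousOn.integrableOn_compact (isCompact_cube r)) (ae_of_all _ hG0)]
  have hint2 : (∫ z in cube (n + 1) r, G z) ≤ 4 / e * ∑ i,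
      (|∫ y in Icc (fun _ => -r) (fun _ => r), P i (facePoint i r y)|
        + |∫ y in Icc (fun _ => -r) (fun _ => r), P i (facePoint i (-r) y)|) := by
    have h3 : ∀ S : ℝ, e / 4 * (∫ z in cube (n + 1) r, G z) ≤ S →
        (∫ z in cube (n + 1) r, G z) ≤ 4 / e * S := by
      intro S hS
      rw [div_mul_eq_mul_div, le_div_iff₀ he0]
      linarith
    refine h3 _ (hint.trans (Finset.sum_le_sum fun i _ => ?_))
    have h4 := le_abs_self (∫ y in Icc (fun _ => -r) (fun _ => r), P i (facePoint i r y))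
    have h5 := neg_abs_le (∫ y in Icc (fun _ => -r) (fun _ => r), P i (facePoint i (-r) y))
    linarith
  refine (ENNReal.ofReal_le_ofReal hint2).trans ?_
  rw [ENNReal.ofReal_mul (by positivity), ENNReal.ofReal_mul (by positivity), mul_assoc]
  refine mul_le_mul_right ?_ _
  rw [ENNReal.ofReal_sum_of_nonneg fun i _ => by positivity, Finset.mul_sum]
  refine Finset.sum_le_sum fun i _ => ?_
  rw [ENNReal.ofReal_add (abs_nonneg _) (abs_nonneg _), mul_add]
  exact add_le_add (hface i r (abs_of_nonneg hr0).le)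
    (hface i (-r) (by rw [abs_neg, abs_of_nonneg hr0]))

end PohozaevInequality

section GeneralizedYoung

variable {X Y : Type*} [MeasurableSpace X] [MeasurableSpace Y]

/-- Young's inequality for integral operators, with exponents expressed through the weights of the
underlying three-factor Hölder inequality. -/
theorem lintegral_rpow_lintegral_mul_le {μ : Measure X} {ν : Measure Y} [SFinite μ] [SFinite ν]
    {k : X → Y → ENNReal} {f : Y → ENNReal} (hk : Measurable (Function.uncurry k))
    (hf : Measurable f) {A : ENNReal} {θ₁ θ₂ θ₃ : ℝ} (h₁ : 0 < θ₁) (h₂ : 0 ≤ θ₂) (h₃ : 0 ≤ θ₃)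
    (hθ : θ₁ + θ₂ + θ₃ = 1) (hx : ∀ᵐ x ∂μ, ∫⁻ y, k x y ^ (1 / (θ₁ + θ₂)) ∂ν ≤ A)
    (hy : ∀ᵐ y ∂ν, ∫⁻ x, k x y ^ (1 / (θ₁ + θ₂)) ∂μ ≤ A) :
    ∫⁻ x, (∫⁻ y, k x y * f y ∂ν) ^ (1 / θ₁) ∂μ
      ≤ A ^ ((θ₁ + θ₂) / θ₁) * (∫⁻ y, f y ^ (1 / (θ₁ + θ₃)) ∂ν) ^ ((θ₁ + θ₃) / θ₁) := by
  set m : ℝ := 1 / (θ₁ + θ₂) with hm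
  set s : ℝ := 1 / (θ₁ + θ₃) with hs
  have h12 : 0 < θ₁ + θ₂ := by linarith
  have h13 : 0 < θ₁ + θ₃ := by linarith
  have hm0 : 0 < m := by positivity
  have hs0 : 0 < s := by positivity
  set F : ENNReal := ∫⁻ y, f y ^ s ∂ν with hF
  have hkx : ∀ x, Measurable (k x) := fun x => hk.comp (measurable_const.prodMk measurable_id)
  have hpt : ∀ x y, k x y * f y
      = (k x y ^ m * f y ^ s) ^ θ₁ * (k x y ^ m) ^ θ₂ * (f y ^ s) ^ θ₃ := by
    intro x y
    rw [ENNReal.mul_rpow_of_nonneg _ _ h₁.le, ← ENNReal.rpow_mul, ← ENNReal.rpow_mul,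
      ← ENNReal.rpow_mul, ← ENNReal.rpow_mul]
    have e1 : k x y = k x y ^ (m * θ₁) * k x y ^ (m * θ₂) := by
      rw [← ENNReal.rpow_add_of_nonneg _ _ (by positivity) (by positivity), ← mul_add, hm,
        one_div_mul_cancel h12.ne', ENNReal.rpow_one]
    have e2 : f y = f y ^ (s * θ₁) * f y ^ (s * θ₃) := by
      rw [← ENNReal.rpow_add_of_nonneg _ _ (by positivity) (by positivity), ← mul_add, hs,
        one_div_mul_cancel h13.ne', ENNReal.rpow_one]
    conv_lhs => rw [e1, e2]
    ring
  have hH : ∀ x, ∫⁻ y, k x y * f y ∂ν ≤ (∫⁻ y, k x y ^ m * f y ^ s ∂ν) ^ θ₁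
      * (∫⁻ y, k x y ^ m ∂ν) ^ θ₂ * F ^ θ₃ := by
    intro x
    have := ENNReal.lintegral_prod_norm_pow_le (μ := ν) (Finset.univ : Finset (Fin 3))
      (f := ![fun y => k x y ^ m * f y ^ s, fun y => k x y ^ m, fun y => f y ^ s])
      (p := ![θ₁, θ₂, θ₃]) ?_ ?_ ?_
    · simp only [Fin.prod_univ_three] at this
      refine le_trans (le_of_eq (lintegral_congr fun y => hpt x y)) this
    · intro i _
      fin_cases i
      · exact (((hkx x).pow_const m).mul (hf.pow_const s)).aemeasurable
      · exact ((hkx x).pow_const m).aemeasurable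
      · exact (hf.pow_const s).aemeasurable
    · simp [Fin.sum_univ_three, hθ]
    · intro i _
      fin_cases i
      · exact h₁.le
      · exact h₂
      · exact h₃
  have hmeas : Measurable (Function.uncurry fun x y => k x y ^ m * f y ^ s) :=
    (hk.pow_const m).mul ((hf.pow_const s).comp measurable_snd)
  have i1 : 0 ≤ 1 / θ₁ := by positivity
  calc ∫⁻ x, (∫⁻ y, k x y * f y ∂ν) ^ (1 / θ₁) ∂μ
      ≤ ∫⁻ x, (∫⁻ y, k x y ^ m * f y ^ s ∂ν) * (A ^ (θ₂ / θ₁) * F ^ (θ₃ / θ₁)) ∂μ := by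
        refine lintegral_mono_ae (hx.mono fun x hx => ?_)
        refine (ENNReal.rpow_le_rpow ((hH x).trans (mul_le_mul' (mul_le_mul' le_rfl
          (ENNReal.rpow_le_rpow hx h₂)) le_rfl)) i1).trans (le_of_eq ?_)
        rw [ENNReal.mul_rpow_of_nonneg _ _ i1, ENNReal.mul_rpow_of_nonneg _ _ i1,
          ← ENNReal.rpow_mul, ← ENNReal.rpow_mul, ← ENNReal.rpow_mul, mul_one_div_cancel h₁.ne',
          ENNReal.rpow_one, mul_one_div, mul_one_div, mul_assoc]
    _ = (∫⁻ y, (∫⁻ x, k x y ^ m ∂μ) * f y ^ s ∂ν) * (A ^ (θ₂ / θ₁) * F ^ (θ₃ / θ₁)) := by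
        rw [lintegral_mul_const _ hmeas.lintegral_prod_right, lintegral_lintegral_swap
          hmeas.aemeasurable]
        congr 1
        refine lintegral_congr fun y => ?_
        rw [lintegral_mul_const]
        exact (hk.comp (measurable_id.prodMk measurable_const)).pow_const m
    _ ≤ (A * F) * (A ^ (θ₂ / θ₁) * F ^ (θ₃ / θ₁)) := by
        refine mul_le_mul' ?_ le_rfl
        rw [hF, ← lintegral_const_mul _ (hf.pow_const s)]
        exact lintegral_mono_ae (hy.mono fun y hy => mul_le_mul' hy le_rfl)
    _ = A ^ ((θ₁ + θ₂) / θ₁) * F ^ ((θ₁ + θ₃) / θ₁) := by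
        rw [add_div, add_div, div_self h₁.ne', ENNReal.rpow_add_of_nonneg _ _ zero_le_one
          (by positivity), ENNReal.rpow_add_of_nonneg _ _ zero_le_one (by positivity),
          ENNReal.rpow_one, ENNReal.rpow_one]
        ring

end GeneralizedYoung

section ProductKernels

theorem lintegral_pi_prod {μ : Measure ℝ} [SigmaFinite μ] : ∀ {n : ℕ} (g : Fin n → ℝ → ENNReal),
    (∀ i, Measurable (g i)) →
      ∫⁻ x, ∏ i, g i (x i) ∂(Measure.pi fun _ => μ) = ∏ i, ∫⁻ s, g i s ∂μ
  | 0, g, _ => by simp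
  | n + 1, g, hg => by
    have h := measurePreserving_piFinSuccAbove (fun _ : Fin (n + 1) => μ) 0
    have hm : Measurable fun x : Fin n → ℝ => ∏ i, g (Fin.succ i) (x i) :=
      Finset.measurable_fun_prod _ fun i _ => (hg _).comp (measurable_pi_apply i)
    calc ∫⁻ x, ∏ i, g i (x i) ∂(Measure.pi fun _ => μ)
        = ∫⁻ z : ℝ × (Fin n → ℝ), g 0 z.1 * ∏ i, g (Fin.succ i) (z.2 i)
            ∂(μ.prod (Measure.pi fun _ => μ)) := by
          have hm2 : Measurable fun z : ℝ × (Fin n → ℝ) => g 0 z.1 * ∏ i, g (Fin.succ i) (z.2 i) :=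
            ((hg 0).comp measurable_fst).mul (hm.comp measurable_snd)
          rw [← h.lintegral_comp hm2]
          refine lintegral_congr fun x => ?_
          rw [Fin.prod_univ_succ]
          rfl
      _ = _ := by
          rw [lintegral_prod_mul (hg 0).aemeasurable hm.aemeasurable,
            lintegral_pi_prod (fun i => g (Fin.succ i)) fun i => hg _, Fin.prod_univ_succ]

theorem restrict_Icc_pi (n : ℕ) (r : ℝ) :
    (volume : Measure (Fin n → ℝ)).restrict (Icc (fun _ => -r) (fun _ => r))
      = Measure.pi fun _ => (volume : Measure ℝ).restrict (Icc (-r) r) := by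
  rw [← pi_univ_Icc, volume_pi, Measure.restrict_pi_pi]

/-- The Riesz kernel. -/
noncomputable def rieszKer {E : Type*} [NormedAddCommGroup E] (a : ℝ) (t : E) : ENNReal :=
  ‖t‖ₑ⁻¹ ^ a

theorem measurable_rieszKer {E : Type*} [NormedAddCommGroup E] [MeasurableSpace E]
    [OpensMeasurableSpace E] (a : ℝ) : Measurable (rieszKer a : E → ENNReal) :=
  measurable_enorm.inv.pow_const a

theorem rieszKer_neg {E : Type*} [NormedAddCommGroup E] (a : ℝ) (t : E) :
    rieszKer a (-t) = rieszKer a t := by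
  simp [rieszKer]

theorem lintegral_rieszKer_lt_top {a : ℝ} (ha : a < 1) (r : ℝ) :
    ∫⁻ s in Icc (-r) r, rieszKer a s < ⊤ := by
  have h : IntegrableOn (fun s : ℝ => |s| ^ (-a)) (ball 0 (r + 1)) := by
    refine integrableOn_ball_of_norm_le_rpow (C := 1) (α := a) (by simp) (by simpa using ha)
      (ae_of_all _ fun x => ?_) ?_
    · simp [abs_of_nonneg (Real.rpow_nonneg (abs_nonneg x) _)]
    · exact (measurable_id.abs.pow_const _).aestronglyMeasurable
  have hsub : Icc (-r) r ⊆ ball 0 (r + 1) := by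
    intro s hs
    rw [mem_ball_zero_iff, Real.norm_eq_abs]
    have := abs_le.2 ⟨hs.1, hs.2⟩
    linarith
  have h2 := (h.mono_set hsub).2
  refine lt_of_le_of_lt (lintegral_mono_ae ?_) h2
  have h0 : ∀ᵐ s : ℝ, s ≠ 0 := by simp [ae_iff]
  refine (ae_restrict_of_ae h0).mono fun s hs => le_of_eq ?_
  have hs' : 0 < |s| := abs_pos.2 hs
  rw [rieszKer, ← ofReal_norm, ← ofReal_norm, Real.norm_eq_abs, Real.norm_eq_abs,
    abs_of_pos (Real.rpow_pos_of_pos hs' _), ← ENNReal.ofReal_rpow_of_pos hs', ENNReal.rpow_neg,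
    ENNReal.inv_rpow]

theorem exists_lintegral_rieszKer_sub_le {a : ℝ} (ha : a < 1) (r : ℝ) :
    ∃ A : ENNReal, A ≠ ⊤ ∧ 1 ≤ A ∧ ∀ t : ℝ, |t| ≤ r → ∫⁻ s in Icc (-r) r, rieszKer a (t - s) ≤ A := by
  refine ⟨(∫⁻ s in Icc (-(2 * r)) (2 * r), rieszKer a s) + 1,
    ENNReal.add_ne_top.2 ⟨(lintegral_rieszKer_lt_top ha _).ne, ENNReal.one_ne_top⟩, le_add_self,
    fun t ht => le_add_right ?_⟩
  have hp := Measure.measurePreserving_sub_left (volume : Measure ℝ) t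
  rw [← hp.setLIntegral_comp_preimage measurableSet_Icc (measurable_rieszKer a)]
  refine lintegral_mono_set fun s hs => ?_
  rw [abs_le] at ht
  simp only [mem_preimage, mem_Icc] at hs ⊢
  constructor <;> linarith [hs.1, hs.2]

theorem rieszKer_le_mul_prod {n : ℕ} {a σ : ℝ} (ha : 0 ≤ a) (hσ : 0 ≤ σ) (i : Fin (n + 1)) (t : ℝ)
    (y : Fin n → ℝ) (z : Fin (n + 1) → ℝ) :
    rieszKer (a + n * σ) (facePoint i t y - WithLp.toLp 2 z)
      ≤ rieszKer a (t - z i) * ∏ j, rieszKer σ (y j - z (i.succAbove j)) := by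
  set w := facePoint i t y - WithLp.toLp 2 z with hw
  have hc : ∀ (b : ℝ), 0 ≤ b → ∀ j, rieszKer b w ≤ rieszKer b (w j) := by
    intro b hb j
    refine ENNReal.rpow_le_rpow (ENNReal.inv_le_inv.2 ?_) hb
    rw [← ofReal_norm, ← ofReal_norm]
    exact ENNReal.ofReal_le_ofReal (PiLp.norm_apply_le w j)
  have h1 : rieszKer (a + n * σ) w = rieszKer a w * ∏ _j : Fin n, rieszKer σ w := by
    rw [rieszKer, ENNReal.rpow_add_of_nonneg _ _ ha (by positivity), mul_comm (n : ℝ),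
      ENNReal.rpow_mul, ENNReal.rpow_natCast, Finset.prod_const, Finset.card_univ, Fintype.card_fin]
    rfl
  rw [h1]
  refine mul_le_mul' ?_ (Finset.prod_le_prod' fun j _ => ?_)
  · refine (hc a ha i).trans (le_of_eq ?_)
    simp [hw, facePoint]
  · refine (hc σ hσ (i.succAbove j)).trans (le_of_eq ?_)
    simp [hw, facePoint]

end ProductKernels

section SliceEstimates

theorem abs_le_of_mem_Icc_pi {m : ℕ} {r : ℝ} {y : Fin m → ℝ}
    (hy : y ∈ Icc (fun _ => -r) (fun _ => r)) (j : Fin m) : |y j| ≤ r :=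
  abs_le.2 ⟨hy.1 j, hy.2 j⟩

theorem measurable_prod_rieszKer {n : ℕ} (σ : ℝ) (i : Fin (n + 1)) :
    Measurable (Function.uncurry fun (y : Fin n → ℝ) (z : Fin (n + 1) → ℝ) =>
      ∏ j, rieszKer σ (y j - z (i.succAbove j))) := by
  have h : ∀ j : Fin n, Measurable fun w : (Fin n → ℝ) × (Fin (n + 1) → ℝ) =>
      w.1 j - w.2 (i.succAbove j) := fun j => by fun_prop
  exact Finset.measurable_fun_prod _ fun j _ => (measurable_rieszKer σ).comp (h j)

theorem prod_rieszKer_rpow {n : ℕ} (σ : ℝ) {m : ℝ} (hm : 0 ≤ m) (i : Fin (n + 1)) (y : Fin n → ℝ)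
    (z : Fin (n + 1) → ℝ) :
    (∏ j, rieszKer σ (y j - z (i.succAbove j))) ^ m
      = ∏ j, rieszKer (σ * m) (y j - z (i.succAbove j)) := by
  rw [← ENNReal.prod_rpow_of_nonneg hm]
  simp only [rieszKer, ← ENNReal.rpow_mul]

/-- Riesz potentials are bounded on faces of cubes in terms of a weighted Lebesgue norm. -/
theorem exists_lintegral_facePoint_le (n : ℕ) {δ σ θ₁ θ₂ θ₃ : ℝ} (hδ : 0 < δ) (hδ1 : δ ≤ 1)
    (hσ : 0 ≤ σ) (h₁ : 0 < θ₁) (h₂ : 0 ≤ θ₂) (h₃ : 0 ≤ θ₃) (hθ : θ₁ + θ₂ + θ₃ = 1)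
    (hσθ : σ < θ₁ + θ₂) :
    ∃ A : ENNReal, A ≠ ⊤ ∧ ∀ (i : Fin (n + 1)) (t : ℝ), |t| ≤ 2 → ∀ r : ℝ, r ≤ 2 →
      ∀ f : EuclideanSpace ℝ (Fin (n + 1)) → ENNReal, Measurable f →
        ∫⁻ y in Icc (fun _ => -r) (fun _ => r), (∫⁻ z in cube (n + 1) 3,
            rieszKer (1 - δ + n * σ) (facePoint i t y - z) * f z) ^ (1 / θ₁)
          ≤ A * (∫⁻ z in cube (n + 1) 3, rieszKer (1 - δ) (t - z i) * f z ^ (1 / (θ₁ + θ₃)))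
            ^ ((θ₁ + θ₃) / θ₁) := by
  have h12 : 0 < θ₁ + θ₂ := by linarith
  set m : ℝ := 1 / (θ₁ + θ₂) with hm
  have hσm : σ * m < 1 := by rwa [hm, mul_one_div, div_lt_one h12]
  obtain ⟨A₀, hA₀, hA₀', hb₀⟩ := exists_lintegral_rieszKer_sub_le (a := 1 - δ) (by linarith) 3
  obtain ⟨A₁, hA₁, hA₁', hb₁⟩ := exists_lintegral_rieszKer_sub_le hσm 3
  set A : ENNReal := A₀ * A₁ ^ n with hA
  have hAtop : A ≠ ⊤ := ENNReal.mul_ne_top hA₀ (ENNReal.pow_ne_top hA₁)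
  refine ⟨A ^ ((θ₁ + θ₂) / θ₁), ENNReal.rpow_ne_top_of_nonneg (by positivity) hAtop,
    fun i t ht r hr f hf => ?_⟩
  set lam : Measure (Fin (n + 1) → ℝ) := volume.restrict (Icc (fun _ => -3) (fun _ => 3)) with hlam
  set w : (Fin (n + 1) → ℝ) → ENNReal := fun z => rieszKer (1 - δ) (t - z i) with hw
  have hwm : Measurable w :=
    (measurable_rieszKer _).comp (measurable_const.sub (measurable_pi_apply i))
  set k : (Fin n → ℝ) → (Fin (n + 1) → ℝ) → ENNReal :=
    fun y z => ∏ j, rieszKer σ (y j - z (i.succAbove j)) with hk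
  have hkm : Measurable (Function.uncurry k) := measurable_prod_rieszKer σ i
  have hkm' : ∀ y, Measurable (k y) := fun y => hkm.of_uncurry_left
  have hkpow : ∀ y z, k y z ^ m = ∏ j, rieszKer (σ * m) (y j - z (i.succAbove j)) := fun y z =>
    prod_rieszKer_rpow σ (one_div_pos.2 h12).le i y z
  set g : (Fin (n + 1) → ℝ) → ENNReal := fun z => f (WithLp.toLp 2 z) with hg
  have hgm : Measurable g := hf.comp (by fun_prop)
  have hbound : ∀ (m : ℕ) (y : Fin m → ℝ), (∀ j, |y j| ≤ 3) →
      ∏ j, ∫⁻ s in Icc (-3) 3, rieszKer (σ * (1 / (θ₁ + θ₂))) (y j - s) ≤ A₁ ^ m := by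
    intro m y hy
    refine (Finset.prod_le_prod' fun j _ => hb₁ (y j) (hy j)).trans (le_of_eq ?_)
    simp
  have hfub : ∀ y : Fin n → ℝ, (∀ j, |y j| ≤ 3) → ∫⁻ z, w z * k y z ^ m ∂lam ≤ A := by
    intro y hy
    set G : Fin (n + 1) → ℝ → ENNReal :=
      i.insertNth (α := fun _ => ℝ → ENNReal) (fun s => rieszKer (1 - δ) (t - s))
        fun j s => rieszKer (σ * m) (y j - s) with hG
    have hGm : ∀ j, Measurable (G j) := by
      intro j
      refine Fin.succAboveCases i ?_ (fun j => ?_) j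
      · simp only [hG, Fin.insertNth_apply_same]
        exact (measurable_rieszKer _).comp (measurable_const.sub measurable_id)
      · simp only [hG, Fin.insertNth_apply_succAbove]
        exact (measurable_rieszKer _).comp (measurable_const.sub measurable_id)
    have e : ∀ z : Fin (n + 1) → ℝ, w z * k y z ^ m = ∏ j, G j (z j) := by
      intro z
      rw [Fin.prod_univ_succAbove _ i, hkpow]
      simp [hG, hw]
    simp_rw [e]
    rw [hlam, restrict_Icc_pi, lintegral_pi_prod G hGm, Fin.prod_univ_succAbove _ i]
    simp only [hG, Fin.insertNth_apply_same, Fin.insertNth_apply_succAbove]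
    exact mul_le_mul' (hb₀ t (by linarith)) (hbound n y hy)
  have hwd : ∀ h : (Fin (n + 1) → ℝ) → ENNReal, Measurable h →
      ∫⁻ z, h z ∂(lam.withDensity w) = ∫⁻ z, w z * h z ∂lam := fun h hh =>
    lintegral_withDensity_eq_lintegral_mul _ hwm hh
  have hY := lintegral_rpow_lintegral_mul_le (μ := volume.restrict (Icc (fun _ => -r) (fun _ => r)))
    (ν := lam.withDensity w) (A := A) hkm hgm h₁ h₂ h₃ hθ ?_ ?_
  · rw [hwd _ (hgm.pow_const _)] at hY
    rw [lintegral_cube]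
    refine le_trans (lintegral_mono fun y => ENNReal.rpow_le_rpow ?_ (by positivity)) hY
    rw [hwd (fun z => k y z * g z) ((hkm' y).mul hgm), lintegral_cube]
    refine lintegral_mono fun z => ?_
    rw [← mul_assoc]
    exact mul_le_mul' (rieszKer_le_mul_prod (by linarith) hσ i t y z) le_rfl
  · refine (ae_restrict_mem measurableSet_Icc).mono fun y hy => ?_
    rw [hwd (fun z => k y z ^ (1 / (θ₁ + θ₂))) ((hkm' y).pow_const _)]
    exact hfub y fun j => (abs_le_of_mem_Icc_pi hy j).trans (by linarith)
  · refine (withDensity_absolutelyContinuous _ _).ae_le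
      ((ae_restrict_mem measurableSet_Icc).mono fun z hz => ?_)
    have hsub : Icc (fun _ : Fin n => -r) (fun _ => r) ⊆ Icc (fun _ => -3) (fun _ => 3) :=
      Icc_subset_Icc (fun _ => by linarith) (fun _ => by linarith)
    refine (lintegral_mono_set hsub).trans ?_
    have e : ∀ y, k y z ^ (1 / (θ₁ + θ₂))
        = ∏ j, rieszKer (σ * m) (z (i.succAbove j) - y j) := by
      intro y
      rw [hkpow]
      refine Finset.prod_congr rfl fun j _ => ?_
      rw [← rieszKer_neg, neg_sub]
    simp_rw [e]
    rw [restrict_Icc_pi, lintegral_pi_prod (fun j s => rieszKer (σ * m) (z (i.succAbove j) - s))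
      fun j => (measurable_rieszKer _).comp (measurable_const.sub measurable_id)]
    refine (hbound n _ fun j => abs_le_of_mem_Icc_pi hz (i.succAbove j)).trans ?_
    exact le_mul_of_one_le_left' hA₀'

/-- A radius at which the weighted integrals over the cube are controlled by the unweighted
integral. -/
theorem exists_radius (n : ℕ) {a : ℝ} (ha : a < 1) :
    ∃ C : ENNReal, C ≠ ⊤ ∧ ∀ h : EuclideanSpace ℝ (Fin (n + 1)) → ENNReal, Measurable h →
      ∃ r ∈ Icc (1 : ℝ) 2, ∀ i : Fin (n + 1),
        (∫⁻ z in cube (n + 1) 3, rieszKer a (r - z i) * h z)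
          + (∫⁻ z in cube (n + 1) 3, rieszKer a (-r - z i) * h z)
          ≤ C * ∫⁻ z in cube (n + 1) 3, h z := by
  obtain ⟨A, hA, -, hb⟩ := exists_lintegral_rieszKer_sub_le ha 3
  refine ⟨∑ _i : Fin (n + 1), (A + A), by simp [ENNReal.mul_eq_top, hA], fun h hh => ?_⟩
  have hm : ∀ (i : Fin (n + 1)) (s : ℝ), Measurable (Function.uncurry fun (r : ℝ)
      (z : EuclideanSpace ℝ (Fin (n + 1))) => rieszKer a (s * r - z i) * h z) := fun i s =>
    ((measurable_rieszKer a).comp ((measurable_fst.const_mul s).sub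
      ((by fun_prop : Measurable fun z : EuclideanSpace ℝ (Fin (n + 1)) => z i).comp
        measurable_snd))).mul (hh.comp measurable_snd)
  set Φ : Fin (n + 1) → ℝ → ℝ → ENNReal := fun i s r =>
    ∫⁻ z in cube (n + 1) 3, rieszKer a (s * r - z i) * h z with hΦ
  have hΦm : ∀ i s, Measurable (Φ i s) := fun i s => (hm i s).lintegral_prod_right
  have hk : ∀ s : ℝ, |s| = 1 → ∀ c : ℝ, |c| ≤ 3 →
      ∫⁻ r in Icc (1 : ℝ) 2, rieszKer a (s * r - c) ≤ A := by
    intro s hs c hc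
    refine (lintegral_mono_set (Icc_subset_Icc (by norm_num) (by norm_num) :
      Icc (1 : ℝ) 2 ⊆ Icc (-3) 3)).trans ?_
    rcases eq_or_eq_neg_of_abs_eq hs with rfl | rfl
    · refine le_trans (le_of_eq (lintegral_congr fun r => ?_)) (hb c hc)
      rw [← rieszKer_neg, neg_sub, one_mul]
    · refine le_trans (le_of_eq (lintegral_congr fun r => ?_)) (hb (-c) (by rwa [abs_neg]))
      congr 1
      ring
  have hint : ∀ i s, |s| = 1 → ∫⁻ r in Icc (1 : ℝ) 2, Φ i s r ≤ A * ∫⁻ z in cube (n + 1) 3, h z := by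
    intro i s hs
    rw [hΦ, lintegral_lintegral_swap (hm i s).aemeasurable, ← lintegral_const_mul _ hh]
    refine setLIntegral_mono' (isClosed_cube _ _).measurableSet fun z hz => ?_
    rw [lintegral_mul_const]
    · exact mul_le_mul' (hk s hs _ (hz i)) le_rfl
    · exact (measurable_rieszKer a).comp ((measurable_id.const_mul s).sub_const _)
  have hsum : ∫⁻ r in Icc (1 : ℝ) 2, ∑ i, (Φ i 1 r + Φ i (-1) r)
      ≤ (∑ _i : Fin (n + 1), (A + A)) * ∫⁻ z in cube (n + 1) 3, h z := by
    rw [lintegral_finsetSum _ fun i _ => (hΦm i 1).fun_add (hΦm i (-1)), Finset.sum_mul]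
    refine Finset.sum_le_sum fun i _ => ?_
    rw [lintegral_add_left (hΦm i 1), add_mul]
    exact add_le_add (hint i 1 (by simp)) (hint i (-1) (by simp))
  obtain ⟨r, hr, hle⟩ := exists_le_setLAverage (μ := volume) (s := Icc (1 : ℝ) 2)
    (f := fun r => ∑ i, (Φ i 1 r + Φ i (-1) r)) (by simp) (by simp)
    (Finset.measurable_fun_sum _ fun i _ => (hΦm i 1).fun_add (hΦm i (-1))).aemeasurable
  refine ⟨r, hr, fun i => ?_⟩
  have hv : volume (Icc (1 : ℝ) 2) = 1 := by rw [Real.volume_Icc]; norm_num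
  rw [setLAverage_eq, hv, div_one] at hle
  refine le_trans (le_of_eq ?_) ((Finset.single_le_sum (f := fun i => Φ i 1 r + Φ i (-1) r)
    (fun _ _ => bot_le) (Finset.mem_univ i)).trans (hle.trans hsum))
  simp [hΦ]

end SliceEstimates

section FaceBounds

/-- The Riesz potential of `f` on the cube of half-side `3`. -/
noncomputable def rieszPot {N : ℕ} (a : ℝ) (f : EuclideanSpace ℝ (Fin N) → ENNReal)
    (x : EuclideanSpace ℝ (Fin N)) : ENNReal :=
  ∫⁻ z in cube N 3, rieszKer a (x - z) * f z

theorem measurable_rieszPot {N : ℕ} (a : ℝ) {f : EuclideanSpace ℝ (Fin N) → ENNReal}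
    (hf : Measurable f) : Measurable (rieszPot a f) := by
  have h : Measurable (Function.uncurry fun x z : EuclideanSpace ℝ (Fin N) =>
      rieszKer a (x - z) * f z) :=
    ((measurable_rieszKer a).comp (measurable_fst.sub measurable_snd)).mul (hf.comp measurable_snd)
  exact h.lintegral_prod_right

/-- A radius such that weighted integrals of two given functions are simultaneously controlled. -/
theorem exists_radius_pair (n : ℕ) {a : ℝ} (ha : a < 1) :
    ∃ C : ENNReal, C ≠ ⊤ ∧ ∀ h₁ h₂ : EuclideanSpace ℝ (Fin (n + 1)) → ENNReal,
      Measurable h₁ → Measurable h₂ →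
      (∫⁻ z in cube (n + 1) 3, h₁ z) ≠ 0 → (∫⁻ z in cube (n + 1) 3, h₁ z) ≠ ⊤ →
      (∫⁻ z in cube (n + 1) 3, h₂ z) ≠ 0 → (∫⁻ z in cube (n + 1) 3, h₂ z) ≠ ⊤ →
      ∃ r ∈ Icc (1 : ℝ) 2, ∀ i : Fin (n + 1), ∀ t : ℝ, t = r ∨ t = -r →
        (∫⁻ z in cube (n + 1) 3, rieszKer a (t - z i) * h₁ z)
          ≤ C * (∫⁻ z in cube (n + 1) 3, h₁ z) ∧
        (∫⁻ z in cube (n + 1) 3, rieszKer a (t - z i) * h₂ z)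
          ≤ C * (∫⁻ z in cube (n + 1) 3, h₂ z) := by
  obtain ⟨C, hC, h⟩ := exists_radius n ha
  refine ⟨C * 2, ENNReal.mul_ne_top hC (by simp), fun h₁ h₂ m₁ m₂ n₁ f₁ n₂ f₂ => ?_⟩
  set H₁ := ∫⁻ z in cube (n + 1) 3, h₁ z with hH₁
  set H₂ := ∫⁻ z in cube (n + 1) 3, h₂ z with hH₂
  obtain ⟨r, hr, hb⟩ := h (fun z => H₁⁻¹ * h₁ z + H₂⁻¹ * h₂ z)
    ((m₁.const_mul _).add (m₂.const_mul _))
  rw [lintegral_add_left (m₁.const_mul _), lintegral_const_mul _ m₁, lintegral_const_mul _ m₂,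
    ENNReal.inv_mul_cancel n₁ f₁, ENNReal.inv_mul_cancel n₂ f₂, one_add_one_eq_two] at hb
  refine ⟨r, hr, fun i t ht => ?_⟩
  have hk : Measurable fun z : EuclideanSpace ℝ (Fin (n + 1)) => rieszKer a (t - z i) :=
    (measurable_rieszKer a).comp (measurable_const.sub (by fun_prop))
  have hb' : ∫⁻ z in cube (n + 1) 3, rieszKer a (t - z i) * (H₁⁻¹ * h₁ z + H₂⁻¹ * h₂ z)
      ≤ C * 2 := by
    rcases ht with rfl | rfl
    · exact le_self_add.trans (hb i)
    · exact le_add_self.trans (hb i)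
  have key : ∀ (H : ENNReal) (h : EuclideanSpace ℝ (Fin (n + 1)) → ENNReal), Measurable h →
      H ≠ 0 → H ≠ ⊤ → (∀ z, H⁻¹ * h z ≤ H₁⁻¹ * h₁ z + H₂⁻¹ * h₂ z) →
      ∫⁻ z in cube (n + 1) 3, rieszKer a (t - z i) * h z ≤ C * 2 * H := by
    intro H h hm h0 ht hle
    have := (lintegral_mono (μ := volume.restrict (cube (n + 1) 3))
      fun z => mul_le_mul' (le_refl (rieszKer a (t - z i))) (hle z)).trans hb'
    simp_rw [mul_left_comm _ H⁻¹] at this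
    rw [lintegral_const_mul _ (hk.fun_mul hm), mul_comm, ← div_eq_mul_inv,
      ENNReal.div_le_iff h0 ht] at this
    exact this
  exact ⟨key H₁ h₁ m₁ n₁ f₁ fun z => le_self_add, key H₂ h₂ m₂ n₂ f₂ fun z => le_add_self⟩

/-- On the faces of a suitable cube, products and powers of Riesz potentials are controlled by
Lebesgue norms. -/
theorem exists_lintegral_face_rieszPot_le {n : ℕ} (hn : 2 ≤ n) {q τ : ℝ} (hq : 0 < q) (hτ : 0 < τ)
    (hτ1 : τ + 1 / (q + 1) ≤ 1) (hτn : ((n : ℝ) - 2) / n < τ + 1 / (q + 1)) :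
    ∃ C : ENNReal, C ≠ ⊤ ∧ ∀ f g : EuclideanSpace ℝ (Fin (n + 1)) → ENNReal,
      Measurable f → Measurable g →
      (∫⁻ z in cube (n + 1) 3, f z ^ (1 / (1 - τ))) ≠ 0 →
      (∫⁻ z in cube (n + 1) 3, f z ^ (1 / (1 - τ))) ≠ ⊤ →
      (∫⁻ z in cube (n + 1) 3, g z ^ ((q + 1) / q)) ≠ 0 →
      (∫⁻ z in cube (n + 1) 3, g z ^ ((q + 1) / q)) ≠ ⊤ →
      ∃ r ∈ Icc (1 : ℝ) 2, ∀ i : Fin (n + 1), ∀ t : ℝ, t = r ∨ t = -r →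
        (∫⁻ y in Icc (fun _ => -r) (fun _ => r), rieszPot n f (facePoint i t y)
            * rieszPot n g (facePoint i t y))
          ≤ C * ((∫⁻ z in cube (n + 1) 3, f z ^ (1 / (1 - τ))) ^ (1 - τ)
            * (∫⁻ z in cube (n + 1) 3, g z ^ ((q + 1) / q)) ^ (q / (q + 1))) ∧
        (∫⁻ y in Icc (fun _ => -r) (fun _ => r),
            rieszPot ((n : ℝ) - 1) f (facePoint i t y) ^ (q + 1))
          ≤ C * (∫⁻ z in cube (n + 1) 3, f z ^ (1 / (1 - τ))) ^ ((1 - τ) * (q + 1)) := by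
  have hn' : (2 : ℝ) ≤ n := by exact_mod_cast hn
  have hn0 : (0 : ℝ) < n := by linarith
  have hq1 : 0 < 1 / (q + 1) := by positivity
  have hqe : 1 / (q + 1) * (q + 1) = 1 := one_div_mul_cancel (by linarith)
  have hqd : 1 - 1 / (q + 1) = q / (q + 1) := by field_simp; ring
  have hq2 : 0 < q / (q + 1) := by positivity
  generalize hκ : 1 / (q + 1) = κ at *
  set δ : ℝ := (n * (τ + κ) - n + 2) / 4 with hδ
  rw [div_lt_iff₀ hn0] at hτn
  have hδ0 : 0 < δ := by rw [hδ]; nlinarith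
  have hδ1 : δ ≤ 1 / 2 := by rw [hδ]; nlinarith
  set ω : ℝ := (1 - τ + κ) / 2 with hω
  set θ : ℝ := (1 - τ - κ) / 2 with hθ
  obtain ⟨AZ, hAZ, bZ⟩ := exists_lintegral_facePoint_le n (δ := δ) (σ := (n - 2 + δ) / n)
    (θ₁ := κ) (θ₂ := τ) (θ₃ := 1 - τ - κ) hδ0 (by linarith)
    (div_nonneg (by linarith) hn0.le) hq1 hτ.le (by linarith) (by ring)
    (by rw [div_lt_iff₀ hn0, hδ]; linarith)
  obtain ⟨AX, hAX, bX⟩ := exists_lintegral_facePoint_le n (δ := δ) (σ := (n - 1 + δ) / n)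
    (θ₁ := ω) (θ₂ := τ) (θ₃ := θ) hδ0 (by linarith)
    (div_nonneg (by linarith) hn0.le) (by linarith) hτ.le (by linarith) (by ring)
    (by rw [div_lt_iff₀ hn0, hδ, hω]; linarith)
  obtain ⟨AY, hAY, bY⟩ := exists_lintegral_facePoint_le n (δ := δ) (σ := (n - 1 + δ) / n)
    (θ₁ := 1 - ω) (θ₂ := κ) (θ₃ := θ) hδ0 (by linarith)
    (div_nonneg (by linarith) hn0.le) (by linarith) hq1.le (by linarith) (by ring)
    (by rw [div_lt_iff₀ hn0, hδ, hω]; linarith)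
  obtain ⟨B, hB, hrad⟩ := exists_radius_pair n (a := 1 - δ) (by linarith)
  have eZ : (1 - δ + n * ((n - 2 + δ) / n) : ℝ) = n - 1 := by field_simp; ring
  have eX : (1 - δ + n * ((n - 1 + δ) / n) : ℝ) = n := by field_simp; ring
  have eZ2 : κ + (1 - τ - κ) = 1 - τ := by ring
  have eX2 : ω + θ = 1 - τ := by ring
  have eY2 : 1 - ω + θ = q / (q + 1) := by rw [← hqd]; ring
  have eZ3 : (1 - τ) / κ = (1 - τ) * (q + 1) := by
    rw [div_eq_iff hq1.ne', mul_assoc, mul_comm (q + 1), hqe, mul_one]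
  have eZ4 : 1 / κ = q + 1 := by rw [← hκ, one_div_one_div]
  rw [eZ, eZ2, eZ3, eZ4] at bZ
  rw [eX, eX2] at bX
  rw [eX, eY2, one_div_div] at bY
  have hω0 : 0 < ω := by linarith
  have hω1 : 0 < 1 - ω := by linarith
  have hτ0 : 0 < 1 - τ := by linarith
  refine ⟨AX ^ ω * AY ^ (1 - ω) * (B ^ (1 - τ) * B ^ (q / (q + 1)))
    + AZ * B ^ ((1 - τ) * (q + 1)), ?_, fun f g hf hg f0 ft g0 gt => ?_⟩
  · refine ENNReal.add_ne_top.2 ⟨ENNReal.mul_ne_top (ENNReal.mul_ne_top ?_ ?_)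
      (ENNReal.mul_ne_top ?_ ?_), ENNReal.mul_ne_top hAZ ?_⟩ <;>
    exact ENNReal.rpow_ne_top_of_nonneg (by positivity) (by assumption)
  obtain ⟨r, hr, hb⟩ := hrad _ _ (hf.pow_const (1 / (1 - τ))) (hg.pow_const ((q + 1) / q))
    f0 ft g0 gt
  refine ⟨r, hr, fun i t ht => ?_⟩
  obtain ⟨h1, h2⟩ := hb i t ht
  have ht2 : |t| ≤ 2 := by
    have hr' : |r| ≤ 2 := abs_le.2 ⟨by linarith [hr.1], hr.2⟩
    rcases ht with rfl | rfl
    · exact hr'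
    · rwa [abs_neg]
  set H₁ := ∫⁻ z in cube (n + 1) 3, f z ^ (1 / (1 - τ))
  set H₂ := ∫⁻ z in cube (n + 1) 3, g z ^ ((q + 1) / q)
  have hZ := bZ i t ht2 r hr.2 f hf
  have hX := bX i t ht2 r hr.2 f hf
  have hY := bY i t ht2 r hr.2 g hg
  constructor
  · have hm : ∀ h : EuclideanSpace ℝ (Fin (n + 1)) → ENNReal, Measurable h →
        Measurable fun y => rieszPot n h (facePoint i t y) := fun h hh =>
      (measurable_rieszPot _ hh).comp (continuous_facePoint i t).measurable
    have hH := ENNReal.lintegral_mul_norm_pow_le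
      (μ := volume.restrict (Icc (fun _ : Fin n => -r) (fun _ => r)))
      (((hm f hf).pow_const (1 / ω)).aemeasurable)
      (((hm g hg).pow_const (1 / (1 - ω))).aemeasurable) hω0.le hω1.le (by ring)
    have e : ∀ y, (rieszPot n f (facePoint i t y) ^ (1 / ω)) ^ ω
        * (rieszPot n g (facePoint i t y) ^ (1 / (1 - ω))) ^ (1 - ω)
        = rieszPot n f (facePoint i t y) * rieszPot n g (facePoint i t y) := by
      intro y
      rw [← ENNReal.rpow_mul, ← ENNReal.rpow_mul, one_div_mul_cancel hω0.ne',
        one_div_mul_cancel hω1.ne', ENNReal.rpow_one, ENNReal.rpow_one]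
    simp_rw [e] at hH
    refine hH.trans ((mul_le_mul' (ENNReal.rpow_le_rpow (hX.trans (mul_le_mul' le_rfl
      (ENNReal.rpow_le_rpow h1 (by positivity)))) hω0.le) (ENNReal.rpow_le_rpow
        (hY.trans (mul_le_mul' le_rfl (ENNReal.rpow_le_rpow h2 (by positivity)))) hω1.le)).trans ?_)
    rw [ENNReal.mul_rpow_of_nonneg _ _ hω0.le, ENNReal.mul_rpow_of_nonneg _ _ hω1.le,
      ← ENNReal.rpow_mul, ← ENNReal.rpow_mul, div_mul_cancel₀ _ hω0.ne', div_mul_cancel₀ _ hω1.ne',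
      ENNReal.mul_rpow_of_nonneg _ _ hτ0.le, ENNReal.mul_rpow_of_nonneg _ _ hq2.le, add_mul]
    refine le_add_right (le_of_eq ?_)
    ring
  · refine hZ.trans ((mul_le_mul' le_rfl (ENNReal.rpow_le_rpow h1 (by positivity))).trans ?_)
    rw [ENNReal.mul_rpow_of_nonneg _ _ (by positivity), add_mul, ← mul_assoc]
    exact le_add_left le_rfl

end FaceBounds

section PotentialBounds

variable {N : ℕ} {p q η K : ℝ} {U V c d : EuclideanSpace ℝ (Fin N) → ℝ}

theorem closedBall_subset_cube {x : EuclideanSpace ℝ (Fin N)} (hx : x ∈ cube N 2) :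
    closedBall x 1 ⊆ cube N 3 := by
  intro z hz i
  rw [mem_closedBall, dist_eq_norm] at hz
  have h1 := abs_sub_apply_le i x z
  have h2 := hx i
  have h3 := abs_sub_abs_le_abs_sub (z i) (x i)
  linarith

theorem one_le_rieszKer {a : ℝ} (ha : 0 ≤ a) {x : EuclideanSpace ℝ (Fin N)} (hx : ‖x‖ ≤ 1) :
    1 ≤ rieszKer a x := by
  have h : ‖x‖ₑ ≤ 1 := by rwa [← ofReal_norm, ENNReal.ofReal_le_one]
  have := ENNReal.rpow_le_rpow (ENNReal.one_le_inv.2 h) ha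
  rwa [ENNReal.one_rpow] at this

theorem rieszKer_sub_eq (a : ℝ) (x z : EuclideanSpace ℝ (Fin N)) :
    rieszKer a (x - z) = ‖z - x‖ₑ ^ (-a) := by
  rw [← rieszKer_neg, neg_sub, rieszKer, ENNReal.inv_rpow, ENNReal.rpow_neg]

theorem IsSys.ofReal_neg_lap_le (hS : IsSys p q η K U V c d) {z : EuclideanSpace ℝ (Fin N)}
    (hz : ‖z‖ ≤ K) :
    ENNReal.ofReal (-lap U z) ≤ 2 * ENNReal.ofReal (V z ^ p) := by
  have hV := Real.rpow_nonneg (hS.right_pos z).le p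
  rw [hS.lap_left z hz, show (2 : ENNReal) = ENNReal.ofReal 2 by simp,
    ← ENNReal.ofReal_mul (by norm_num)]
  exact ENNReal.ofReal_le_ofReal (mul_le_mul_of_nonneg_right (hS.coeff_left_mem z hz).2 hV)

theorem IsSys.neg_lap_nonneg (hS : IsSys p q η K U V c d) {z : EuclideanSpace ℝ (Fin N)}
    (hz : ‖z‖ ≤ K) : 0 ≤ -lap U z := by
  have hV := Real.rpow_nonneg (hS.right_pos z).le p
  have hc := (hS.coeff_left_mem z hz).1
  rw [hS.lap_left z hz]
  positivity

theorem IsSys.add_lintegral_le_rieszPot (hS : IsSys p q η K U V c d) (hK : (N : ℝ) * 3 ≤ K)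
    {x : EuclideanSpace ℝ (Fin N)} (hx : x ∈ cube N 2) {a : ℝ} (ha : 0 ≤ a) (B : ENNReal) :
    B + ∫⁻ z in closedBall x 1, ‖z - x‖ₑ ^ (-a) * ENNReal.ofReal (-lap U z)
      ≤ (B / volume (closedBall (0 : EuclideanSpace ℝ (Fin N)) 1) + 2)
        * rieszPot a (fun z => 1 + ENNReal.ofReal (V z ^ p)) x := by
  have hsub := closedBall_subset_cube hx
  rw [add_mul]
  refine add_le_add ?_ ?_
  · have hv : volume (closedBall (0 : EuclideanSpace ℝ (Fin N)) 1)
        ≤ rieszPot a (fun z => 1 + ENNReal.ofReal (V z ^ p)) x := by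
      rw [← Measure.addHaar_closedBall_center volume x, ← setLIntegral_one]
      refine (setLIntegral_mono' measurableSet_closedBall fun z hz => ?_).trans
        (lintegral_mono_set hsub)
      rw [mem_closedBall, dist_comm, dist_eq_norm] at hz
      exact one_le_mul (one_le_rieszKer ha hz) le_self_add
    refine le_trans (le_of_eq ?_) (mul_le_mul' le_rfl hv)
    rw [ENNReal.div_mul_cancel]
    · exact (measure_closedBall_pos volume _ one_pos).ne'
    · exact measure_closedBall_lt_top.ne
  · rw [rieszPot, ← lintegral_const_mul' _ _ (by simp)]
    refine (setLIntegral_mono' measurableSet_closedBall fun z hz => ?_).trans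
      (lintegral_mono_set hsub)
    rw [rieszKer_sub_eq, mul_left_comm]
    exact mul_le_mul' le_rfl ((hS.ofReal_neg_lap_le
      ((norm_le_of_mem_cube (hsub hz)).trans hK)).trans (mul_le_mul' le_rfl le_add_self))

end PotentialBounds

section PotentialEstimates

variable {n : ℕ} {p q : ℝ}

/-- Pointwise bounds of a solution and its gradient by Riesz potentials. -/
theorem IsSys.exists_le_rieszPot (hn : 2 ≤ n) (hp : 0 < p) (hq : 0 < q) (hpq : 1 < p * q) :
    ∃ C : ENNReal, C ≠ ⊤ ∧ ∀ {η K : ℝ} {U V c d : EuclideanSpace ℝ (Fin (n + 1)) → ℝ},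
      IsSys p q η K U V c d → ((n + 1 : ℕ) : ℝ) * 3 + 3 ≤ K → ∀ x ∈ cube (n + 1) 2,
        ENNReal.ofReal (U x) + 1
          ≤ C * rieszPot ((n : ℝ) - 1) (fun z => 1 + ENNReal.ofReal (V z ^ p)) x ∧
        ENNReal.ofReal (gradSum U x)
          ≤ C * rieszPot n (fun z => 1 + ENNReal.ofReal (V z ^ p)) x := by
  have hN : 3 ≤ n + 1 := by omega
  have hn2 : (2 : ℝ) ≤ n := by exact_mod_cast hn
  obtain ⟨C₁, hC₁, hU⟩ := exists_ofReal_le hN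
  obtain ⟨C₂, hC₂, hD⟩ := exists_enorm_pd_le hN
  obtain ⟨B, hB, hint⟩ := IsSys.exists_lintegral_le hN hq hp (by rwa [mul_comm])
    (((n + 1 : ℕ) : ℝ) * 3)
  set v := volume (closedBall (0 : EuclideanSpace ℝ (Fin (n + 1))) 1) with hv
  have hv0 : v ≠ 0 := (measure_closedBall_pos volume _ one_pos).ne'
  refine ⟨C₁ * (B / v + 2) + (1 / v + 2) + (n + 1 : ℕ) * (C₂ * (B / v + 2)),
    by finiteness, fun {η K U V c d} hS hK x hx => ?_⟩
  have hsub := closedBall_subset_cube hx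
  have hnorm : ∀ z ∈ closedBall x 1, ‖z‖ ≤ ((n + 1 : ℕ) : ℝ) * 3 := fun z hz =>
    norm_le_of_mem_cube (hsub hz)
  have hK3 : ((n + 1 : ℕ) : ℝ) * 3 ≤ K := by linarith
  have hBU : ∫⁻ z in closedBall x 1, ENNReal.ofReal (U z) ≤ B :=
    (lintegral_mono_set fun z hz => mem_closedBall_zero_iff.2 (hnorm z hz)).trans
      (hint hS.swap (by linarith)).2
  have e2 : (2 - (n + 1 : ℕ) : ℝ) = -((n : ℝ) - 1) := by push_cast; ring
  have e1 : (1 - (n + 1 : ℕ) : ℝ) = -(n : ℝ) := by push_cast; ring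
  have hU' := hU U x hS.contDiff_left
  rw [e2] at hU'
  constructor
  · rw [add_mul, add_mul]
    refine le_add_right (add_le_add ?_ ?_)
    · rw [mul_assoc]
      exact hU'.trans (mul_le_mul' le_rfl ((add_le_add hBU le_rfl).trans
        (hS.add_lintegral_le_rieszPot hK3 hx (by linarith) B)))
    · exact le_self_add.trans (hS.add_lintegral_le_rieszPot hK3 hx (by linarith) 1)
  · have hmono : ∫⁻ z in closedBall x 1, ‖z - x‖ₑ ^ (-((n : ℝ) - 1)) * ENNReal.ofReal (-lap U z)
        ≤ ∫⁻ z in closedBall x 1, ‖z - x‖ₑ ^ (-(n : ℝ)) * ENNReal.ofReal (-lap U z) := by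
      refine setLIntegral_mono' measurableSet_closedBall fun z hz => mul_le_mul' ?_ le_rfl
      refine ENNReal.rpow_le_rpow_of_exponent_ge ?_ (by linarith)
      rw [mem_closedBall, dist_eq_norm] at hz
      rwa [← ofReal_norm, ENNReal.ofReal_le_one]
    have hpot := hS.add_lintegral_le_rieszPot hK3 hx (by linarith : (0 : ℝ) ≤ n) B
    have hgrad : ∀ i, ENNReal.ofReal |pd i U x| ≤ C₂ * ((B / v + 2)
        * rieszPot n (fun z => 1 + ENNReal.ofReal (V z ^ p)) x) := by
      intro i
      have h := hD U x i hS.contDiff_left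
      rw [e1] at h
      rw [← Real.norm_eq_abs, ofReal_norm]
      refine h.trans (mul_le_mul' le_rfl (le_trans (add_le_add ?_ (le_of_eq ?_)) hpot))
      · refine le_trans (le_of_eq (lintegral_congr fun z => ?_)) hBU
        rw [← ofReal_norm, Real.norm_eq_abs, abs_of_pos (hS.left_pos z)]
      · refine setLIntegral_congr_fun measurableSet_closedBall fun z hz => ?_
        rw [← enorm_neg (lap U z), ← ofReal_norm (-lap U z), Real.norm_eq_abs,
          abs_of_nonneg (hS.neg_lap_nonneg ((hnorm z hz).trans hK3))]
    rw [gradSum, ENNReal.ofReal_add (abs_nonneg _) (Finset.sum_nonneg fun _ _ => abs_nonneg _),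
      ENNReal.ofReal_sum_of_nonneg fun _ _ => abs_nonneg _, add_mul, add_mul]
    refine add_le_add (le_add_right ?_) ?_
    · rw [abs_of_pos (hS.left_pos x), mul_assoc]
      exact hU'.trans (mul_le_mul' le_rfl ((add_le_add hBU hmono).trans hpot))
    · refine (Finset.sum_le_sum fun i _ => hgrad i).trans (le_of_eq ?_)
      rw [Finset.sum_const, Finset.card_univ, Fintype.card_fin, nsmul_eq_mul]
      ring

end PotentialEstimates

section CubeNorms

variable {N : ℕ}

/-- The total energy of a pair of functions on a cube. -/
noncomputable def cubeEnergy (p q : ℝ) (U V : EuclideanSpace ℝ (Fin N) → ℝ) (r : ℝ) : ENNReal :=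
  ∫⁻ z in cube N r, ENNReal.ofReal (U z ^ (q + 1) + V z ^ (p + 1))

theorem volume_cube_ne_top (r : ℝ) : volume (cube N r) ≠ ⊤ := (isCompact_cube r).measure_lt_top.ne

theorem volume_cube_ne_zero {r : ℝ} (hr : 0 < r) : volume (cube N r) ≠ 0 := by
  refine (measure_mono_null (t := cube N r) (s := ball 0 r) ?_).mt
    (measure_ball_pos volume _ hr).ne'
  intro z hz i
  rw [mem_ball_zero_iff] at hz
  exact ((PiLp.norm_apply_le z i).trans_lt hz).le

theorem volume_cube_le_lintegral_one_add_rpow (f : EuclideanSpace ℝ (Fin N) → ℝ) {s r : ℝ}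
    (hs : 0 < s) : volume (cube N r) ≤ ∫⁻ z in cube N r, (1 + ENNReal.ofReal (f z)) ^ s := by
  rw [← setLIntegral_one]
  exact lintegral_mono fun z => ENNReal.one_le_rpow le_self_add hs

theorem lintegral_one_add_rpow_le {f : EuclideanSpace ℝ (Fin N) → ℝ} (hf : ∀ x, 0 < f x) {q : ℝ}
    (hq : 0 < q) (r : ℝ) :
    ∫⁻ z in cube N r, (1 + ENNReal.ofReal (f z ^ q)) ^ ((q + 1) / q)
      ≤ 2 ^ ((q + 1) / q - 1)
        * (volume (cube N r) + ∫⁻ z in cube N r, ENNReal.ofReal (f z ^ (q + 1))) := by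
  have hl : 1 ≤ (q + 1) / q := by rw [le_div_iff₀ hq]; linarith
  rw [← setLIntegral_one, ← lintegral_add_left measurable_const,
    ← lintegral_const_mul' _ _ (ENNReal.rpow_ne_top_of_nonneg (by linarith) (by simp))]
  refine lintegral_mono fun z => (ENNReal.rpow_add_le_mul_rpow_add_rpow _ _ hl).trans (le_of_eq ?_)
  rw [ENNReal.one_rpow, ENNReal.ofReal_rpow_of_pos (Real.rpow_pos_of_pos (hf z) _),
    ← Real.rpow_mul (hf z).le, mul_div_cancel₀ _ hq.ne']

/-- Interpolation between Lebesgue norms. -/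
theorem lintegral_rpow_le_interpolation {X : Type*} [MeasurableSpace X] {μ : Measure X}
    {f : X → ENNReal} (hf : Measurable f) {p τ : ℝ} (hp : 0 < p) (hτ : 0 ≤ τ) (hτ1 : τ < 1)
    (hpτ : p * τ ≤ 1 - τ) :
    ∫⁻ z, f z ^ (1 / (1 - τ)) ∂μ ≤ (∫⁻ z, f z ∂μ) ^ (1 - p * τ / (1 - τ))
      * (∫⁻ z, f z ^ ((p + 1) / p) ∂μ) ^ (p * τ / (1 - τ)) := by
  have h1 : 0 < 1 - τ := by linarith
  have h2 : p * τ / (1 - τ) ≤ 1 := (div_le_one h1).2 hpτ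
  have h3 : 0 ≤ p * τ / (1 - τ) := by positivity
  refine le_trans (le_of_eq (lintegral_congr fun z => ?_)) (ENNReal.lintegral_mul_norm_pow_le
    hf.aemeasurable (hf.pow_const ((p + 1) / p)).aemeasurable (by linarith) h3 (by ring))
  rw [← ENNReal.rpow_mul, ← ENNReal.rpow_add_of_nonneg _ _ (by linarith) (by positivity)]
  congr 1
  field_simp
  ring

end CubeNorms

section EnergyStep

variable {n : ℕ} {p q : ℝ}

theorem one_add_ofReal_rpow_le {t s : ℝ} (ht : 0 < t) (hs : 0 < s) :
    ENNReal.ofReal (t ^ s + 1) ≤ 2 * (ENNReal.ofReal t + 1) ^ s := by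
  rw [ENNReal.ofReal_add (by positivity) zero_le_one, ENNReal.ofReal_one,
    ← ENNReal.ofReal_rpow_of_pos ht, two_mul]
  refine add_le_add (ENNReal.rpow_le_rpow le_self_add hs.le) (ENNReal.one_le_rpow le_add_self hs)

theorem IsSys.exists_lintegral_boundaryDensity_le (hn : 2 ≤ n) (hq : 0 < q) (hqp : q ≤ p)
    (hpq : 1 < p * q) :
    ∃ C : ENNReal, C ≠ ⊤ ∧ ∀ {η K : ℝ} {U V c d : EuclideanSpace ℝ (Fin (n + 1)) → ℝ},
      IsSys p q η K U V c d → ((n + 1 : ℕ) : ℝ) * 3 + 3 ≤ K → ∀ x ∈ cube (n + 1) 2,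
        boundaryDensity p q U V x ≤ C *
          (rieszPot n (fun z => 1 + ENNReal.ofReal (V z ^ p)) x
            * rieszPot n (fun z => 1 + ENNReal.ofReal (U z ^ q)) x
            + rieszPot ((n : ℝ) - 1) (fun z => 1 + ENNReal.ofReal (V z ^ p)) x ^ (q + 1)) := by
  have hp : 0 < p := hq.trans_le hqp
  obtain ⟨C₁, hC₁, h₁⟩ := IsSys.exists_le_rieszPot hn hp hq hpq
  obtain ⟨C₂, hC₂, h₂⟩ := IsSys.exists_le_rieszPot hn hq hp (by rwa [mul_comm])
  obtain ⟨C₃, hC₃, h₃⟩ := IsSys.exists_rpow_le (N := n + 1) (by omega) hq hqp hpq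
    (((n + 1 : ℕ) : ℝ) * 3)
  refine ⟨C₁ * C₂ + ENNReal.ofReal (1 + C₃) * 2 * C₁ ^ (q + 1), ?_,
    fun {η K U V c d} hS hK x hx => ?_⟩
  · have := ENNReal.rpow_ne_top_of_nonneg (by linarith : 0 ≤ q + 1) hC₁
    finiteness
  obtain ⟨a₁, a₂⟩ := h₁ hS hK x hx
  obtain ⟨b₁, b₂⟩ := h₂ hS.swap hK x hx
  have hV := h₃ hS hK x ((norm_le_of_mem_cube hx).trans (by gcongr; norm_num))
  have hU0 := Real.rpow_nonneg (hS.left_pos x).le (q + 1)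
  rw [boundaryDensity, mul_add]
  refine add_le_add ((mul_le_mul' a₂ b₂).trans ?_) ?_
  · rw [mul_mul_mul_comm]
    exact mul_le_mul' le_self_add le_rfl
  · calc ENNReal.ofReal (U x ^ (q + 1) + V x ^ (p + 1))
        ≤ ENNReal.ofReal ((1 + C₃) * (U x ^ (q + 1) + 1)) := by
          refine ENNReal.ofReal_le_ofReal ?_
          linarith
      _ ≤ ENNReal.ofReal (1 + C₃) * (2 * (C₁ * rieszPot ((n : ℝ) - 1)
            (fun z => 1 + ENNReal.ofReal (V z ^ p)) x) ^ (q + 1)) := by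
          rw [ENNReal.ofReal_mul (by linarith)]
          exact mul_le_mul' le_rfl ((one_add_ofReal_rpow_le (hS.left_pos x) (by linarith)).trans
            (mul_le_mul' le_rfl (ENNReal.rpow_le_rpow a₁ (by linarith))))
      _ ≤ _ := by
          rw [ENNReal.mul_rpow_of_nonneg _ _ (by linarith), ← mul_assoc, ← mul_assoc, add_mul]
          exact le_add_left le_rfl

theorem exists_exponent {n p q : ℝ} (hn : 2 ≤ n) (hp : 0 < p) (hq : 0 < q) (hpq : 1 < p * q)
    (h : 2 * (p + 1) / (p * q - 1) > n - 2) :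
    ∃ τ, 0 < τ ∧ τ < 1 ∧ (q + 1) * (p * τ) < 1 ∧ p * τ + q / (q + 1) < 1 ∧ p * τ ≤ 1 - τ ∧
      τ + 1 / (q + 1) ≤ 1 ∧ (n - 2) / n < τ + 1 / (q + 1) := by
  have h1 : (n - 2) / n - 1 / (q + 1) < 1 / (p * (q + 1)) := by
    rw [gt_iff_lt, lt_div_iff₀ (by linarith)] at h
    rw [sub_lt_iff_lt_add, show 1 / (p * (q + 1)) + 1 / (q + 1) = (p + 1) / (p * (q + 1)) by
      field_simp; ring, div_lt_div_iff₀ (by linarith) (by positivity)]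
    nlinarith
  obtain ⟨τ, h2, h3⟩ := exists_between (max_lt h1 (show 0 < 1 / (p * (q + 1)) by positivity))
  rw [max_lt_iff] at h2
  have hτ0 := h2.2
  have hpτ : (q + 1) * (p * τ) < 1 := by
    rw [lt_div_iff₀ (by positivity)] at h3
    linarith
  have e : 1 / (q + 1) + q / (q + 1) = 1 := by field_simp; ring
  have h4 : p * τ < 1 / (q + 1) := by rw [lt_div_iff₀ (by linarith)]; linarith
  have h5 : p * τ ≤ 1 - τ := by nlinarith
  have h6 : τ ≤ q / (q + 1) := by
    rw [le_div_iff₀ (by linarith)]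
    nlinarith
  exact ⟨τ, hτ0, by nlinarith, hpτ, by linarith, h5, by linarith, by linarith [h2.1]⟩

/-- The energy on the small cube is controlled by a power less than one of the energy on a larger
cube. -/
theorem IsSys.exists_cubeEnergy_le (hn : 2 ≤ n) (hq : 0 < q) (hqp : q ≤ p) (hpq : 1 < p * q)
    (hhyper : ((n + 1 : ℕ) : ℝ) / (p + 1) + (n + 1 : ℕ) / (q + 1) > (n + 1 : ℕ) - 2)
    (halpha : 2 * (p + 1) / (p * q - 1) > (n : ℝ) - 2) :
    ∃ b : ℝ, 0 ≤ b ∧ b < 1 ∧ ∃ η > 0, ∃ C : ENNReal, C ≠ ⊤ ∧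
      ∀ {K : ℝ} {U V c d : EuclideanSpace ℝ (Fin (n + 1)) → ℝ},
      IsSys p q η K U V c d → ((n + 1 : ℕ) : ℝ) * 3 + 3 ≤ K →
        cubeEnergy p q U V 1 ≤ C * (1 + cubeEnergy p q U V 3) ^ b := by
  have hp : 0 < p := hq.trans_le hqp
  have hn2 : (2 : ℝ) ≤ n := by exact_mod_cast hn
  obtain ⟨τ, hτ0, hτ, hpτ, hpτ2, hpτ3, hτ4, hτ2⟩ := exists_exponent hn2 hp hq hpq halpha
  obtain ⟨η, hη, C₁, hC₁, hen⟩ := IsSys.exists_lintegral_energy_le hp hq hhyper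
  obtain ⟨C₂, hC₂, hbd⟩ := IsSys.exists_lintegral_boundaryDensity_le hn hq hqp hpq
  obtain ⟨C₃, hC₃, hface⟩ := exists_lintegral_face_rieszPot_le hn hq hτ0 hτ4 hτ2
  obtain ⟨C₄, hC₄, hint⟩ := IsSys.exists_lintegral_le (N := n + 1) (by omega) hp hq hpq
    (((n + 1 : ℕ) : ℝ) * 3)
  set v := volume (cube (n + 1) 3) with hv
  have hvt : v ≠ ⊤ := volume_cube_ne_top 3
  have hv0 : v ≠ 0 := volume_cube_ne_zero (by norm_num)
  have hτ' : 0 < 1 - τ := by linarith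
  have hpτ0 : 0 < p * τ := by positivity
  set lam : ℝ := p * τ / (1 - τ) with hlam
  have hlam0 : 0 ≤ lam := by positivity
  have hlam1 : lam ≤ 1 := (div_le_one hτ').2 hpτ3
  have hq1 : 0 < q / (q + 1) := by positivity
  set b : ℝ := max (p * τ + q / (q + 1)) ((q + 1) * (p * τ)) with hb
  set D₂ : ENNReal := 2 ^ ((q + 1) / q - 1) * (v + 1) with hD₂
  set D₁ : ENNReal := (v + C₄) ^ (1 - lam) * (2 ^ ((p + 1) / p - 1) * (v + 1)) ^ lam with hD₁
  have hexp : ∀ s : ℝ, 0 < s → 0 ≤ (s + 1) / s - 1 := fun s hs => by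
    rw [sub_nonneg, le_div_iff₀ hs]; linarith
  have hDt : ∀ s : ℝ, 0 < s → (2 : ENNReal) ^ ((s + 1) / s - 1) * (v + 1) ≠ ⊤ := fun s hs =>
    ENNReal.mul_ne_top (ENNReal.rpow_ne_top_of_nonneg (hexp s hs) (by simp)) (by finiteness)
  have hD₂t : D₂ ≠ ⊤ := hDt q hq
  have hD₁t : D₁ ≠ ⊤ := ENNReal.mul_ne_top
    (ENNReal.rpow_ne_top_of_nonneg (by linarith) (by finiteness))
    (ENNReal.rpow_ne_top_of_nonneg hlam0 (hDt p hp))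
  set D : ENNReal := C₂ * (C₃ * (D₁ ^ (1 - τ) * D₂ ^ (q / (q + 1))
    + D₁ ^ ((1 - τ) * (q + 1)))) with hD
  have hDtop : D ≠ ⊤ := by
    have i1 := ENNReal.rpow_ne_top_of_nonneg hτ'.le hD₁t
    have i2 := ENNReal.rpow_ne_top_of_nonneg hq1.le hD₂t
    have i3 := ENNReal.rpow_ne_top_of_nonneg (by positivity : 0 ≤ (1 - τ) * (q + 1)) hD₁t
    finiteness
  refine ⟨b, by positivity, max_lt hpτ2 hpτ, η, hη, C₁ * ∑ _i : Fin (n + 1), (D + D), by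
    simp [ENNReal.mul_eq_top, hC₁, hDtop], fun {K U V c d} hS hK => ?_⟩
  set T : ENNReal := 1 + cubeEnergy p q U V 3 with hT
  have hT1 : 1 ≤ T := le_self_add
  have hTt : T ≠ ⊤ := by
    refine ENNReal.add_ne_top.2 ⟨by simp, ?_⟩
    have hc : Continuous fun z => U z ^ (q + 1) + V z ^ (p + 1) :=
      (hS.continuous_rpow _).add (hS.swap.continuous_rpow _)
    refine ((hc.continuousOn.integrableOn_compact (isCompact_cube 3)).lintegral_lt_top).ne
  set f : EuclideanSpace ℝ (Fin (n + 1)) → ENNReal := fun z => 1 + ENNReal.ofReal (V z ^ p) with hf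
  set g : EuclideanSpace ℝ (Fin (n + 1)) → ENNReal := fun z => 1 + ENNReal.ofReal (U z ^ q) with hg
  have hfm : Measurable f :=
    measurable_const.add (hS.swap.continuous_rpow p).measurable.ennreal_ofReal
  have hgm : Measurable g :=
    measurable_const.add (hS.continuous_rpow q).measurable.ennreal_ofReal
  have hvT : ∀ e : ENNReal, e ≤ cubeEnergy p q U V 3 → v + e ≤ (v + 1) * T := by
    intro e he
    rw [hT, add_mul, one_mul, mul_add, mul_one, add_assoc]
    refine add_le_add le_rfl (he.trans ?_)
    rw [← add_assoc]
    exact le_add_self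
  have hH₂ : ∫⁻ z in cube (n + 1) 3, g z ^ ((q + 1) / q) ≤ D₂ * T := by
    refine (lintegral_one_add_rpow_le hS.left_pos hq 3).trans ?_
    rw [hD₂, mul_assoc]
    refine mul_le_mul' le_rfl (hvT _ (lintegral_mono fun z => ENNReal.ofReal_le_ofReal ?_))
    linarith [Real.rpow_nonneg (hS.right_pos z).le (p + 1)]
  have hH₁' : ∫⁻ z in cube (n + 1) 3, f z ^ ((p + 1) / p)
      ≤ 2 ^ ((p + 1) / p - 1) * (v + 1) * T := by
    refine (lintegral_one_add_rpow_le hS.right_pos hp 3).trans ?_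
    rw [mul_assoc]
    refine mul_le_mul' le_rfl (hvT _ (lintegral_mono fun z => ENNReal.ofReal_le_ofReal ?_))
    linarith [Real.rpow_nonneg (hS.left_pos z).le (q + 1)]
  have hf1 : ∫⁻ z in cube (n + 1) 3, f z ≤ v + C₄ := by
    rw [hf, lintegral_add_left measurable_const, setLIntegral_one]
    refine add_le_add le_rfl (le_trans (lintegral_mono_set fun z hz => ?_)
      (hint hS (by linarith)).1)
    exact mem_closedBall_zero_iff.2 (norm_le_of_mem_cube hz)
  have hH₁ : ∫⁻ z in cube (n + 1) 3, f z ^ (1 / (1 - τ)) ≤ D₁ * T ^ lam := by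
    refine (lintegral_rpow_le_interpolation hfm hp hτ0.le hτ hpτ3).trans ?_
    rw [hD₁, mul_assoc, ← ENNReal.mul_rpow_of_nonneg _ _ hlam0]
    exact mul_le_mul' (ENNReal.rpow_le_rpow hf1 (by linarith)) (ENNReal.rpow_le_rpow hH₁' hlam0)
  obtain ⟨r, hr, hface⟩ := hface f g hfm hgm
    (fun h => hv0 (le_zero_iff.1 ((volume_cube_le_lintegral_one_add_rpow _
      (by positivity)).trans h.le)))
    (ne_top_of_le_ne_top (ENNReal.mul_ne_top hD₁t (ENNReal.rpow_ne_top_of_nonneg hlam0 hTt)) hH₁)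
    (fun h => hv0 (le_zero_iff.1 ((volume_cube_le_lintegral_one_add_rpow _
      (by positivity)).trans h.le)))
    (ne_top_of_le_ne_top (ENNReal.mul_ne_top hD₂t hTt) hH₂)
  have hbound : ∀ (i : Fin (n + 1)) (t : ℝ), t = r ∨ t = -r →
      ∫⁻ y in Icc (fun _ => -r) (fun _ => r), boundaryDensity p q U V (facePoint i t y)
        ≤ D * T ^ b := by
    intro i t ht
    obtain ⟨h1, h2⟩ := hface i t ht
    have hr2 : |t| ≤ r := by
      have hr0 : 0 ≤ r := by linarith [hr.1]
      rcases ht with rfl | rfl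
      · exact (abs_of_nonneg hr0).le
      · rw [abs_neg, abs_of_nonneg hr0]
    have hm : ∀ (a : ℝ) (h : EuclideanSpace ℝ (Fin (n + 1)) → ENNReal), Measurable h →
        Measurable fun y => rieszPot a h (facePoint i t y) := fun a h hh =>
      (measurable_rieszPot _ hh).comp (continuous_facePoint i t).measurable
    calc ∫⁻ y in Icc (fun _ => -r) (fun _ => r), boundaryDensity p q U V (facePoint i t y)
        ≤ ∫⁻ y in Icc (fun _ => -r) (fun _ => r), C₂ * (rieszPot n f (facePoint i t y)
            * rieszPot n g (facePoint i t y) + rieszPot ((n : ℝ) - 1) f (facePoint i t y) ^ (q + 1)) :=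
          setLIntegral_mono' measurableSet_Icc fun y hy => hbd hS hK _ fun j =>
            (facePoint_mem_cube hr2 hy j).trans hr.2
      _ = C₂ * ((∫⁻ y in Icc (fun _ => -r) (fun _ => r), rieszPot n f (facePoint i t y)
            * rieszPot n g (facePoint i t y)) + ∫⁻ y in Icc (fun _ => -r) (fun _ => r),
              rieszPot ((n : ℝ) - 1) f (facePoint i t y) ^ (q + 1)) := by
          rw [lintegral_const_mul' _ _ hC₂, lintegral_add_left ((hm _ f hfm).fun_mul (hm _ g hgm))]
      _ ≤ C₂ * (C₃ * ((D₁ * T ^ lam) ^ (1 - τ) * (D₂ * T) ^ (q / (q + 1)))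
            + C₃ * (D₁ * T ^ lam) ^ ((1 - τ) * (q + 1))) := by
          refine mul_le_mul' le_rfl (add_le_add (h1.trans ?_) (h2.trans ?_))
          · exact mul_le_mul' le_rfl (mul_le_mul' (ENNReal.rpow_le_rpow hH₁ hτ'.le)
              (ENNReal.rpow_le_rpow hH₂ hq1.le))
          · exact mul_le_mul' le_rfl (ENNReal.rpow_le_rpow hH₁ (by positivity))
      _ = C₂ * (C₃ * (D₁ ^ (1 - τ) * D₂ ^ (q / (q + 1)) * T ^ (p * τ + q / (q + 1))
            + D₁ ^ ((1 - τ) * (q + 1)) * T ^ ((q + 1) * (p * τ)))) := by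
          clear_value D₁ D₂
          rw [ENNReal.mul_rpow_of_nonneg _ _ hτ'.le, ENNReal.mul_rpow_of_nonneg _ _ hq1.le,
            ENNReal.mul_rpow_of_nonneg _ _ (by positivity), ← ENNReal.rpow_mul, ← ENNReal.rpow_mul,
            ENNReal.rpow_add_of_nonneg _ _ hpτ0.le hq1.le, ← mul_assoc lam,
            hlam, div_mul_cancel₀ _ hτ'.ne', mul_comm (p * τ) (q + 1)]
          ring
      _ ≤ C₂ * (C₃ * (D₁ ^ (1 - τ) * D₂ ^ (q / (q + 1)) * T ^ b
            + D₁ ^ ((1 - τ) * (q + 1)) * T ^ b)) := by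
          gcongr
          · exact le_max_left _ _
          · exact le_max_right _ _
      _ = D * T ^ b := by
          rw [hD]
          ring
  have hsub : cube (n + 1) 1 ⊆ cube (n + 1) r := fun z hz i => (hz i).trans hr.1
  refine (lintegral_mono_set hsub).trans ((hen hS (by linarith) r hr).trans ?_)
  rw [mul_assoc, Finset.sum_mul]
  refine mul_le_mul' le_rfl (Finset.sum_le_sum fun i _ => ?_)
  rw [add_mul]
  exact add_le_add (hbound i r (Or.inl rfl)) (hbound i (-r) (Or.inr rfl))

end EnergyStep

section Rescaling

variable {N : ℕ}

theorem pd_affine {f : EuclideanSpace ℝ (Fin N) → ℝ} (hf : Differentiable ℝ f) (A t : ℝ)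
    (y₀ : EuclideanSpace ℝ (Fin N)) (i : Fin N) :
    pd i (fun y => A * f (y₀ + t • y)) = fun y => A * t * pd i f (y₀ + t • y) := by
  funext y
  have h1 : HasFDerivAt (fun y : EuclideanSpace ℝ (Fin N) => y₀ + t • y)
      (t • ContinuousLinearMap.id ℝ (EuclideanSpace ℝ (Fin N))) y :=
    ((hasFDerivAt_id y).const_smul t).const_add y₀
  have h2 := (((hf (y₀ + t • y)).hasFDerivAt.comp y h1).const_mul A).fderiv
  simp only [pd]
  rw [show (fun y => A * f (y₀ + t • y)) = fun y => A * (f ∘ fun y => y₀ + t • y) y from rfl, h2]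
  simp
  ring

theorem lap_affine {f : EuclideanSpace ℝ (Fin N) → ℝ} (hf : ContDiff ℝ 2 f) (A t : ℝ)
    (y₀ y : EuclideanSpace ℝ (Fin N)) :
    lap (fun y => A * f (y₀ + t • y)) y = A * t ^ 2 * lap f (y₀ + t • y) := by
  have hc : ContDiff ℝ 2 (fun y => A * f (y₀ + t • y)) :=
    contDiff_const.mul (hf.comp (contDiff_const.add (contDiff_id.const_smul t)))
  rw [lap_eq_sum_pd hc, lap_eq_sum_pd hf, Finset.mul_sum]
  refine Finset.sum_congr rfl fun i _ => ?_
  rw [pd_affine (hf.differentiable (by norm_num)),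
    pd_affine ((contDiff_pd hf i).differentiable (by norm_num))]
  ring

/-- Affine rescaling of a system. -/
theorem IsSys.rescale {p q η K A B R : ℝ} {U V c d : EuclideanSpace ℝ (Fin N) → ℝ}
    (h : IsSys p q η K U V c d) (hA : 0 < A) (hB : 0 < B) (hR : 0 < R)
    (hAB : A * R ^ 2 = B ^ p) (hBA : B * R ^ 2 = A ^ q) :
    IsSys p q η (K / R) (fun y => A * U (R • y)) (fun y => B * V (R • y)) (fun y => c (R • y))
      (fun y => d (R • y)) := by
  have hs : ContDiff ℝ 2 fun y : EuclideanSpace ℝ (Fin N) => R • y :=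
    contDiff_id.const_smul R
  have hn : ∀ x : EuclideanSpace ℝ (Fin N), ‖x‖ ≤ K / R → ‖R • x‖ ≤ K := fun x hx => by
    rw [norm_smul, Real.norm_of_nonneg hR.le]
    rwa [le_div_iff₀' hR] at hx
  have hfd : ∀ {f : EuclideanSpace ℝ (Fin N) → ℝ}, ContDiff ℝ 1 f → ∀ x,
      fderiv ℝ (fun y => f (R • y)) x x = fderiv ℝ f (R • x) (R • x) := fun {f} hf x => by
    have h1 : HasFDerivAt (fun y : EuclideanSpace ℝ (Fin N) => R • y)
        (R • ContinuousLinearMap.id ℝ (EuclideanSpace ℝ (Fin N))) x :=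
      (hasFDerivAt_id x).const_smul R
    have h2 := ((hf.differentiable (by norm_num) (R • x)).hasFDerivAt.comp x h1).fderiv
    rw [show (fun y => f (R • y)) = f ∘ fun y => R • y from rfl, h2]
    simp
  have hl : ∀ {f g : EuclideanSpace ℝ (Fin N) → ℝ} {A B s e : ℝ}, ContDiff ℝ 2 f → 0 < B →
      A * R ^ 2 = B ^ s → ∀ x, 0 < g (R • x) → -lap f (R • x) = e * g (R • x) ^ s →
      -lap (fun y => A * f (R • y)) x = e * (B * g (R • x)) ^ s := by
    intro f g A B s e hf hB hAB x hg he
    have := lap_affine hf A R 0 x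
    simp only [zero_add] at this
    rw [this, Real.mul_rpow hB.le hg.le, ← hAB]
    linear_combination (A * R ^ 2) * he
  exact
    { contDiff_left := contDiff_const.mul (h.contDiff_left.comp hs)
      contDiff_right := contDiff_const.mul (h.contDiff_right.comp hs)
      contDiff_coeff_left := h.contDiff_coeff_left.comp (hs.of_le (by norm_num))
      contDiff_coeff_right := h.contDiff_coeff_right.comp (hs.of_le (by norm_num))
      left_pos := fun x => mul_pos hA (h.left_pos _)
      right_pos := fun x => mul_pos hB (h.right_pos _)
      coeff_left_mem := fun x hx => h.coeff_left_mem _ (hn x hx)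
      coeff_right_mem := fun x hx => h.coeff_right_mem _ (hn x hx)
      lap_left := fun x hx => hl h.contDiff_left hB hAB x (h.right_pos _) (h.lap_left _ (hn x hx))
      lap_right := fun x hx => hl h.contDiff_right hA hBA x (h.left_pos _) (h.lap_right _ (hn x hx))
      radial_left := fun x hx => by
        rw [hfd h.contDiff_coeff_left]; exact h.radial_left _ (hn x hx)
      radial_right := fun x hx => by
        rw [hfd h.contDiff_coeff_right]; exact h.radial_right _ (hn x hx) }

theorem setLIntegral_cube_smul {R : ℝ} (hR : 0 < R) (r : ℝ)
    (f : EuclideanSpace ℝ (Fin N) → ENNReal) (hf : Measurable f) :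
    ∫⁻ z in cube N (R * r), f z = ENNReal.ofReal (R ^ N) * ∫⁻ z in cube N r, f (R • z) := by
  have hm := Measure.map_addHaar_smul (volume : Measure (EuclideanSpace ℝ (Fin N))) hR.ne'
  rw [finrank_euclideanSpace_fin] at hm
  have hs : Measurable fun z : EuclideanSpace ℝ (Fin N) => R • z := measurable_const_smul R
  have hpre : (fun z : EuclideanSpace ℝ (Fin N) => R • z) ⁻¹' cube N (R * r) = cube N r := by
    ext z
    simp [cube, abs_mul, abs_of_pos hR, hR]
  have h1 : ∫⁻ z in cube N r, f (R • z)
      = ENNReal.ofReal |(R ^ N)⁻¹| * ∫⁻ z in cube N (R * r), f z := by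
    rw [← hpre, ← setLIntegral_map (isClosed_cube N (R * r)).measurableSet hf hs]
    erw [hm]
    rw [Measure.restrict_smul, lintegral_smul_measure, smul_eq_mul]
  have hp : 0 < R ^ N := by positivity
  rw [h1, ← mul_assoc, ← ENNReal.ofReal_mul hp.le, abs_of_pos (inv_pos.2 hp),
    mul_inv_cancel₀ hp.ne', ENNReal.ofReal_one, one_mul]

theorem ofReal_pow_mul_cubeEnergy_rescale {p q A B R γ : ℝ} {U V : EuclideanSpace ℝ (Fin N) → ℝ}
    (hU : Continuous U) (hV : Continuous V) (hU0 : ∀ x, 0 < U x) (hV0 : ∀ x, 0 < V x)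
    (hA : 0 < A) (hB : 0 < B) (hR : 0 < R) (hA' : A ^ (q + 1) = R ^ γ * R ^ N)
    (hB' : B ^ (p + 1) = R ^ γ * R ^ N) (r : ℝ) :
    cubeEnergy p q (fun y => A * U (R • y)) (fun y => B * V (R • y)) r
      = ENNReal.ofReal (R ^ γ) * cubeEnergy p q U V (R * r) := by
  have hf : Continuous fun z => U z ^ (q + 1) + V z ^ (p + 1) :=
    (hU.rpow_const fun x => Or.inl (hU0 x).ne').add (hV.rpow_const fun x => Or.inl (hV0 x).ne')
  have hm : Measurable fun z => ENNReal.ofReal (U z ^ (q + 1) + V z ^ (p + 1)) :=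
    hf.measurable.ennreal_ofReal
  unfold cubeEnergy
  rw [setLIntegral_cube_smul hR r _ hm, ← mul_assoc, ← ENNReal.ofReal_mul (by positivity),
    ← lintegral_const_mul' _ _ ENNReal.ofReal_ne_top]
  refine lintegral_congr fun z => ?_
  rw [← ENNReal.ofReal_mul (by positivity), Real.mul_rpow hA.le (hU0 _).le,
    Real.mul_rpow hB.le (hV0 _).le, hA', hB', mul_add]

theorem cubeEnergy_swap (p q : ℝ) (U V : EuclideanSpace ℝ (Fin N) → ℝ) (r : ℝ) :
    cubeEnergy q p V U r = cubeEnergy p q U V r := by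
  unfold cubeEnergy
  simp only [add_comm]

end Rescaling

section LowerBound

variable {N : ℕ}

theorem lintegral_enorm_rpow_lt_top {s : ℝ} (hN : 0 < N) (hs : -(N : ℝ) < s) :
    ∫⁻ z in closedBall (0 : EuclideanSpace ℝ (Fin N)) 1, ‖z‖ₑ ^ s < ⊤ := by
  have : Nonempty (Fin N) := ⟨⟨0, hN⟩⟩
  have : Nontrivial (EuclideanSpace ℝ (Fin N)) := inferInstance
  have h : IntegrableOn (fun z : EuclideanSpace ℝ (Fin N) => ‖z‖ ^ s) (ball 0 2) := by
    refine integrableOn_ball_of_norm_le_rpow (C := 1) (α := -s) (by simpa using Nat.succ_le_of_lt hN)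
      (by simpa using by linarith)
      (ae_of_all _ fun x => ?_) ?_
    · simp [abs_of_nonneg (Real.rpow_nonneg (norm_nonneg x) _)]
    · exact (measurable_norm.pow_const _).aestronglyMeasurable
  have h2 := (h.mono_set (closedBall_subset_ball one_lt_two)).2
  refine lt_of_le_of_lt (lintegral_mono_ae ?_) h2
  have h0 : ∀ᵐ z : EuclideanSpace ℝ (Fin N), z ≠ 0 := by simp [ae_iff]
  refine (ae_restrict_of_ae h0).mono fun z hz => le_of_eq ?_
  have hz' : 0 < ‖z‖ := norm_pos_iff.2 hz
  rw [← ofReal_norm, ← ofReal_norm, ENNReal.ofReal_rpow_of_pos hz',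
    Real.norm_of_nonneg (by positivity)]

theorem lintegral_enorm_sub_rpow (s : ℝ) (x : EuclideanSpace ℝ (Fin N)) :
    ∫⁻ z in closedBall x 1, ‖z - x‖ₑ ^ s
      = ∫⁻ z in closedBall (0 : EuclideanSpace ℝ (Fin N)) 1, ‖z‖ₑ ^ s := by
  have hp := measurePreserving_sub_right (volume : Measure (EuclideanSpace ℝ (Fin N))) x
  rw [← hp.setLIntegral_comp_preimage measurableSet_closedBall
    ((measurable_enorm).pow_const s)]
  congr 2
  ext z
  simp [mem_closedBall, dist_eq_norm]

theorem norm_fderiv_le_of_pd_le {f : EuclideanSpace ℝ (Fin N) → ℝ} {G : ℝ} (hG : 0 ≤ G)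
    {x : EuclideanSpace ℝ (Fin N)} (h : ∀ i, |pd i f x| ≤ G) : ‖fderiv ℝ f x‖ ≤ N * G := by
  refine ContinuousLinearMap.opNorm_le_bound _ (by positivity) fun y => ?_
  have hy : fderiv ℝ f x y = ∑ i, y i * pd i f x := by
    conv_lhs => rw [← (EuclideanSpace.basisFun (Fin N) ℝ).sum_repr y]
    simp [map_sum, pd]
  rw [hy]
  refine (norm_sum_le _ _).trans ?_
  calc ∑ i, ‖y i * pd i f x‖ ≤ ∑ _i : Fin N, ‖y‖ * G := by
        refine Finset.sum_le_sum fun i _ => ?_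
        rw [norm_mul]
        exact mul_le_mul (PiLp.norm_apply_le y i) (h i) (norm_nonneg _) (norm_nonneg _)
    _ = N * G * ‖y‖ := by simp; ring

/-- Bounded solutions have bounded gradient. -/
theorem IsSys.exists_norm_fderiv_le (hN : 3 ≤ N) {p q A B : ℝ} (hp : 0 < p) :
    ∃ L : ℝ, 0 ≤ L ∧ ∀ {η K : ℝ} {U V c d : EuclideanSpace ℝ (Fin N) → ℝ}, IsSys p q η K U V c d →
      2 ≤ K → (∀ x, ‖x‖ ≤ K → U x ≤ A) → (∀ x, ‖x‖ ≤ K → V x ≤ B) →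
      ∀ x, ‖x‖ ≤ 1 → ‖fderiv ℝ U x‖ ≤ L := by
  obtain ⟨C, hC, hgrad⟩ := exists_enorm_pd_le (N := N) hN
  set I := ∫⁻ z in closedBall (0 : EuclideanSpace ℝ (Fin N)) 1, ‖z‖ₑ ^ (1 - N : ℝ) with hI
  have hI' : I ≠ ⊤ := (lintegral_enorm_rpow_lt_top (by omega) (by linarith)).ne
  set w := volume (closedBall (0 : EuclideanSpace ℝ (Fin N)) 1) with hw
  have hw' : w ≠ ⊤ := measure_closedBall_lt_top.ne
  set G : ENNReal := C * (ENNReal.ofReal A * w + I * ENNReal.ofReal (2 * B ^ p)) with hG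
  have hG' : G ≠ ⊤ := ENNReal.mul_ne_top hC (ENNReal.add_ne_top.2
    ⟨ENNReal.mul_ne_top ENNReal.ofReal_ne_top hw', ENNReal.mul_ne_top hI' ENNReal.ofReal_ne_top⟩)
  refine ⟨N * G.toReal, by positivity, fun {η K U V c d} hS hK hUA hVB x hx =>
    norm_fderiv_le_of_pd_le ENNReal.toReal_nonneg fun i => ?_⟩
  have hball : ∀ z ∈ closedBall x 1, ‖z‖ ≤ K := fun z hz => by
    rw [mem_closedBall, dist_eq_norm] at hz
    have := norm_add_le (z - x) x
    rw [sub_add_cancel] at this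
    linarith
  have h1 : ‖pd i U x‖ₑ ≤ G := by
    refine (hgrad U x i hS.contDiff_left).trans (mul_le_mul_right ?_ C)
    refine add_le_add ?_ ?_
    · refine (setLIntegral_mono measurable_const fun z hz => ?_).trans
        (le_of_eq (setLIntegral_const (closedBall x 1) (ENNReal.ofReal A))) |>.trans ?_
      · rw [← ofReal_norm, Real.norm_of_nonneg (hS.left_pos z).le]
        exact ENNReal.ofReal_le_ofReal (hUA z (hball z hz))
      · rw [Measure.addHaar_closedBall_center]
    · rw [hI, ← lintegral_enorm_sub_rpow _ x, ← lintegral_mul_const' _ _ ENNReal.ofReal_ne_top]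
      refine setLIntegral_mono' measurableSet_closedBall fun z hz => mul_le_mul_right ?_ _
      have hz' := hball z hz
      rw [← ofReal_norm, Real.norm_eq_abs, ← abs_neg, hS.lap_left z hz']
      have hc := hS.coeff_left_mem z hz'
      have hV := hS.right_pos z
      rw [abs_of_nonneg (mul_nonneg (by linarith [hc.1]) (by positivity))]
      refine ENNReal.ofReal_le_ofReal (mul_le_mul hc.2 ?_ (by positivity) (by norm_num))
      exact Real.rpow_le_rpow hV.le (hVB z hz') hp.le
  have h2 := ENNReal.toReal_mono hG' h1
  rwa [toReal_enorm, Real.norm_eq_abs] at h2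

theorem IsSys.exists_le_cubeEnergy (hN : 3 ≤ N) {p q A B m : ℝ} (hp : 0 < p) (hq : 0 < q)
    (hm : 0 < m) :
    ∃ e : ENNReal, e ≠ 0 ∧ ∀ {η K : ℝ} {U V c d : EuclideanSpace ℝ (Fin N) → ℝ},
      IsSys p q η K U V c d → 2 ≤ K → (∀ x, ‖x‖ ≤ K → U x ≤ A) → (∀ x, ‖x‖ ≤ K → V x ≤ B) →
      m ≤ U 0 → e ≤ cubeEnergy p q U V 1 := by
  obtain ⟨L, hL, hgrad⟩ := IsSys.exists_norm_fderiv_le (N := N) (q := q) (A := A) (B := B) hN hp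
  set δ : ℝ := min 1 (m / (2 * (L + 1))) with hδ
  have hδ0 : 0 < δ := lt_min one_pos (by positivity)
  have hδ1 : δ ≤ 1 := min_le_left _ _
  have hδL : L * δ ≤ m / 2 := by
    have h1 : δ ≤ m / (2 * (L + 1)) := min_le_right _ _
    rw [le_div_iff₀ (by positivity)] at h1
    nlinarith
  refine ⟨ENNReal.ofReal ((m / 2) ^ (q + 1)) * volume (closedBall (0 : EuclideanSpace ℝ (Fin N)) δ),
    mul_ne_zero ?_ (measure_closedBall_pos volume _ hδ0).ne', ?_⟩
  · exact (ENNReal.ofReal_pos.2 (by positivity)).ne'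
  intro η K U V c d hS hK hUA hVB hm0
  have hsub : closedBall (0 : EuclideanSpace ℝ (Fin N)) δ ⊆ cube N 1 := fun z hz i =>
    (PiLp.norm_apply_le z i).trans ((mem_closedBall_zero_iff.1 hz).trans hδ1)
  have hlow : ∀ z ∈ closedBall (0 : EuclideanSpace ℝ (Fin N)) δ, m / 2 ≤ U z := by
    intro z hz
    have h1 := (convex_closedBall (0 : EuclideanSpace ℝ (Fin N)) δ).norm_image_sub_le_of_norm_fderiv_le
      (𝕜 := ℝ) (fun y _ => hS.contDiff_left.differentiable (by norm_num) y)
      (fun y hy => hgrad hS hK hUA hVB y ((mem_closedBall_zero_iff.1 hy).trans hδ1)) hz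
      (mem_closedBall_self hδ0.le)
    rw [zero_sub, norm_neg, Real.norm_eq_abs] at h1
    have h2 := (abs_le.1 h1).2
    have h3 := mul_le_mul_of_nonneg_left (mem_closedBall_zero_iff.1 hz) hL
    linarith
  rw [← setLIntegral_const]
  unfold cubeEnergy
  refine (setLIntegral_mono' measurableSet_closedBall fun z hz => ?_).trans (lintegral_mono_set hsub)
  refine ENNReal.ofReal_le_ofReal ?_
  have h1 := Real.rpow_le_rpow (by positivity) (hlow z hz) (by linarith : 0 ≤ q + 1)
  have h2 := Real.rpow_nonneg (hS.right_pos z).le (p + 1)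
  linarith

end LowerBound

section Liouville

variable {n : ℕ} {p q : ℝ}

theorem exponent_identities (hpq : 1 < p * q) :
    2 * (p + 1) / (p * q - 1) + 2 = 2 * (q + 1) / (p * q - 1) * p ∧
    2 * (q + 1) / (p * q - 1) + 2 = 2 * (p + 1) / (p * q - 1) * q ∧
    2 * (q + 1) / (p * q - 1) * (p + 1) = 2 * (p + 1) / (p * q - 1) * (q + 1) := by
  have h : (p * q - 1) * (p * q - 1)⁻¹ = 1 := mul_inv_cancel₀ (by linarith)
  simp only [div_eq_mul_inv]
  refine ⟨?_, ?_, ?_⟩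
  · linear_combination -2 * h
  · linear_combination -2 * h
  · ring

theorem scaling_exponent_pos {N : ℝ} (hp : 0 < p) (hq : 0 < q) (hpq : 1 < p * q)
    (hhyper : N / (p + 1) + N / (q + 1) > N - 2) :
    0 < 2 * (p + 1) / (p * q - 1) * (q + 1) - N := by
  have h1 : 0 < p * q - 1 := by linarith
  have h2 : N / (p + 1) + N / (q + 1) = N * (p + q + 2) / ((p + 1) * (q + 1)) := by
    field_simp
    ring
  rw [h2, gt_iff_lt, lt_div_iff₀ (by positivity)] at hhyper
  have h3 : 2 * (p + 1) / (p * q - 1) * (q + 1) - N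
      = (2 * (p + 1) * (q + 1) - N * (p * q - 1)) / (p * q - 1) := by
    field_simp
  rw [h3]
  refine div_pos ?_ h1
  linarith

theorem volume_cube {N : ℕ} {R : ℝ} (hR : 0 < R) :
    volume (cube N R) = ENNReal.ofReal (R ^ N) * volume (cube N 1) := by
  have := setLIntegral_cube_smul hR (N := N) 1 (fun _ => 1) measurable_const
  simpa using this

/-- The energy grows at most polynomially, with an exponent that can be made arbitrarily small by
iterating the one-step estimate. -/
theorem IsSys.exists_cubeEnergy_le_rpow (hq : 0 < q) (hp : 0 < p) (hpq : 1 < p * q)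
    (hγ : 0 < 2 * (p + 1) / (p * q - 1) * (q + 1) - (n : ℝ)) {b η K₀ : ℝ} {C : ENNReal}
    (hb0 : 0 ≤ b) (hC : C ≠ ⊤) (hK₀ : (n : ℝ) ≤ K₀)
    (hstep : ∀ {K : ℝ} {U V c d : EuclideanSpace ℝ (Fin n) → ℝ}, IsSys p q η K U V c d → K₀ ≤ K →
      cubeEnergy p q U V 1 ≤ C * (1 + cubeEnergy p q U V 3) ^ b) (A B : ℝ) (j : ℕ) :
    ∃ D : ENNReal, D ≠ ⊤ ∧ ∀ {K : ℝ} {U V c d : EuclideanSpace ℝ (Fin n) → ℝ},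
      IsSys p q η K U V c d → (∀ x, ‖x‖ ≤ K → U x ≤ A) → (∀ x, ‖x‖ ≤ K → V x ≤ B) →
      ∀ R, 1 ≤ R → 3 ^ j * R * K₀ ≤ K →
        ENNReal.ofReal (R ^ (2 * (p + 1) / (p * q - 1) * (q + 1) - (n : ℝ))) * cubeEnergy p q U V R
          ≤ D * ENNReal.ofReal (R ^ (2 * (p + 1) / (p * q - 1) * (q + 1) * b ^ j)) := by
  obtain ⟨e1, e2, e3⟩ := exponent_identities hpq
  set α := 2 * (p + 1) / (p * q - 1) with hα
  set β := 2 * (q + 1) / (p * q - 1) with hβ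
  have hα0 : 0 < α := div_pos (by positivity) (by linarith)
  induction j with
  | zero =>
    refine ⟨ENNReal.ofReal (A ^ (q + 1) + B ^ (p + 1)) * volume (cube n 1),
      ENNReal.mul_ne_top ENNReal.ofReal_ne_top (volume_cube_ne_top 1), ?_⟩
    intro K U V c d hS hA hB R hR hK
    have hR0 : 0 < R := by linarith
    rw [pow_zero, one_mul] at hK
    have h1 : cubeEnergy p q U V R
        ≤ ENNReal.ofReal (A ^ (q + 1) + B ^ (p + 1)) * volume (cube n R) := by
      rw [← setLIntegral_const]
      refine setLIntegral_mono measurable_const fun z hz => ENNReal.ofReal_le_ofReal ?_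
      have hz' : ‖z‖ ≤ K := (norm_le_of_mem_cube hz).trans
        ((by nlinarith : (n : ℝ) * R ≤ R * K₀).trans hK)
      exact add_le_add (Real.rpow_le_rpow (hS.left_pos z).le (hA z hz') (by linarith))
        (Real.rpow_le_rpow (hS.right_pos z).le (hB z hz') (by linarith))
    refine (mul_le_mul_right h1 _).trans (le_of_eq ?_)
    rw [volume_cube hR0, pow_zero, mul_one]
    have h2 : R ^ (α * (q + 1)) = R ^ (α * (q + 1) - (n : ℝ)) * R ^ n := by
      rw [← Real.rpow_natCast, ← Real.rpow_add hR0, sub_add_cancel]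
    rw [h2, ENNReal.ofReal_mul (by positivity)]
    ring
  | succ j ih =>
    obtain ⟨D, hD, ih⟩ := ih
    set s := α * (q + 1) * b ^ j with hs
    have hs0 : 0 ≤ s := by positivity
    refine ⟨C * ((1 + D) ^ b * ENNReal.ofReal (3 ^ (s * b))), ENNReal.mul_ne_top hC
      (ENNReal.mul_ne_top (ENNReal.rpow_ne_top_of_nonneg hb0
        (ENNReal.add_ne_top.2 ⟨ENNReal.one_ne_top, hD⟩)) ENNReal.ofReal_ne_top), ?_⟩
    intro K U V c d hS hA hB R hR hK
    have hR0 : 0 < R := by linarith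
    have hK₀' : 0 ≤ K₀ := (Nat.cast_nonneg n).trans hK₀
    have h3 : (1 : ℝ) ≤ 3 ^ j := one_le_pow₀ (by norm_num)
    have hKR : K₀ ≤ K / R := by
      rw [le_div_iff₀ hR0]
      refine le_trans ?_ hK
      rw [pow_succ]
      nlinarith [mul_nonneg hK₀' hR0.le]
    have hSR := hS.rescale (A := R ^ α) (B := R ^ β) (by positivity) (by positivity) hR0
      (by rw [← Real.rpow_natCast, ← Real.rpow_add hR0, ← Real.rpow_mul hR0.le]; push_cast; rw [e1])
      (by rw [← Real.rpow_natCast, ← Real.rpow_add hR0, ← Real.rpow_mul hR0.le]; push_cast; rw [e2])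
    have hE : ∀ r, cubeEnergy p q (fun y => R ^ α * U (R • y)) (fun y => R ^ β * V (R • y)) r
        = ENNReal.ofReal (R ^ (α * (q + 1) - (n : ℝ))) * cubeEnergy p q U V (R * r) := fun r =>
      ofReal_pow_mul_cubeEnergy_rescale hS.contDiff_left.continuous hS.contDiff_right.continuous
        hS.left_pos hS.right_pos (by positivity) (by positivity) hR0
        (by rw [← Real.rpow_mul hR0.le, ← Real.rpow_natCast, ← Real.rpow_add hR0, sub_add_cancel])
        (by rw [← Real.rpow_mul hR0.le, ← Real.rpow_natCast, ← Real.rpow_add hR0, sub_add_cancel,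
          e3]) r
    have h4 := hstep hSR hKR
    rw [hE, hE, mul_one] at h4
    refine h4.trans ?_
    rw [mul_assoc]
    refine mul_le_mul_right ?_ C
    have h5 := ih hS hA hB (R * 3) (by linarith) (by rw [pow_succ] at hK; linarith)
    have h6 : ENNReal.ofReal (R ^ (α * (q + 1) - (n : ℝ))) * cubeEnergy p q U V (R * 3)
        ≤ D * ENNReal.ofReal ((R * 3) ^ s) := by
      refine le_trans (mul_le_mul_left (ENNReal.ofReal_le_ofReal ?_) _) h5
      exact Real.rpow_le_rpow hR0.le (by linarith) hγ.le
    have h7 : (1 : ENNReal) ≤ ENNReal.ofReal ((R * 3) ^ s) := by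
      rw [ENNReal.one_le_ofReal]
      exact Real.one_le_rpow (by linarith) hs0
    calc (1 + ENNReal.ofReal (R ^ (α * (q + 1) - (n : ℝ))) * cubeEnergy p q U V (R * 3)) ^ b
        ≤ ((1 + D) * ENNReal.ofReal ((R * 3) ^ s)) ^ b := by
          refine ENNReal.rpow_le_rpow ?_ hb0
          rw [add_mul, one_mul]
          exact add_le_add h7 h6
      _ = _ := by
          rw [ENNReal.mul_rpow_of_nonneg _ _ hb0, ENNReal.ofReal_rpow_of_pos (by positivity),
            ← Real.rpow_mul (by positivity), Real.mul_rpow hR0.le (by norm_num),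
            ENNReal.ofReal_mul (by positivity),
            show α * (q + 1) * b ^ (j + 1) = s * b by rw [hs, pow_succ]; ring]
          ring

/-- Bounded solutions on a large ball, with coefficients that are nearly radially constant, are
small at the center. -/
theorem IsSys.exists_forall_lt (hn : 2 ≤ n) (hq : 0 < q) (hqp : q ≤ p) (hpq : 1 < p * q)
    (hhyper : ((n + 1 : ℕ) : ℝ) / (p + 1) + (n + 1 : ℕ) / (q + 1) > (n + 1 : ℕ) - 2)
    (halpha : 2 * (p + 1) / (p * q - 1) > (n : ℝ) - 2) (A B : ℝ) {m : ℝ} (hm : 0 < m) :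
    ∃ η > 0, ∃ K > 0, ∀ {U V c d : EuclideanSpace ℝ (Fin (n + 1)) → ℝ}, IsSys p q η K U V c d →
      (∀ x, ‖x‖ ≤ K → U x ≤ A) → (∀ x, ‖x‖ ≤ K → V x ≤ B) → U 0 < m ∧ V 0 < m := by
  have hp : 0 < p := hq.trans_le hqp
  obtain ⟨b, hb0, hb1, η, hη, C, hC, hstep⟩ := IsSys.exists_cubeEnergy_le hn hq hqp hpq hhyper halpha
  obtain ⟨e₁, he₁, hlow₁⟩ := IsSys.exists_le_cubeEnergy (N := n + 1) (by omega) (A := A) (B := B)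
    hp hq hm
  obtain ⟨e₂, he₂, hlow₂⟩ := IsSys.exists_le_cubeEnergy (N := n + 1) (by omega) (A := B) (B := A)
    hq hp hm
  have hγ := scaling_exponent_pos hp hq hpq hhyper
  set γ := 2 * (p + 1) / (p * q - 1) * (q + 1) - ((n + 1 : ℕ) : ℝ) with hγdef
  set θ := 2 * (p + 1) / (p * q - 1) * (q + 1) with hθ
  obtain ⟨j, hj⟩ : ∃ j : ℕ, θ * b ^ j ≤ γ / 2 := by
    have h := (tendsto_pow_atTop_nhds_zero_of_lt_one hb0 hb1).const_mul θ
    rw [mul_zero] at h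
    exact ((h.eventually_lt_const (half_pos hγ)).mono fun _ h => h.le).exists
  set K₀ : ℝ := ((n + 1 : ℕ) : ℝ) * 3 + 3 with hK₀
  obtain ⟨D, hD, hiter⟩ := IsSys.exists_cubeEnergy_le_rpow hq hp hpq hγ hb0 hC
    (K₀ := K₀) (by push_cast [hK₀]; linarith [(Nat.cast_nonneg n : (0 : ℝ) ≤ n)]) hstep A B j
  obtain ⟨R, hR, hR1⟩ : ∃ R : ℝ, D * ENNReal.ofReal (R ^ (-(γ / 2))) < min e₁ e₂ ∧ 1 ≤ R := by
    have h := ENNReal.Tendsto.const_mul (ENNReal.tendsto_ofReal (tendsto_rpow_neg_atTop (half_pos hγ)))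
      (Or.inr hD)
    rw [ENNReal.ofReal_zero, mul_zero] at h
    exact ((h.eventually_lt_const (lt_min (pos_iff_ne_zero.2 he₁) (pos_iff_ne_zero.2 he₂))).and
      (eventually_ge_atTop 1)).exists
  have hR0 : 0 < R := by linarith
  refine ⟨η, hη, max 2 (3 ^ j * R * K₀), lt_max_of_lt_left two_pos, fun {U V c d} hS hA hB => ?_⟩
  have hF : cubeEnergy p q U V 1 < min e₁ e₂ := by
    have h1 := hiter hS hA hB R hR1 (le_max_right _ _)
    have h2 : cubeEnergy p q U V 1 ≤ cubeEnergy p q U V R :=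
      lintegral_mono_set fun z hz i => (hz i).trans hR1
    refine lt_of_le_of_lt (h2.trans ?_) hR
    have h3 : cubeEnergy p q U V R = ENNReal.ofReal (R ^ (-γ)) *
        (ENNReal.ofReal (R ^ γ) * cubeEnergy p q U V R) := by
      rw [← mul_assoc, ← ENNReal.ofReal_mul (by positivity), ← Real.rpow_add hR0, neg_add_cancel,
        Real.rpow_zero, ENNReal.ofReal_one, one_mul]
    rw [h3]
    refine (mul_le_mul_right h1 _).trans ?_
    rw [mul_left_comm, ← ENNReal.ofReal_mul (by positivity), ← Real.rpow_add hR0]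
    refine mul_le_mul_right (ENNReal.ofReal_le_ofReal ?_) _
    exact Real.rpow_le_rpow_of_exponent_le hR1 (by linarith)
  constructor
  · by_contra! h
    exact absurd (hlow₁ hS (le_max_left _ _) hA hB h) (not_le.2 (hF.trans_le (min_le_left _ _)))
  · by_contra! h
    have := hlow₂ hS.swap (le_max_left _ _) hB hA h
    rw [cubeEnergy_swap] at this
    exact absurd this (not_le.2 (hF.trans_le (min_le_right _ _)))

end Liouville

section Blowup

variable {N : ℕ}

/-- A point-picking lemma: near a point where `M` is large there is a point around which `M` is
controlled by twice its value, at its natural scale. -/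
theorem exists_doubling_point {M : EuclideanSpace ℝ (Fin N) → ℝ} (hM : Continuous M)
    (hM0 : ∀ x, 0 < M x) {x₀ : EuclideanSpace ℝ (Fin N)} {r K : ℝ} (hr : 0 < r)
    (h : 2 * K < r * M x₀) :
    ∃ x₁, ‖x₁ - x₀‖ < r ∧ ∀ y : EuclideanSpace ℝ (Fin N), ‖y‖ ≤ K →
      ‖x₁ + (M x₁)⁻¹ • y - x₀‖ < r ∧ M (x₁ + (M x₁)⁻¹ • y) ≤ 2 * M x₁ := by
  have hc : Continuous fun x => (r - ‖x - x₀‖) * M x := by fun_prop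
  obtain ⟨x₁, hx₁, hmax⟩ := (isCompact_closedBall x₀ r).exists_isMaxOn
    (nonempty_closedBall.2 hr.le) hc.continuousOn
  have h0 : r * M x₀ ≤ (r - ‖x₁ - x₀‖) * M x₁ := by
    simpa using hmax (mem_closedBall_self hr.le)
  have h1 : 0 < r - ‖x₁ - x₀‖ := by
    by_contra! h2
    have := mul_nonpos_of_nonpos_of_nonneg h2 (hM0 x₁).le
    linarith [mul_pos hr (hM0 x₀)]
  refine ⟨x₁, by linarith, fun y hy => ?_⟩
  have h2 : ‖(M x₁)⁻¹ • y‖ < (r - ‖x₁ - x₀‖) / 2 := by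
    rw [norm_smul, Real.norm_of_nonneg (inv_pos.2 (hM0 x₁)).le, inv_mul_lt_iff₀ (hM0 x₁)]
    linarith
  have h3 : ‖x₁ + (M x₁)⁻¹ • y - x₀‖ ≤ ‖x₁ - x₀‖ + ‖(M x₁)⁻¹ • y‖ := by
    rw [add_sub_right_comm]
    exact norm_add_le _ _
  have h4 : ‖x₁ + (M x₁)⁻¹ • y - x₀‖ < r := by linarith
  refine ⟨h4, ?_⟩
  have h5 : (r - ‖x₁ + (M x₁)⁻¹ • y - x₀‖) * M (x₁ + (M x₁)⁻¹ • y)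
      ≤ (r - ‖x₁ - x₀‖) * M x₁ :=
    hmax (mem_closedBall.2 (by rw [dist_eq_norm]; exact h4.le))
  have h6 : (r - ‖x₁ - x₀‖) / 2 * M (x₁ + (M x₁)⁻¹ • y)
      ≤ (r - ‖x₁ + (M x₁)⁻¹ • y - x₀‖) * M (x₁ + (M x₁)⁻¹ • y) :=
    mul_le_mul_of_nonneg_right (by linarith) (hM0 _).le
  have h7 : (r - ‖x₁ - x₀‖) * M (x₁ + (M x₁)⁻¹ • y) ≤ (r - ‖x₁ - x₀‖) * (2 * M x₁) := by
    linarith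
  exact le_of_mul_le_mul_left h7 h1

theorem exists_contDiff_eqOn {f : EuclideanSpace ℝ (Fin N) → ℝ} {x₀ : EuclideanSpace ℝ (Fin N)}
    {r : ℝ} (hr : 0 < r) (hf : ContDiffOn ℝ 2 f (ball x₀ (2 * r)))
    (hf0 : ∀ x ∈ ball x₀ (2 * r), 0 < f x) :
    ∃ g : EuclideanSpace ℝ (Fin N) → ℝ, ContDiff ℝ 2 g ∧ (∀ x, 0 < g x) ∧
      EqOn g f (ball x₀ r) := by
  let χ : ContDiffBump x₀ := ⟨r, 3 / 2 * r, hr, by linarith⟩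
  refine ⟨fun x => χ x * f x + (1 - χ x), ?_, fun x => ?_, fun x hx => ?_⟩
  · rw [contDiff_iff_contDiffAt]
    intro x
    by_cases hx : x ∈ ball x₀ (2 * r)
    · have hfx := hf.contDiffAt (isOpen_ball.mem_nhds hx)
      exact (χ.contDiffAt.mul hfx).add (contDiffAt_const.sub χ.contDiffAt)
    · have hx' : x ∈ (closedBall x₀ (3 / 2 * r))ᶜ := fun h => hx
        (closedBall_subset_ball (by linarith) h)
      refine (contDiffAt_const (c := (1 : ℝ))).congr_of_eventuallyEq ?_
      filter_upwards [isClosed_closedBall.isOpen_compl.mem_nhds hx'] with y hy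
      have h0 : χ y = 0 := χ.zero_of_le_dist (not_le.1 fun h => hy h).le
      simp [h0]
  · by_cases hx : x ∈ ball x₀ (2 * r)
    · rcases χ.nonneg.eq_or_lt (b := χ x) with h | h
      · simp [← h]
      · have h1 := mul_pos h (hf0 x hx)
        have h2 : χ x ≤ 1 := χ.le_one
        linarith
    · have h0 : χ x = 0 := χ.zero_of_le_dist (by
        rw [mem_ball, not_lt] at hx
        exact le_trans (show 3 / 2 * r ≤ 2 * r by linarith) hx)
      simp [h0]
  · have h1 : χ x = 1 := χ.one_of_mem_closedBall (ball_subset_closedBall hx)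
    simp [h1]

theorem lap_congr {f g : EuclideanSpace ℝ (Fin N) → ℝ} {s : Set (EuclideanSpace ℝ (Fin N))}
    (hs : IsOpen s) (h : EqOn f g s) {x : EuclideanSpace ℝ (Fin N)} (hx : x ∈ s) :
    lap f x = lap g x := by
  have h1 : f =ᶠ[nhds x] g := h.eventuallyEq_of_mem (hs.mem_nhds hx)
  unfold lap
  rw [(h1.iteratedFDeriv ℝ 2).eq_of_nhds]

theorem contDiffAt_norm_rpow (a : ℝ) {x : EuclideanSpace ℝ (Fin N)} (hx : x ≠ 0) :
    ContDiffAt ℝ 2 (fun x : EuclideanSpace ℝ (Fin N) => ‖x‖ ^ a) x :=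
  (contDiffAt_norm ℝ hx).rpow_const_of_ne (norm_ne_zero_iff.2 hx)

theorem norm_fderiv_norm_rpow_le_abs (a : ℝ) {x : EuclideanSpace ℝ (Fin N)} (hx : x ≠ 0) :
    ‖fderiv ℝ (fun x : EuclideanSpace ℝ (Fin N) => ‖x‖ ^ a) x‖ ≤ |a| * ‖x‖ ^ (a - 1) := by
  have h1 : HasFDerivAt (fun x : EuclideanSpace ℝ (Fin N) => ‖x‖) _ x :=
    ((contDiffAt_norm ℝ hx (n := 1)).differentiableAt (by norm_num)).hasFDerivAt
  rw [(h1.rpow_const (p := a) (Or.inl (norm_ne_zero_iff.2 hx))).fderiv, norm_smul, norm_mul,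
    Real.norm_eq_abs, Real.norm_of_nonneg (Real.rpow_nonneg (norm_nonneg x) _)]
  have h2 : ‖fderiv ℝ (fun x : EuclideanSpace ℝ (Fin N) => ‖x‖) x‖ ≤ 1 := by
    have := norm_fderiv_le_of_lipschitz ℝ (x₀ := x)
      (lipschitzWith_one_norm (E := EuclideanSpace ℝ (Fin N)))
    simpa using this
  exact mul_le_of_le_one_right (by positivity) h2

/-- After normalization, the weight `‖x‖ ^ a` is almost constant close to a point. -/
theorem exists_weight_bound (a : ℝ) {η : ℝ} (hη : 0 < η) :
    ∃ δ₀ > 0, ∀ δ, 0 < δ → δ ≤ δ₀ → ∀ {R : ℝ} {x₀ x : EuclideanSpace ℝ (Fin N)}, 0 < R →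
      ‖x₀‖ = R → ‖x - x₀‖ < δ * R →
      R ^ (-a) * ‖x‖ ^ a ∈ Icc (1 / 2 : ℝ) 2 ∧ ∀ z : EuclideanSpace ℝ (Fin N), ‖z‖ ≤ 2 * (δ * R) →
        |R ^ (-a) * fderiv ℝ (fun x : EuclideanSpace ℝ (Fin N) => ‖x‖ ^ a) x z| ≤ η := by
  have hc : ContinuousAt (fun s : ℝ => s ^ a) 1 :=
    Real.continuousAt_rpow_const 1 a (Or.inl one_ne_zero)
  have hnb : Icc (1 / 2 : ℝ) 2 ∈ nhds ((1 : ℝ) ^ a) := by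
    rw [Real.one_rpow]
    exact Icc_mem_nhds (by norm_num) (by norm_num)
  obtain ⟨ε, hε, hball⟩ := Metric.mem_nhds_iff.1 (hc.preimage_mem_nhds hnb)
  refine ⟨min (min (1 / 2) ε) (η / (8 * (|a| + 1))), by positivity, ?_⟩
  intro δ hδ hδ' R x₀ x hR hx₀ hx
  have hδ1 : δ ≤ 1 / 2 := hδ'.trans ((min_le_left _ _).trans (min_le_left _ _))
  have hδ2 : δ ≤ ε := hδ'.trans ((min_le_left _ _).trans (min_le_right _ _))
  have hδ3 : δ * (8 * (|a| + 1)) ≤ η := by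
    rw [← le_div_iff₀ (by positivity)]
    exact hδ'.trans (min_le_right _ _)
  have h1 : |‖x‖ - R| < δ * R := by
    rw [← hx₀] at hx ⊢
    exact (abs_norm_sub_norm_le x x₀).trans_lt hx
  rw [abs_lt] at h1
  have hxR : R / 2 < ‖x‖ := by nlinarith
  have hx0 : 0 < ‖x‖ := by linarith
  have hw : R ^ (-a) * ‖x‖ ^ a = (‖x‖ / R) ^ a := by
    rw [Real.div_rpow hx0.le hR.le, Real.rpow_neg hR.le]
    field_simp
  have hmem : R ^ (-a) * ‖x‖ ^ a ∈ Icc (1 / 2 : ℝ) 2 := by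
    rw [hw]
    refine hball (mem_ball.2 ?_)
    rw [Real.dist_eq, show ‖x‖ / R - 1 = (‖x‖ - R) / R by field_simp, abs_div, abs_of_pos hR,
      div_lt_iff₀ hR]
    exact (abs_lt.2 h1).trans_le (mul_le_mul_of_nonneg_right hδ2 hR.le)
  refine ⟨hmem, fun z hz => ?_⟩
  have hRa : 0 < R ^ (-a) := by positivity
  have h2 := (ContinuousLinearMap.le_opNorm (fderiv ℝ (fun x : EuclideanSpace ℝ (Fin N) => ‖x‖ ^ a) x)
    z).trans (mul_le_mul (norm_fderiv_norm_rpow_le_abs a (norm_pos_iff.1 hx0)) hz (norm_nonneg z)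
      (by positivity))
  rw [abs_mul, abs_of_pos hRa, ← Real.norm_eq_abs]
  calc R ^ (-a) * ‖fderiv ℝ (fun x : EuclideanSpace ℝ (Fin N) => ‖x‖ ^ a) x z‖
      ≤ R ^ (-a) * (|a| * ‖x‖ ^ (a - 1) * (2 * (δ * R))) := mul_le_mul_of_nonneg_left h2 hRa.le
    _ = (R ^ (-a) * ‖x‖ ^ a) * (2 * |a| * δ * (R / ‖x‖)) := by
        rw [Real.rpow_sub_one hx0.ne']
        field_simp
    _ ≤ 2 * (2 * |a| * δ * 2) := by
        refine mul_le_mul hmem.2 (mul_le_mul_of_nonneg_left ?_ (by positivity)) (by positivity)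
          (by norm_num)
        rw [div_le_iff₀ hx0]
        linarith
    _ ≤ η := by nlinarith [abs_nonneg a]

theorem neg_lap_rescaled {u v w : EuclideanSpace ℝ (Fin N) → ℝ} {p t R a α β τ τ' : ℝ}
    (hu : ContDiff ℝ 2 u) (ht : 0 < t) (hR : 0 < R) (hαβ : α + 2 = β * p) (hτ : τ + a = τ' * p)
    (x₁ y : EuclideanSpace ℝ (Fin N)) (hv : 0 < v (x₁ + t • y))
    (h : -lap u (x₁ + t • y) = w (x₁ + t • y) * v (x₁ + t • y) ^ p) :
    -lap (fun y => t ^ α * R ^ τ * u (x₁ + t • y)) y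
      = R ^ (-a) * w (x₁ + t • y) * (t ^ β * R ^ τ' * v (x₁ + t • y)) ^ p := by
  rw [lap_affine hu, Real.mul_rpow (by positivity) hv.le,
    Real.mul_rpow (by positivity) (by positivity), ← Real.rpow_mul ht.le, ← Real.rpow_mul hR.le,
    ← hαβ, ← hτ, Real.rpow_add ht, Real.rpow_two, Real.rpow_add hR, Real.rpow_neg hR.le]
  have hRa : R ^ a * (R ^ a)⁻¹ = 1 := mul_inv_cancel₀ (by positivity)
  linear_combination (t ^ α * R ^ τ * t ^ 2) * h
    - (w (x₁ + t • y) * v (x₁ + t • y) ^ p * t ^ α * R ^ τ * t ^ 2) * hRa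

end Blowup

section Conclusion

theorem fderiv_affine_apply {N : ℕ} {f : EuclideanSpace ℝ (Fin N) → ℝ} (hf : Differentiable ℝ f)
    (A t : ℝ) (y₀ y z : EuclideanSpace ℝ (Fin N)) :
    fderiv ℝ (fun y => A * f (y₀ + t • y)) y z = A * fderiv ℝ f (y₀ + t • y) (t • z) := by
  have h1 : HasFDerivAt (fun y : EuclideanSpace ℝ (Fin N) => y₀ + t • y)
      (t • ContinuousLinearMap.id ℝ (EuclideanSpace ℝ (Fin N))) y :=
    ((hasFDerivAt_id y).const_smul t).const_add y₀
  have h2 := (((hf (y₀ + t • y)).hasFDerivAt.comp y h1).const_mul A).fderiv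
  rw [show (fun y => A * f (y₀ + t • y)) = fun y => A * (f ∘ fun y => y₀ + t • y) y from rfl, h2]
  simp

theorem weight_exponent_identities {a b p q : ℝ} (hpq : 1 < p * q) :
    (a + b * p) / (p * q - 1) + a = (b + a * q) / (p * q - 1) * p ∧
    (b + a * q) / (p * q - 1) + b = (a + b * p) / (p * q - 1) * q := by
  have h : (p * q - 1) * (p * q - 1)⁻¹ = 1 := mul_inv_cancel₀ (by linarith)
  simp only [div_eq_mul_inv]
  constructor
  · linear_combination -a * h
  · linear_combination -b * h

theorem IsHHSol.exists_rpow_add_rpow_le {n : ℕ} {a b p q : ℝ} (hn : 2 ≤ n) (hq : 0 < q)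
    (hqp : q ≤ p) (hpq : 1 < p * q)
    (hhyper : ((n + 1 : ℕ) : ℝ) / (p + 1) + (n + 1 : ℕ) / (q + 1) > (n + 1 : ℕ) - 2)
    (halpha : 2 * (p + 1) / (p * q - 1) > (n : ℝ) - 2) :
    ∃ C > 0, ∀ ρ > (0 : ℝ), ∀ u v : EuclideanSpace ℝ (Fin (n + 1)) → ℝ,
      IsHHSol a b p q {x : EuclideanSpace ℝ (Fin (n + 1)) | 0 < ‖x‖ ∧ ‖x‖ < ρ} u v →
      ∀ x : EuclideanSpace ℝ (Fin (n + 1)), 0 < ‖x‖ → ‖x‖ < ρ / 2 →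
        (‖x‖ ^ ((a + b * p) / (p * q - 1)) * u x) ^ (2 * (p + 1) / (p * q - 1))⁻¹ +
          (‖x‖ ^ ((b + a * q) / (p * q - 1)) * v x) ^ (2 * (q + 1) / (p * q - 1))⁻¹
          ≤ C / ‖x‖ := by
  have hp : 0 < p := hq.trans_le hqp
  obtain ⟨e1, e2, -⟩ := exponent_identities hpq
  obtain ⟨f1, f2⟩ := weight_exponent_identities (a := a) (b := b) hpq
  set α := 2 * (p + 1) / (p * q - 1) with hα
  set β := 2 * (q + 1) / (p * q - 1) with hβ
  set τ := (a + b * p) / (p * q - 1)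
  set τ' := (b + a * q) / (p * q - 1)
  have hα0 : 0 < α := div_pos (by positivity) (by linarith)
  have hβ0 : 0 < β := div_pos (by positivity) (by linarith)
  obtain ⟨η, hη, K, hK, hsmall⟩ := IsSys.exists_forall_lt hn hq hqp hpq hhyper halpha (2 ^ α) (2 ^ β)
    (m := min ((1 / 2) ^ α) ((1 / 2) ^ β)) (by positivity)
  obtain ⟨δ₁, hδ₁, hwa⟩ := exists_weight_bound (N := n + 1) a hη
  obtain ⟨δ₂, hδ₂, hwb⟩ := exists_weight_bound (N := n + 1) b hη
  set δ : ℝ := min (1 / 4) (min δ₁ δ₂) with hδ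
  have hδ0 : 0 < δ := by positivity
  have hδ4 : δ ≤ 1 / 4 := min_le_left _ _
  replace hwa := fun {R} {x₀ x} => @hwa δ hδ0 ((min_le_right _ _).trans (min_le_left _ _)) R x₀ x
  replace hwb := fun {R} {x₀ x} => @hwb δ hδ0 ((min_le_right _ _).trans (min_le_right _ _)) R x₀ x
  refine ⟨2 * K / δ, by positivity, fun ρ hρ u v hsol x₀ hx₀ hx₀ρ => ?_⟩
  obtain ⟨-, -, hu2, hv2, hu0, hv0, hlu, hlv⟩ := hsol
  obtain ⟨R, hR⟩ : ∃ R, R = ‖x₀‖ := ⟨_, rfl⟩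
  rw [← hR] at hx₀ hx₀ρ ⊢
  by_contra! hcon
  have hball : ∀ x ∈ ball x₀ (2 * (R / 4)), R / 2 < ‖x‖ ∧ ‖x‖ < ρ := by
    intro x hx
    rw [mem_ball, dist_eq_norm] at hx
    have h1 := abs_lt.1 ((abs_norm_sub_norm_le x x₀).trans_lt hx)
    rw [← hR] at h1
    constructor <;> linarith [h1.1, h1.2]
  have hne : ∀ x ∈ ball x₀ (2 * (R / 4)), x ≠ 0 := fun x hx =>
    norm_pos_iff.1 (by linarith [(hball x hx).1])
  have hsub : ball x₀ (2 * (R / 4)) ⊆ {x | 0 < ‖x‖ ∧ ‖x‖ < ρ} \ {0} := fun x hx =>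
    ⟨⟨norm_pos_iff.2 (hne x hx), (hball x hx).2⟩, hne x hx⟩
  have hwC : ∀ s : ℝ, ContDiffOn ℝ 2 (fun x : EuclideanSpace ℝ (Fin (n + 1)) => ‖x‖ ^ s)
      (ball x₀ (2 * (R / 4))) := fun s x hx => (contDiffAt_norm_rpow s (hne x hx)).contDiffWithinAt
  have hwp : ∀ s : ℝ, ∀ x ∈ ball x₀ (2 * (R / 4)), 0 < ‖x‖ ^ s := fun s x hx =>
    Real.rpow_pos_of_pos (norm_pos_iff.2 (hne x hx)) s
  have hR4 : 0 < R / 4 := by linarith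
  obtain ⟨u', hu'2, hu'0, hu'⟩ := exists_contDiff_eqOn hR4 (hu2.mono hsub)
    fun x hx => hu0 x (hsub hx).1
  obtain ⟨v', hv'2, hv'0, hv'⟩ := exists_contDiff_eqOn hR4 (hv2.mono hsub)
    fun x hx => hv0 x (hsub hx).1
  obtain ⟨c, hc2, -, hc⟩ := exists_contDiff_eqOn hR4 (hwC a) (hwp a)
  obtain ⟨d, hd2, -, hd⟩ := exists_contDiff_eqOn hR4 (hwC b) (hwp b)
  have hx₀mem : x₀ ∈ ball x₀ (R / 4) := mem_ball_self hR4
  set M : EuclideanSpace ℝ (Fin (n + 1)) → ℝ := fun x =>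
    (R ^ τ * u' x) ^ α⁻¹ + (R ^ τ' * v' x) ^ β⁻¹ with hM
  have hup : ∀ x, 0 < R ^ τ * u' x := fun x => mul_pos (by positivity) (hu'0 x)
  have hvp : ∀ x, 0 < R ^ τ' * v' x := fun x => mul_pos (by positivity) (hv'0 x)
  have hMc : Continuous M :=
    ((continuous_const.mul hu'2.continuous).rpow_const fun x => Or.inl (hup x).ne').add
      ((continuous_const.mul hv'2.continuous).rpow_const fun x => Or.inl (hvp x).ne')
  have hM0 : ∀ x, 0 < M x := fun x =>
    add_pos (Real.rpow_pos_of_pos (hup x) _) (Real.rpow_pos_of_pos (hvp x) _)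
  have hbig : 2 * K < δ * R * M x₀ := by
    rw [hM]
    simp only
    rw [hu' hx₀mem, hv' hx₀mem]
    rw [div_div, div_lt_iff₀ (by positivity)] at hcon
    linarith
  obtain ⟨x₁, hx₁, hdoub⟩ := exists_doubling_point hMc hM0 (by positivity) hbig
  obtain ⟨t, ht⟩ : ∃ t, t = (M x₁)⁻¹ := ⟨_, rfl⟩
  have ht0 : 0 < t := ht ▸ inv_pos.2 (hM0 x₁)
  have htM : t * M x₁ = 1 := by rw [ht, inv_mul_cancel₀ (hM0 x₁).ne']
  rw [← ht] at hdoub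
  have hmem : ∀ y : EuclideanSpace ℝ (Fin (n + 1)), ‖y‖ ≤ K → x₁ + t • y ∈ ball x₀ (R / 4) := by
    intro y hy
    rw [mem_ball, dist_eq_norm]
    refine (hdoub y hy).1.trans_le ?_
    nlinarith
  have hbb : ball x₀ (R / 4) ⊆ ball x₀ (2 * (R / 4)) := ball_subset_ball (by linarith)
  have hty : ∀ y : EuclideanSpace ℝ (Fin (n + 1)), ‖y‖ ≤ K → ‖t • y‖ ≤ 2 * (δ * R) := by
    intro y hy
    have h1 := norm_sub_le (x₁ + t • y - x₀) (x₁ - x₀)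
    rw [show x₁ + t • y - x₀ - (x₁ - x₀) = t • y by abel] at h1
    linarith [(hdoub y hy).1]
  have hlap : ∀ {f g : EuclideanSpace ℝ (Fin (n + 1)) → ℝ}, EqOn f g (ball x₀ (R / 4)) →
      ∀ x ∈ ball x₀ (R / 4), lap f x = lap g x := fun h x hx => lap_congr isOpen_ball h hx
  have hfd : ∀ {f g : EuclideanSpace ℝ (Fin (n + 1)) → ℝ}, EqOn f g (ball x₀ (R / 4)) →
      ∀ x ∈ ball x₀ (R / 4), fderiv ℝ f x = fderiv ℝ g x := fun h x hx =>
    (h.eventuallyEq_of_mem (isOpen_ball.mem_nhds hx)).fderiv_eq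
  have hlin : ContDiff ℝ 2 fun y : EuclideanSpace ℝ (Fin (n + 1)) => x₁ + t • y :=
    contDiff_const.add (contDiff_id.const_smul t)
  have hSys : IsSys p q η K (fun y => t ^ α * R ^ τ * u' (x₁ + t • y))
      (fun y => t ^ β * R ^ τ' * v' (x₁ + t • y)) (fun y => R ^ (-a) * c (x₁ + t • y))
      (fun y => R ^ (-b) * d (x₁ + t • y)) :=
    { contDiff_left := contDiff_const.mul (hu'2.comp hlin)
      contDiff_right := contDiff_const.mul (hv'2.comp hlin)
      contDiff_coeff_left := (contDiff_const.mul (hc2.comp hlin)).of_le (by norm_num)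
      contDiff_coeff_right := (contDiff_const.mul (hd2.comp hlin)).of_le (by norm_num)
      left_pos := fun y => mul_pos (by positivity) (hu'0 _)
      right_pos := fun y => mul_pos (by positivity) (hv'0 _)
      coeff_left_mem := fun y hy => by
        rw [hc (hmem y hy)]
        exact (hwa hx₀ hR.symm (hdoub y hy).1).1
      coeff_right_mem := fun y hy => by
        rw [hd (hmem y hy)]
        exact (hwb hx₀ hR.symm (hdoub y hy).1).1
      lap_left := fun y hy => neg_lap_rescaled hu'2 ht0 hx₀ e1 f1 x₁ y (hv'0 _) (by
        rw [hlap hu' _ (hmem y hy), hc (hmem y hy), hv' (hmem y hy)]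
        exact hlu _ (hsub (hbb (hmem y hy))))
      lap_right := fun y hy => neg_lap_rescaled hv'2 ht0 hx₀ e2 f2 x₁ y (hu'0 _) (by
        rw [hlap hv' _ (hmem y hy), hd (hmem y hy), hu' (hmem y hy)]
        exact hlv _ (hsub (hbb (hmem y hy))))
      radial_left := fun y hy => by
        rw [fderiv_affine_apply (hc2.differentiable (by norm_num)), hfd hc _ (hmem y hy)]
        exact (hwa hx₀ hR.symm (hdoub y hy).1).2 _ (hty y hy)
      radial_right := fun y hy => by
        rw [fderiv_affine_apply (hd2.differentiable (by norm_num)), hfd hd _ (hmem y hy)]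
        exact (hwb hx₀ hR.symm (hdoub y hy).1).2 _ (hty y hy) }
  have hroot : ∀ {s w k : ℝ}, 0 < s → 0 < w → 0 ≤ k → t * w ^ s⁻¹ ≤ k → t ^ s * w ≤ k ^ s := by
    intro s w k hs hw hk h
    have h1 := Real.rpow_le_rpow (by positivity) h hs.le
    rwa [Real.mul_rpow ht0.le (by positivity), Real.rpow_inv_rpow hw.le hs.ne'] at h1
  have hroot' : ∀ {s w k : ℝ}, 0 < s → 0 < w → 0 ≤ k → t ^ s * w < k ^ s → t * w ^ s⁻¹ < k := by
    intro s w k hs hw hk h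
    refine (Real.rpow_lt_rpow_iff (by positivity) hk hs).1 ?_
    rwa [Real.mul_rpow ht0.le (by positivity), Real.rpow_inv_rpow hw.le hs.ne']
  have hM2 : ∀ y : EuclideanSpace ℝ (Fin (n + 1)), ‖y‖ ≤ K → t * M (x₁ + t • y) ≤ 2 := by
    intro y hy
    have := mul_le_mul_of_nonneg_left (hdoub y hy).2 ht0.le
    linarith
  obtain ⟨hU, hV⟩ := hsmall hSys
    (fun y hy => by
      rw [mul_assoc]
      refine hroot hα0 (hup _) zero_le_two (le_trans ?_ (hM2 y hy))
      exact mul_le_mul_of_nonneg_left (le_add_of_nonneg_right (Real.rpow_nonneg (hvp _).le _)) ht0.le)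
    (fun y hy => by
      rw [mul_assoc]
      refine hroot hβ0 (hvp _) zero_le_two (le_trans ?_ (hM2 y hy))
      exact mul_le_mul_of_nonneg_left (le_add_of_nonneg_left (Real.rpow_nonneg (hup _).le _)) ht0.le)
  simp only [smul_zero, add_zero, mul_assoc] at hU hV
  have h1 := hroot' hα0 (hup x₁) one_half_pos.le (hU.trans_le (min_le_left _ _))
  have h2 := hroot' hβ0 (hvp x₁) one_half_pos.le (hV.trans_le (min_le_right _ _))
  have h3 : t * M x₁ = t * (R ^ τ * u' x₁) ^ α⁻¹ + t * (R ^ τ' * v' x₁) ^ β⁻¹ := mul_add _ _ _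
  linarith

theorem le_mul_rpow_of_rpow_inv_le {R w C α τ : ℝ} (hR : 0 < R) (hw : 0 < w) (hC : 0 < C)
    (hα : 0 < α) (h : (R ^ τ * w) ^ α⁻¹ ≤ C / R) : w ≤ C ^ α * R ^ (-α - τ) := by
  have h1 := Real.rpow_le_rpow (by positivity) h hα.le
  rw [Real.rpow_inv_rpow (by positivity) hα.ne', Real.div_rpow hC.le hR.le] at h1
  have h2 : R ^ (-α - τ) = (R ^ α)⁻¹ * (R ^ τ)⁻¹ := by
    rw [Real.rpow_sub hR, Real.rpow_neg hR.le, div_eq_mul_inv]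
  rw [h2, ← mul_assoc, ← div_eq_mul_inv, ← div_eq_mul_inv, le_div_iff₀ (by positivity)]
  linarith

end Conclusion

/-- Theorem 1.3 (i): singularity estimate for positive solutions of the Hardy–Hénon
system on a punctured ball. -/
theorem singularity_estimate
    (N : ℕ) (hN : 3 ≤ N) (a b p q : ℝ) (ha : -2 < a) (hb : -2 < b)
    (hq : 0 < q) (hqp : q ≤ p) (hpq : 1 < p * q)
    (hhyper : (N : ℝ) / (p + 1) + (N : ℝ) / (q + 1) > (N : ℝ) - 2)
    (halpha : 2 * (p + 1) / (p * q - 1) > (N : ℝ) - 3) :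
    ∃ C > 0, ∀ ρ > (0 : ℝ), ∀ u v : EuclideanSpace ℝ (Fin N) → ℝ,
      IsHHSol a b p q {x : EuclideanSpace ℝ (Fin N) | 0 < ‖x‖ ∧ ‖x‖ < ρ} u v →
      ∀ x : EuclideanSpace ℝ (Fin N), 0 < ‖x‖ → ‖x‖ < ρ / 2 →
        u x ≤ C * ‖x‖ ^ (-(2 * (p + 1) / (p * q - 1)) - (a + b * p) / (p * q - 1)) ∧
        v x ≤ C * ‖x‖ ^ (-(2 * (q + 1) / (p * q - 1)) - (b + a * q) / (p * q - 1)) := by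
  obtain ⟨n, rfl⟩ : ∃ n, N = n + 1 := ⟨N - 1, by omega⟩
  have hp : 0 < p := hq.trans_le hqp
  obtain ⟨C, hC, h⟩ := IsHHSol.exists_rpow_add_rpow_le (a := a) (b := b) (n := n) (by omega) hq hqp
    hpq hhyper (by push_cast at halpha; linarith)
  refine ⟨max (C ^ (2 * (p + 1) / (p * q - 1))) (C ^ (2 * (q + 1) / (p * q - 1))), by positivity,
    fun ρ hρ u v hsol x hx hxρ => ?_⟩
  have hpq' : 0 < p * q - 1 := by linarith
  have hux := hsol.2.2.2.2.1 x ⟨hx, by linarith⟩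
  have hvx := hsol.2.2.2.2.2.1 x ⟨hx, by linarith⟩
  have hx' := h ρ hρ u v hsol x hx hxρ
  constructor
  · refine (le_mul_rpow_of_rpow_inv_le hx hux hC (by positivity)
      (le_trans (le_add_of_nonneg_right (by positivity)) hx')).trans ?_
    exact mul_le_mul_of_nonneg_right (le_max_left _ _) (by positivity)
  · refine (le_mul_rpow_of_rpow_inv_le hx hvx hC (by positivity)
      (le_trans (le_add_of_nonneg_left (by positivity)) hx')).trans ?_
    exact mul_le_mul_of_nonneg_right (le_max_right _ _) (by positivity)
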